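/- For all η, ε ∈ (0,1] there exists C > 0 such that for every c > 0 there is n₀ ∈ ℕ with the following property: for all n ≥ n₀, every d with C·log n ≤ d ≤ n−1 and dn even, and every integer m with ε·d·n ≤ m ≤ dn/2, if F ~ F⁻(n,d,m), then with probability at least 1 − c·n^{−2} the following holds: for all e, f ∈ [n]^(2) ∖ E(F), |{K ∈ 𝒦_d(n) : F + e ⊆ K}| ≤ (1+η)·|{K ∈ 𝒦_d(n) : F + f ⊆ K}|. (Lemma 2.1.) -/

import Mathlib

open scoped Classical ENNReal

noncomputable section

namespace Sandwich

variable {n : ℕ}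

/-- The degree of the vertex `v` in the graph `G`. -/
def deg (G : SimpleGraph (Fin n)) (v : Fin n) : ℕ := Nat.card (G.neighborSet v)

/-- `G` is a `d`-regular graph. -/
def IsRegularGraph (G : SimpleGraph (Fin n)) (d : ℕ) : Prop := ∀ v, deg G v = d

/-- The number of edges of `G`. -/
def edgeCount (G : SimpleGraph (Fin n)) : ℕ := G.edgeSet.ncard

/-- The probability of the event `P` under the probability mass function `μ`. -/
def prEvent {α : Type*} (μ : PMF α) (P : α → Prop) : ℝ≥0∞ := ∑' a, if P a then μ a else 0

/-- `μ` is the uniform distribution on the set `S`. -/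
def IsUniformOn {α : Type*} (μ : PMF α) (S : Set α) : Prop :=
  ∀ a, μ a = if a ∈ S then (S.ncard : ℝ≥0∞)⁻¹ else 0

/-- `P` lists the `k+1` vertices of a `(G₁,G₂)`-alternating path of length `k`: the vertices
are distinct and consecutive vertices are joined by an edge of `G₁` (for steps of even index)
or of `G₂` (for steps of odd index). -/
def IsAltSeq (G₁ G₂ : SimpleGraph (Fin n)) (k : ℕ) (P : Fin (k + 1) → Fin n) : Prop :=
  Function.Injective P ∧
    ∀ i : Fin k, if (i : ℕ) % 2 = 0 then G₁.Adj (P i.castSucc) (P i.succ)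
      else G₂.Adj (P i.castSucc) (P i.succ)

/-- The number of `(G₁,G₂)`-alternating `x,y`-paths of length `k` with no internal vertex
in `Z`. -/
def altPathCount (G₁ G₂ : SimpleGraph (Fin n)) (k : ℕ) (x y : Fin n) (Z : Set (Fin n)) : ℕ :=
  Nat.card {P : Fin (k + 1) → Fin n // IsAltSeq G₁ G₂ k P ∧ P 0 = x ∧ P (Fin.last k) = y ∧
    ∀ i : Fin (k + 1), i ≠ 0 → i ≠ Fin.last k → P i ∉ Z}

/-- The number of `(G₁,G₂)`-alternating paths of length `k` starting at `x`. -/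
def altStartCount (G₁ G₂ : SimpleGraph (Fin n)) (k : ℕ) (x : Fin n) : ℕ :=
  Nat.card {P : Fin (k + 1) → Fin n // IsAltSeq G₁ G₂ k P ∧ P 0 = x}

/-- The external neighbourhood `N_G(U)` of a set of vertices `U`. -/
def nbhd (G : SimpleGraph (Fin n)) (U : Set (Fin n)) : Set (Fin n) :=
  {v | v ∉ U ∧ ∃ u ∈ U, G.Adj u v}

/-- `e_G(U)`, the number of edges of `G` with both endpoints in `U`. -/
def edgesWithin (G : SimpleGraph (Fin n)) (U : Set (Fin n)) : ℕ :=
  {e ∈ G.edgeSet | ∀ v ∈ e, v ∈ U}.ncard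

/-- `e_G(U,V) = |{(u,v) : u ∈ U, v ∈ V, uv ∈ E(G)}|`. -/
def edgesBetween (G : SimpleGraph (Fin n)) (U V : Set (Fin n)) : ℕ :=
  {p : Fin n × Fin n | p.1 ∈ U ∧ p.2 ∈ V ∧ G.Adj p.1 p.2}.ncard

/-- `|E_{≥2,G}(U)|`, the number of edges `xy ∈ E(G)` with `x ∈ U`, `y ∉ U` such that some
`x' ∈ U ∖ {x}` also satisfies `x'y ∈ E(G)`. -/
def E2count (G : SimpleGraph (Fin n)) (U : Set (Fin n)) : ℕ :=
  {e : Sym2 (Fin n) | e ∈ G.edgeSet ∧ ∃ x y, e = s(x, y) ∧ x ∈ U ∧ y ∉ U ∧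
    ∃ x' ∈ U, x' ≠ x ∧ G.Adj x' y}.ncard

/-- `Σ_{u ∈ N_{F∖K}(v)} Σ_{u' ∈ N_K(u)} d_{F∖K}(u')`. -/
def doubleDegSum (F K : SimpleGraph (Fin n)) (v : Fin n) : ℝ :=
  ∑ u : Fin n, if (F \ K).Adj v u then
    ∑ u' : Fin n, if K.Adj u u' then (deg (F \ K) u' : ℝ) else 0
  else 0

/-- `μ` is the law of the binomial random graph `G(n,p)`. -/
def IsGnp (μ : PMF (SimpleGraph (Fin n))) (p : ℝ) : Prop :=
  ∀ G, μ G = ENNReal.ofReal (p ^ edgeCount G * (1 - p) ^ (n.choose 2 - edgeCount G))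

/-- `μ` is the law of `G(n,p)`, where `p` is truncated to `[0,1]` (so that `G(n,p)` is the
empty graph for `p ≤ 0` and the complete graph for `p ≥ 1`). -/
def IsGnpLaw (μ : PMF (SimpleGraph (Fin n))) (p : ℝ) : Prop :=
  IsGnp μ (max 0 (min p 1))

/-- `μ` is the law of `K + E`, where `E` includes each pair not in `E(K)` independently with
probability `p`. -/
def IsAddGnp (μ : PMF (SimpleGraph (Fin n))) (K : SimpleGraph (Fin n)) (p : ℝ) : Prop :=
  ∀ F, μ F = if K ≤ F then
      ENNReal.ofReal (p ^ (edgeCount F - edgeCount K) * (1 - p) ^ (n.choose 2 - edgeCount F))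
    else 0

/-- `ν` is the joint law of `(K, F)` where `K ~ G_d(n)` is a uniformly random `d`-regular graph
and `F = K + E`, `E` including each pair not in `E(K)` independently with probability `p`. -/
def IsRegAddGnp (ν : PMF (SimpleGraph (Fin n) × SimpleGraph (Fin n))) (d : ℕ) (p : ℝ) : Prop :=
  ∀ w, ν w = if IsRegularGraph w.1 d ∧ w.1 ≤ w.2 then
      ({G : SimpleGraph (Fin n) | IsRegularGraph G d}.ncard : ℝ≥0∞)⁻¹ *
        ENNReal.ofReal (p ^ (edgeCount w.2 - edgeCount w.1) *
          (1 - p) ^ (n.choose 2 - edgeCount w.2))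
    else 0

/-- `ν` is the joint law of an independent pair `(K, F)` with `K ~ G_d(n)` and `F ~ G(n,q)`. -/
def IsRegIndepGnp (ν : PMF (SimpleGraph (Fin n) × SimpleGraph (Fin n))) (d : ℕ) (q : ℝ) :
    Prop :=
  ∀ w, ν w = (if IsRegularGraph w.1 d then
      ({G : SimpleGraph (Fin n) | IsRegularGraph G d}.ncard : ℝ≥0∞)⁻¹ else 0) *
      ENNReal.ofReal (q ^ edgeCount w.2 * (1 - q) ^ (n.choose 2 - edgeCount w.2))

theorem choose_sub_mul_pow_le (N k j : ℕ) (hk : k ≤ N) (hj : j ≤ k) :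
    (N - j).choose (k - j) * N ^ j ≤ N.choose k * k ^ j := by
  induction j with
  | zero => simp
  | succ j ih =>
    have ih := ih (by omega)
    obtain ⟨a, rfl⟩ : ∃ a, k = a + j + 1 := ⟨k - j - 1, by omega⟩
    obtain ⟨b, rfl⟩ : ∃ b, N = b + j + 1 := ⟨N - j - 1, by omega⟩
    have e1 : b + j + 1 - (j + 1) = b := by omega
    have e2 : a + j + 1 - (j + 1) = a := by omega
    have e3 : b + j + 1 - j = b + 1 := by omega
    have e4 : a + j + 1 - j = a + 1 := by omega
    rw [e3, e4] at ih
    rw [e1, e2]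
    have h := Nat.add_one_mul_choose_eq b a
    have h2 : (a + 1) * (b + j + 1) ≤ (a + j + 1) * (b + 1) := by nlinarith
    refine le_of_mul_le_mul_left ?_ (show 0 < b + 1 by omega)
    calc (b + 1) * (b.choose a * (b + j + 1) ^ (j + 1))
        = ((b + 1) * b.choose a) * (b + j + 1) ^ j * (b + j + 1) := by ring
      _ = ((b + 1).choose (a + 1) * (b + j + 1) ^ j) * ((a + 1) * (b + j + 1)) := by rw [h]; ring
      _ ≤ ((b + j + 1).choose (a + j + 1) * (a + j + 1) ^ j) * ((a + j + 1) * (b + 1)) :=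
          Nat.mul_le_mul ih h2
      _ = _ := by ring

theorem card_filter_superset_powersetCard_le {α : Type*} (X T : Finset α) (k : ℕ)
    (hX : 0 < X.card) (hk : k ≤ X.card) (hT : T ⊆ X) :
    (((X.powersetCard k).filter (fun E => T ⊆ E)).card : ℝ) ≤
      (X.card.choose k : ℝ) * ((k : ℝ) / X.card) ^ T.card := by
  have hX' : (0 : ℝ) < X.card := by exact_mod_cast hX
  rcases le_or_gt T.card k with h | h
  · have h1 := choose_sub_mul_pow_le X.card k T.card hk h
    rw [Finset.card_filter_powersetCard_subset _ _ _ (by assumption) (by assumption),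
      div_pow, ← mul_div_assoc, le_div_iff₀ (by positivity)]
    exact_mod_cast h1
  · rw [Finset.filter_false_of_mem]
    · simp; positivity
    · intro E hE hTE
      have := Finset.card_le_card hTE
      rw [(Finset.mem_powersetCard.1 hE).2] at this
      omega

/-- Negative dependence of uniformly random `k`-subsets. -/
theorem sum_powersetCard_prod_one_add_le {α : Type*} (X : Finset α) (k : ℕ)
    (hX : 0 < X.card) (hk : k ≤ X.card) (f : α → ℝ) (hf : ∀ e ∈ X, 0 ≤ f e) :
    ∑ E ∈ X.powersetCard k, ∏ e ∈ E, (1 + f e) ≤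
      (X.card.choose k : ℝ) * ∏ e ∈ X, (1 + (k : ℝ) / X.card * f e) := by
  have h1 : ∀ E ∈ X.powersetCard k, ∏ e ∈ E, (1 + f e) =
      ∑ T ∈ X.powerset, if T ⊆ E then ∏ e ∈ T, f e else 0 := by
    intro E hE
    rw [Finset.prod_one_add, ← Finset.sum_filter]
    apply Finset.sum_congr _ (fun _ _ => rfl)
    ext T
    simp only [Finset.mem_powerset, Finset.mem_filter]
    exact ⟨fun h => ⟨h.trans (Finset.mem_powersetCard.1 hE).1, h⟩, fun h => h.2⟩
  rw [Finset.sum_congr rfl h1, Finset.sum_comm, Finset.prod_one_add, Finset.mul_sum]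
  apply Finset.sum_le_sum
  intro T hT
  rw [Finset.mem_powerset] at hT
  have h2 : 0 ≤ ∏ e ∈ T, f e := Finset.prod_nonneg fun e he => hf e (hT he)
  rw [← Finset.sum_filter, Finset.sum_const, nsmul_eq_mul, Finset.prod_mul_distrib,
    Finset.prod_const, ← mul_assoc]
  exact mul_le_mul_of_nonneg_right (card_filter_superset_powersetCard_le X T k hX hk hT) h2

/-- Upper tail bound for sums over uniformly random `k`-subsets. -/
theorem card_powersetCard_upper_tail {α : Type*} (X : Finset α) (k : ℕ)
    (hX : 0 < X.card) (hk : k ≤ X.card) (w : α → ℝ) (hw0 : ∀ e ∈ X, 0 ≤ w e)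
    (hw1 : ∀ e ∈ X, w e ≤ 1) (t s : ℝ) (ht : 0 < t) (hwt : ∑ e ∈ X, w e ≤ t)
    (hs : 0 ≤ s) (hst : s ≤ 2 * t) :
    (((X.powersetCard k).filter
      (fun E => (k : ℝ) / X.card * ∑ e ∈ X, w e + s ≤ ∑ e ∈ E, w e)).card : ℝ) ≤
      (X.card.choose k : ℝ) * Real.exp (-(s ^ 2 / (4 * t))) := by
  set q : ℝ := (k : ℝ) / X.card with hq
  set W := ∑ e ∈ X, w e with hW
  have hX' : (0 : ℝ) < X.card := by exact_mod_cast hX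
  have hq0 : 0 ≤ q := by positivity
  have hq1 : q ≤ 1 := by rw [hq, div_le_one hX']; exact_mod_cast hk
  set u : ℝ := s / (2 * t) with hu
  have hu0 : 0 ≤ u := by positivity
  have hu1 : u ≤ 1 := by rw [hu, div_le_one (by positivity)]; exact hst
  have hbound : ∀ e ∈ X, Real.exp (u * w e) - 1 ≤ u * w e + u ^ 2 * w e := by
    intro e he
    have h0 := hw0 e he
    have h1 := hw1 e he
    have h2 : |u * w e| ≤ 1 := by
      rw [abs_of_nonneg (by positivity)]
      nlinarith
    have h3 := Real.abs_exp_sub_one_sub_id_le h2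
    have h4 := (abs_le.1 h3).2
    have h5 : w e ^ 2 ≤ w e := by nlinarith
    nlinarith [mul_le_mul_of_nonneg_left h5 (sq_nonneg u)]
  have h1 : (((X.powersetCard k).filter (fun E => q * W + s ≤ ∑ e ∈ E, w e)).card : ℝ) ≤
      ∑ E ∈ X.powersetCard k, Real.exp (u * (∑ e ∈ E, w e) - u * (q * W + s)) := by
    rw [Finset.card_filter, Nat.cast_sum]
    apply Finset.sum_le_sum
    intro E _
    split_ifs with h
    · rw [Nat.cast_one, Real.one_le_exp_iff]
      nlinarith
    · simpa using (Real.exp_pos _).le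
  have h2 : ∑ E ∈ X.powersetCard k, Real.exp (u * (∑ e ∈ E, w e) - u * (q * W + s)) =
      Real.exp (-(u * (q * W + s))) *
        ∑ E ∈ X.powersetCard k, ∏ e ∈ E, (1 + (Real.exp (u * w e) - 1)) := by
    rw [Finset.mul_sum (Finset.powersetCard k X)]
    apply Finset.sum_congr rfl
    intro E _
    simp only [add_sub_cancel]
    rw [← Real.exp_sum, ← Real.exp_add, Finset.mul_sum]
    congr 1
    ring
  have h3 := sum_powersetCard_prod_one_add_le X k hX hk (fun e => Real.exp (u * w e) - 1)
    (fun e he => by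
      have : 0 ≤ u * w e := mul_nonneg hu0 (hw0 e he)
      have := Real.one_le_exp this
      linarith)
  have h4 : ∏ e ∈ X, (1 + q * (Real.exp (u * w e) - 1)) ≤
      Real.exp (q * u * W + u ^ 2 * t) := by
    calc ∏ e ∈ X, (1 + q * (Real.exp (u * w e) - 1))
        ≤ ∏ e ∈ X, Real.exp (q * (u * w e + u ^ 2 * w e)) := by
          apply Finset.prod_le_prod
          · intro e he
            have : 0 ≤ u * w e := mul_nonneg hu0 (hw0 e he)
            have := Real.one_le_exp this
            have : 0 ≤ q * (Real.exp (u * w e) - 1) := mul_nonneg hq0 (by linarith)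
            linarith
          · intro e he
            have := mul_le_mul_of_nonneg_left (hbound e he) hq0
            linarith [Real.add_one_le_exp (q * (u * w e + u ^ 2 * w e))]
      _ = Real.exp (q * u * W + q * u ^ 2 * W) := by
          rw [← Real.exp_sum]
          congr 1
          rw [← Finset.mul_sum, Finset.sum_add_distrib, ← Finset.mul_sum, ← Finset.mul_sum]
          ring
      _ ≤ _ := by
          apply Real.exp_le_exp.2
          have hW0 : 0 ≤ W := Finset.sum_nonneg hw0
          have : q * W ≤ t := by nlinarith
          nlinarith [mul_le_mul_of_nonneg_left this (sq_nonneg u)]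
  calc _ ≤ _ := h1
    _ = _ := h2
    _ ≤ Real.exp (-(u * (q * W + s))) *
        ((X.card.choose k : ℝ) * Real.exp (q * u * W + u ^ 2 * t)) := by
        apply mul_le_mul_of_nonneg_left _ (Real.exp_pos _).le
        exact h3.trans (mul_le_mul_of_nonneg_left h4 (by positivity))
    _ = (X.card.choose k : ℝ) * Real.exp (-(s ^ 2 / (4 * t))) := by
        rw [mul_left_comm, ← Real.exp_add]
        congr 2
        rw [hu]
        field_simp
        ring

/-- Lower tail bound for sums over uniformly random `k`-subsets. -/
theorem card_powersetCard_lower_tail {α : Type*} (X : Finset α) (k : ℕ)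
    (hX : 0 < X.card) (hk : k ≤ X.card) (w : α → ℝ) (hw0 : ∀ e ∈ X, 0 ≤ w e)
    (hw1 : ∀ e ∈ X, w e ≤ 1) (t s : ℝ) (ht : 0 < t) (hwt : ∑ e ∈ X, w e ≤ t)
    (hs : 0 ≤ s) (hst : s ≤ 2 * t) :
    (((X.powersetCard k).filter
      (fun E => ∑ e ∈ E, w e ≤ (k : ℝ) / X.card * ∑ e ∈ X, w e - s)).card : ℝ) ≤
      (X.card.choose k : ℝ) * Real.exp (-(s ^ 2 / (4 * t))) := by
  have h := card_powersetCard_upper_tail X (X.card - k) hX (Nat.sub_le _ _) w hw0 hw1 t s ht hwt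
    hs hst
  rw [Nat.choose_symm hk] at h
  refine le_trans ?_ h
  norm_cast
  apply Finset.card_le_card_of_injOn (fun E => X \ E)
  · intro E hE
    simp only [Finset.coe_filter, Finset.mem_powersetCard, Set.mem_ofPred_eq] at hE ⊢
    obtain ⟨⟨hEX, hEk⟩, hE⟩ := hE
    refine ⟨⟨Finset.sdiff_subset, by rw [Finset.card_sdiff_of_subset hEX, hEk]⟩, ?_⟩
    have h1 := Finset.sum_sdiff (f := w) hEX
    have hX' : (0 : ℝ) < X.card := by exact_mod_cast hX
    rw [Nat.cast_sub hk, sub_div, div_self hX'.ne']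
    linarith
  · intro E hE E' hE' h
    simp only [Finset.coe_filter, Finset.mem_powersetCard, Set.mem_ofPred_eq] at hE hE'
    have := congrArg (fun Z => X \ Z) h
    simpa [Finset.sdiff_sdiff_eq_self hE.1.1, Finset.sdiff_sdiff_eq_self hE'.1.1] using this

/-- Two-sided tail bound for sums over uniformly random `k`-subsets. -/
theorem card_powersetCard_tail {α : Type*} (X : Finset α) (k : ℕ)
    (hX : 0 < X.card) (hk : k ≤ X.card) (w : α → ℝ) (hw0 : ∀ e ∈ X, 0 ≤ w e)
    (hw1 : ∀ e ∈ X, w e ≤ 1) (t s : ℝ) (ht : 0 < t) (hwt : ∑ e ∈ X, w e ≤ t)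
    (hs : 0 ≤ s) (hst : s ≤ 2 * t) :
    (((X.powersetCard k).filter
      (fun E => ¬ |∑ e ∈ E, w e - (k : ℝ) / X.card * ∑ e ∈ X, w e| ≤ s)).card : ℝ) ≤
      (X.card.choose k : ℝ) * (2 * Real.exp (-(s ^ 2 / (4 * t)))) := by
  have h1 := card_powersetCard_upper_tail X k hX hk w hw0 hw1 t s ht hwt hs hst
  have h2 := card_powersetCard_lower_tail X k hX hk w hw0 hw1 t s ht hwt hs hst
  have h3 : (((X.powersetCard k).filter
      (fun E => ¬ |∑ e ∈ E, w e - (k : ℝ) / X.card * ∑ e ∈ X, w e| ≤ s)).card : ℝ) ≤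
      (((X.powersetCard k).filter
        (fun E => (k : ℝ) / X.card * ∑ e ∈ X, w e + s ≤ ∑ e ∈ E, w e)).card : ℝ) +
      (((X.powersetCard k).filter
        (fun E => ∑ e ∈ E, w e ≤ (k : ℝ) / X.card * ∑ e ∈ X, w e - s)).card : ℝ) := by
    norm_cast
    refine le_trans (Finset.card_le_card ?_) (Finset.card_union_le _ _)
    intro E hE
    simp only [Finset.mem_filter, Finset.mem_union] at hE ⊢
    by_contra hcon
    push Not at hcon
    apply hE.2
    rw [abs_le]
    constructor <;> linarith [hcon.1 hE.1, hcon.2 hE.1]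
  linarith

/-- The edges of `G` as a finset. -/
def edges (G : SimpleGraph (Fin n)) : Finset (Sym2 (Fin n)) :=
  Finset.univ.filter (fun e => e ∈ G.edgeSet)

@[simp] theorem mem_edges {G : SimpleGraph (Fin n)} {e : Sym2 (Fin n)} :
    e ∈ edges G ↔ e ∈ G.edgeSet := by simp [edges]

theorem edges_eq_edgeFinset (G : SimpleGraph (Fin n)) : edges G = G.edgeFinset := by
  ext e; simp

theorem coe_edges (G : SimpleGraph (Fin n)) : (edges G : Set (Sym2 (Fin n))) = G.edgeSet := by
  ext e; simp

theorem edges_subset_edges {F G : SimpleGraph (Fin n)} : edges F ⊆ edges G ↔ F ≤ G := by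
  rw [← SimpleGraph.edgeSet_subset_edgeSet, ← coe_edges, ← coe_edges, Finset.coe_subset]

theorem edges_injective : Function.Injective (edges : SimpleGraph (Fin n) → _) := by
  intro F G h
  rw [← SimpleGraph.edgeSet_inj, ← coe_edges, ← coe_edges, h]

/-- The graph with edge set `T`. -/
def ofEdges (T : Finset (Sym2 (Fin n))) : SimpleGraph (Fin n) :=
  SimpleGraph.fromEdgeSet (T : Set (Sym2 (Fin n)))

theorem edges_ofEdges {T : Finset (Sym2 (Fin n))} (hT : ∀ e ∈ T, ¬ e.IsDiag) :
    edges (ofEdges T) = T := by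
  ext e
  simp only [mem_edges, ofEdges, SimpleGraph.edgeSet_fromEdgeSet, Set.mem_sdiff, Finset.mem_coe,
    Sym2.mem_diagSet]
  exact ⟨fun h => h.1, fun h => ⟨h, hT e h⟩⟩

theorem ofEdges_edges (G : SimpleGraph (Fin n)) : ofEdges (edges G) = G := by
  rw [ofEdges, coe_edges, SimpleGraph.fromEdgeSet_edgeSet]

theorem not_isDiag_of_mem_edges {G : SimpleGraph (Fin n)} {e : Sym2 (Fin n)} (h : e ∈ edges G) :
    ¬ e.IsDiag := G.not_isDiag_of_mem_edgeSet (mem_edges.1 h)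

theorem edgeCount_eq (G : SimpleGraph (Fin n)) : edgeCount G = (edges G).card := by
  rw [edgeCount, ← coe_edges, Set.ncard_coe_finset]

theorem deg_eq_degree (G : SimpleGraph (Fin n)) (v : Fin n) : deg G v = G.degree v := by
  rw [deg, Nat.card_eq_fintype_card, SimpleGraph.card_neighborSet_eq_degree]

theorem deg_eq_card (G : SimpleGraph (Fin n)) (v : Fin n) :
    deg G v = (Finset.univ.filter (fun u => G.Adj v u)).card := by
  rw [deg_eq_degree, ← SimpleGraph.card_neighborFinset_eq_degree,
    SimpleGraph.neighborFinset_eq_filter]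

theorem deg_eq_card_edges (G : SimpleGraph (Fin n)) (v : Fin n) :
    deg G v = ((edges G).filter (fun e => v ∈ e)).card := by
  rw [deg_eq_degree, ← SimpleGraph.card_incidenceFinset_eq_degree,
    SimpleGraph.incidenceFinset_eq_filter, edges_eq_edgeFinset]

theorem sum_deg (G : SimpleGraph (Fin n)) : ∑ v, deg G v = 2 * (edges G).card := by
  simp_rw [deg_eq_degree, edges_eq_edgeFinset]
  exact SimpleGraph.sum_degrees_eq_twice_card_edges G

theorem deg_mono {F G : SimpleGraph (Fin n)} (h : F ≤ G) (v : Fin n) : deg F v ≤ deg G v := by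
  rw [deg_eq_card, deg_eq_card]
  apply Finset.card_le_card
  intro u
  simp only [Finset.mem_filter, Finset.mem_univ, true_and]
  exact fun hu => h hu

theorem deg_top (v : Fin n) : deg (⊤ : SimpleGraph (Fin n)) v = n - 1 := by
  rw [deg_eq_degree]
  convert SimpleGraph.complete_graph_degree v
  simp

/-- The number of pairs in `A × B` that are adjacent in `G`. -/
def eb (G : SimpleGraph (Fin n)) (A B : Finset (Fin n)) : ℕ :=
  ((A ×ˢ B).filter (fun z => G.Adj z.1 z.2)).card

theorem eb_le (G : SimpleGraph (Fin n)) (A B : Finset (Fin n)) : eb G A B ≤ A.card * B.card := by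
  rw [← Finset.card_product]
  exact Finset.card_filter_le _ _

theorem card_le_n (A : Finset (Fin n)) : A.card ≤ n := by
  simpa using Finset.card_le_univ A

theorem eb_le_sq (G : SimpleGraph (Fin n)) (A B : Finset (Fin n)) : eb G A B ≤ n ^ 2 := by
  rw [sq]
  exact (eb_le G A B).trans (Nat.mul_le_mul (card_le_n A) (card_le_n B))

/-- The number of ordered representatives of `e` in `A × B`. -/
def mult (A B : Finset (Fin n)) (e : Sym2 (Fin n)) : ℕ :=
  ((A ×ˢ B).filter (fun z => s(z.1, z.2) = e)).card

theorem mult_le_two (A B : Finset (Fin n)) (e : Sym2 (Fin n)) : mult A B e ≤ 2 := by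
  induction e with
  | h x y =>
    refine le_trans (Finset.card_le_card (t := {(x, y), (y, x)}) ?_) Finset.card_le_two
    rintro ⟨a, b⟩ h
    simp only [Finset.mem_filter, Sym2.eq_iff] at h
    simpa using h.2

theorem eb_eq_sum_mult (G : SimpleGraph (Fin n)) (A B : Finset (Fin n)) :
    eb G A B = ∑ e ∈ edges G, mult A B e := by
  rw [eb, Finset.card_eq_sum_card_fiberwise (f := fun z => s(z.1, z.2)) (t := edges G)]
  · apply Finset.sum_congr rfl
    intro e he
    rw [mult, Finset.filter_filter]
    congr 1
    apply Finset.filter_congr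
    rintro ⟨a, b⟩ _
    constructor
    · exact fun h => h.2
    · rintro rfl
      exact ⟨by simpa using he, rfl⟩
  · rintro ⟨a, b⟩ h
    simpa using (Finset.mem_filter.1 h).2

theorem eb_top (A B : Finset (Fin n)) :
    eb (⊤ : SimpleGraph (Fin n)) A B + (A ∩ B).card = A.card * B.card := by
  rw [← Finset.card_product, eb,
    ← Finset.card_filter_add_card_filter_not (s := A ×ˢ B) (fun z => z.1 ≠ z.2)]
  simp only [SimpleGraph.top_adj, not_not, ne_eq]
  congr 1
  apply Finset.card_nbij' (fun a => (a, a)) (fun z => z.1)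
  · intro a; simp
  · rintro ⟨a, b⟩; simp only [Finset.coe_filter, Finset.mem_product,
      Set.mem_ofPred_eq, Finset.coe_inter, Set.mem_inter_iff, Finset.mem_coe]
    rintro ⟨⟨h1, h2⟩, rfl⟩; exact ⟨h1, h2⟩
  · intro a; simp
  · rintro ⟨a, b⟩; simp

/-- The subgraphs of `K` with `k` edges. -/
def subs (K : SimpleGraph (Fin n)) (k : ℕ) : Finset (SimpleGraph (Fin n)) :=
  Finset.univ.filter (fun F => F ≤ K ∧ (edges F).card = k)

theorem card_filter_subs (K : SimpleGraph (Fin n)) (k : ℕ) (P : Finset (Sym2 (Fin n)) → Prop)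
    [DecidablePred P] [DecidablePred fun F : SimpleGraph (Fin n) => P (edges F)] :
    ((subs K k).filter (fun F => P (edges F))).card =
      (((edges K).powersetCard k).filter P).card := by
  have key : ∀ T ∈ ((edges K).powersetCard k).filter P, edges (ofEdges T) = T := fun T hT =>
    edges_ofEdges fun e he => not_isDiag_of_mem_edges
      ((Finset.mem_powersetCard.1 (Finset.mem_filter.1 hT).1).1 he)
  apply Finset.card_nbij' edges ofEdges
  · intro F hF
    simpa [subs, Finset.mem_powersetCard, edges_subset_edges] using hF
  · intro T hT
    have h := key T hT
    have hT' := hT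
    simp only [Finset.coe_filter, Finset.mem_powersetCard, Set.mem_ofPred_eq] at hT
    simp only [subs, Finset.coe_filter, Finset.mem_filter, Finset.mem_univ, true_and,
      Set.mem_ofPred_eq]
    rw [← edges_subset_edges, h]
    exact hT
  · intro F _
    exact ofEdges_edges F
  · intro T hT
    exact key T hT

theorem card_subs (K : SimpleGraph (Fin n)) (k : ℕ) :
    (subs K k).card = (edges K).card.choose k := by
  simpa using card_filter_subs K k (fun _ => True)

/-- Degrees of a random subgraph with `k` edges are concentrated. -/
theorem card_deg_tail (K : SimpleGraph (Fin n)) (k : ℕ) (hK : 0 < (edges K).card)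
    (hk : k ≤ (edges K).card) (v : Fin n) (t s : ℝ) (ht : 0 < t) (hv : (deg K v : ℝ) ≤ t)
    (hs : 0 ≤ s) (hst : s ≤ 2 * t) :
    (((subs K k).filter
      (fun F => ¬ |(deg F v : ℝ) - (k : ℝ) / (edges K).card * deg K v| ≤ s)).card : ℝ) ≤
      ((subs K k).card : ℝ) * (2 * Real.exp (-(s ^ 2 / (4 * t)))) := by
  have hd : ∀ G : SimpleGraph (Fin n), (deg G v : ℝ) =
      ∑ e ∈ edges G, if v ∈ e then (1 : ℝ) else 0 := by
    intro G
    rw [deg_eq_card_edges, Finset.card_filter]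
    push_cast
    rfl
  have h := card_powersetCard_tail (edges K) k hK hk (fun e => if v ∈ e then (1 : ℝ) else 0)
    (fun e _ => by positivity) (fun e _ => by split_ifs <;> norm_num) t s ht
    (by rw [← hd]; exact hv) hs hst
  rw [card_subs]
  refine le_trans (le_of_eq ?_) h
  rw [← card_filter_subs K k (fun E => ¬ |(∑ e ∈ E, if v ∈ e then (1 : ℝ) else 0) -
    (k : ℝ) / (edges K).card * ∑ e ∈ edges K, if v ∈ e then (1 : ℝ) else 0| ≤ s)]
  simp_rw [hd]

theorem card_eb_tail (K : SimpleGraph (Fin n)) (k : ℕ) (hK : 0 < (edges K).card)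
    (hk : k ≤ (edges K).card) (A B : Finset (Fin n)) (hn : 0 < n) (γ : ℝ) (h0 : 0 ≤ γ)
    (h1 : γ ≤ 1) :
    (((subs K k).filter (fun F =>
      ¬ |(eb F A B : ℝ) - (k : ℝ) / (edges K).card * eb K A B| ≤ γ * n ^ 2)).card : ℝ) ≤
      ((subs K k).card : ℝ) * (2 * Real.exp (-(γ ^ 2 * n ^ 2 / 16))) := by
  have hn' : (0 : ℝ) < n := by exact_mod_cast hn
  have hd : ∀ G : SimpleGraph (Fin n), (eb G A B : ℝ) =
      2 * ∑ e ∈ edges G, (mult A B e : ℝ) / 2 := by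
    intro G
    rw [eb_eq_sum_mult, ← Finset.sum_div]
    push_cast
    ring
  have hle : ∑ e ∈ edges K, (mult A B e : ℝ) / 2 ≤ (n : ℝ) ^ 2 := by
    have := hd K
    have h2 : (eb K A B : ℝ) ≤ (n : ℝ) ^ 2 := by exact_mod_cast eb_le_sq K A B
    have h3 : (0 : ℝ) ≤ eb K A B := by positivity
    linarith
  have h := card_powersetCard_tail (edges K) k hK hk (fun e => (mult A B e : ℝ) / 2)
    (fun e _ => by positivity)
    (fun e _ => by
      have : (mult A B e : ℝ) ≤ 2 := by exact_mod_cast mult_le_two A B e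
      linarith) ((n : ℝ) ^ 2) (γ * n ^ 2 / 2) (by positivity) hle (by positivity)
    (by nlinarith [sq_nonneg (n : ℝ)])
  have hexp : (γ * (n : ℝ) ^ 2 / 2) ^ 2 / (4 * (n : ℝ) ^ 2) = γ ^ 2 * n ^ 2 / 16 := by
    field_simp; norm_num [mul_assoc]
  rw [card_subs]
  rw [hexp, ← card_filter_subs K k (fun E => ¬ |∑ e ∈ E, (mult A B e : ℝ) / 2 -
    (k : ℝ) / (edges K).card * ∑ e ∈ edges K, (mult A B e : ℝ) / 2| ≤ γ * n ^ 2 / 2)] at h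
  refine le_trans (le_of_eq ?_) h
  congr 2
  apply Finset.filter_congr
  intro F _
  rw [hd F, hd K, mul_left_comm, ← mul_sub, abs_mul, abs_two, not_iff_not]
  constructor <;> intro h <;> linarith

/-- The edge counts of `F` are close to `q` times those of `K` in cut norm. -/
def CutClose (F K : SimpleGraph (Fin n)) (q γ : ℝ) : Prop :=
  ∀ A B : Finset (Fin n), |(eb F A B : ℝ) - q * eb K A B| ≤ γ * n ^ 2

theorem card_filter_not_forall_le {α β : Type*} [Fintype β] (S : Finset α) (P : α → β → Prop)
    (c : ℝ) (h : ∀ b, ((S.filter (fun a => ¬ P a b)).card : ℝ) ≤ c) :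
    ((S.filter (fun a => ¬ ∀ b, P a b)).card : ℝ) ≤ Fintype.card β * c := by
  calc ((S.filter (fun a => ¬ ∀ b, P a b)).card : ℝ)
      ≤ ((Finset.univ.biUnion fun b => S.filter (fun a => ¬ P a b)).card : ℝ) := by
        norm_cast
        apply Finset.card_le_card
        intro a ha
        simp only [Finset.mem_filter, not_forall, Finset.mem_biUnion, Finset.mem_univ,
          true_and] at ha ⊢
        obtain ⟨h1, b, hb⟩ := ha
        exact ⟨b, h1, hb⟩
    _ ≤ ∑ b : β, ((S.filter (fun a => ¬ P a b)).card : ℝ) := by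
        exact_mod_cast Finset.card_biUnion_le
    _ ≤ ∑ b : β, c := Finset.sum_le_sum fun b _ => h b
    _ = _ := by simp

theorem card_not_cutClose_le (K : SimpleGraph (Fin n)) (k : ℕ) (hK : 0 < (edges K).card)
    (hk : k ≤ (edges K).card) (hn : 0 < n) (γ : ℝ) (h0 : 0 ≤ γ) (h1 : γ ≤ 1) :
    (((subs K k).filter
      (fun F => ¬ CutClose F K ((k : ℝ) / (edges K).card) γ)).card : ℝ) ≤
      (2 * 4 ^ n * Real.exp (-(γ ^ 2 * n ^ 2 / 16))) * ((subs K k).card : ℝ) := by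
  have h := card_filter_not_forall_le (β := Finset (Fin n) × Finset (Fin n)) (subs K k)
    (fun F b => |(eb F b.1 b.2 : ℝ) - (k : ℝ) / (edges K).card * eb K b.1 b.2| ≤ γ * n ^ 2) _
    (fun b => card_eb_tail K k hK hk b.1 b.2 hn γ h0 h1)
  have e : (Fintype.card (Finset (Fin n) × Finset (Fin n)) : ℝ) = 4 ^ n := by
    simp [Fintype.card_prod, Fintype.card_finset, ← mul_pow]
  rw [e] at h
  refine le_trans (le_of_eq ?_) (h.trans (le_of_eq (by ring)))
  congr 2
  apply Finset.filter_congr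
  intro F _
  simp [CutClose, Prod.forall]

theorem card_not_deg_close_le (K : SimpleGraph (Fin n)) (k : ℕ) (hK : 0 < (edges K).card)
    (hk : k ≤ (edges K).card) (t s : ℝ) (ht : 0 < t) (hv : ∀ v, (deg K v : ℝ) ≤ t)
    (hs : 0 ≤ s) (hst : s ≤ 2 * t) :
    (((subs K k).filter
      (fun F => ¬ ∀ v, |(deg F v : ℝ) - (k : ℝ) / (edges K).card * deg K v| ≤ s)).card : ℝ) ≤
      (2 * n * Real.exp (-(s ^ 2 / (4 * t)))) * ((subs K k).card : ℝ) := by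
  have h := card_filter_not_forall_le (subs K k)
    (fun F v => |(deg F v : ℝ) - (k : ℝ) / (edges K).card * deg K v| ≤ s) _
    (fun v => card_deg_tail K k hK hk v t s ht (hv v) hs hst)
  rw [Fintype.card_fin] at h
  rw [mul_left_comm, ← mul_assoc] at h
  rw [mul_comm (2 * (n : ℝ) * _), mul_assoc 2, mul_left_comm 2, ← mul_assoc]
  convert h

/-- The graph obtained from `K` by removing the edges in `R` and adding those in `A`. -/
def swap (K : SimpleGraph (Fin n)) (R A : Finset (Sym2 (Fin n))) : SimpleGraph (Fin n) :=
  ofEdges ((edges K \ R) ∪ A)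

theorem edges_swap (K : SimpleGraph (Fin n)) (R : Finset (Sym2 (Fin n)))
    {A : Finset (Sym2 (Fin n))} (hA : ∀ e ∈ A, ¬ e.IsDiag) :
    edges (swap K R A) = (edges K \ R) ∪ A := by
  apply edges_ofEdges
  intro e he
  rcases Finset.mem_union.1 he with h | h
  · exact not_isDiag_of_mem_edges (Finset.mem_sdiff.1 h).1
  · exact hA e h

theorem swap_swap {K : SimpleGraph (Fin n)} {R A : Finset (Sym2 (Fin n))}
    (hA : ∀ e ∈ A, ¬ e.IsDiag) (hRK : R ⊆ edges K) (hAK : Disjoint A (edges K)) :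
    swap (swap K R A) A R = K := by
  apply edges_injective
  rw [edges_swap _ _ fun e he => not_isDiag_of_mem_edges (hRK he), edges_swap _ _ hA]
  ext e
  simp only [Finset.mem_union, Finset.mem_sdiff]
  have h1 : e ∈ R → e ∈ edges K := fun h => hRK h
  have h2 : e ∈ A → e ∉ edges K := fun h => Finset.disjoint_left.1 hAK h
  tauto

theorem deg_swap {K : SimpleGraph (Fin n)} {R A : Finset (Sym2 (Fin n))}
    (hA : ∀ e ∈ A, ¬ e.IsDiag) (hRK : R ⊆ edges K) (hAK : Disjoint A (edges K)) (v : Fin n) :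
    deg (swap K R A) v + (R.filter (fun e => v ∈ e)).card =
      deg K v + (A.filter (fun e => v ∈ e)).card := by
  rw [deg_eq_card_edges, deg_eq_card_edges, edges_swap _ _ hA, Finset.filter_union,
    Finset.card_union_of_disjoint]
  · have : (edges K \ R).filter (fun e => v ∈ e) =
        (edges K).filter (fun e => v ∈ e) \ R.filter (fun e => v ∈ e) := by
      ext e; simp only [Finset.mem_filter, Finset.mem_sdiff]; tauto
    rw [this, Finset.card_sdiff_of_subset (Finset.filter_subset_filter _ hRK)]
    have := Finset.card_le_card (Finset.filter_subset_filter (fun e => v ∈ e) hRK)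
    omega
  · apply Finset.disjoint_filter_filter
    exact (hAK.symm.mono_left Finset.sdiff_subset)

theorem card_edges_swap {K : SimpleGraph (Fin n)} {R A : Finset (Sym2 (Fin n))}
    (hA : ∀ e ∈ A, ¬ e.IsDiag) (hRK : R ⊆ edges K) (hAK : Disjoint A (edges K)) :
    (edges (swap K R A)).card + R.card = (edges K).card + A.card := by
  rw [edges_swap _ _ hA, Finset.card_union_of_disjoint, Finset.card_sdiff_of_subset hRK]
  · have := Finset.card_le_card hRK
    omega
  · exact (hAK.symm.mono_left Finset.sdiff_subset)

/-- The `d`-regular graphs containing `F`. -/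
def exts (F : SimpleGraph (Fin n)) (d : ℕ) : Finset (SimpleGraph (Fin n)) :=
  Finset.univ.filter (fun K => IsRegularGraph K d ∧ F ≤ K)

theorem mem_exts {F K : SimpleGraph (Fin n)} {d : ℕ} :
    K ∈ exts F d ↔ IsRegularGraph K d ∧ F ≤ K := by simp [exts]

/-- The number of elements satisfying `P`. -/
def cnt {α : Type*} [Fintype α] (P : α → Prop) : ℕ := (Finset.univ.filter P).card

theorem cnt_eq {α : Type*} [Fintype α] (P : α → Prop) [DecidablePred P] :
    cnt P = (Finset.univ.filter P).card := by
  unfold cnt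
  congr

theorem cnt_mono {α : Type*} [Fintype α] {P Q : α → Prop} (h : ∀ a, P a → Q a) :
    cnt P ≤ cnt Q :=
  Finset.card_le_card fun a => by simpa using h a

theorem cnt_congr {α : Type*} [Fintype α] {P Q : α → Prop} (h : ∀ a, P a ↔ Q a) :
    cnt P = cnt Q := by
  rw [show P = Q from funext fun a => propext (h a)]

theorem cnt_or_le {α : Type*} [Fintype α] (P Q : α → Prop) :
    cnt (fun a => P a ∨ Q a) ≤ cnt P + cnt Q := by
  unfold cnt
  rw [← Finset.card_union_add_card_inter]
  refine le_add_right (Finset.card_le_card fun a => ?_)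
  simp

theorem cnt_le_add {α : Type*} [Fintype α] {P Q R : α → Prop} (h : ∀ a, P a → Q a ∨ R a) :
    cnt P ≤ cnt Q + cnt R :=
  (cnt_mono h).trans (cnt_or_le Q R)

theorem cnt_eq_zero {α : Type*} [Fintype α] {P : α → Prop} (h : ∀ a, ¬ P a) : cnt P = 0 := by
  simp [cnt, h]

theorem sum_switchings_le {τ : Type*} [Fintype τ] (F : SimpleGraph (Fin n)) (d : ℕ)
    (R A : τ → Finset (Sym2 (Fin n))) (P : τ → Prop)
    (hA : ∀ t, P t → ∀ e ∈ A t, ¬ e.IsDiag)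
    (hbal : ∀ t, P t → ∀ v, ((R t).filter (fun e => v ∈ e)).card =
      ((A t).filter (fun e => v ∈ e)).card) :
    ∑ K ∈ exts F d, cnt (fun t => P t ∧ R t ⊆ edges K \ edges F ∧
        Disjoint (A t) (edges K)) ≤
      ∑ K ∈ exts F d, cnt (fun t => P t ∧ A t ⊆ edges K \ edges F ∧
        Disjoint (R t) (edges K)) := by
  unfold cnt
  rw [← Finset.card_sigma, ← Finset.card_sigma]
  apply Finset.card_le_card_of_injOn (fun z => ⟨swap z.1 (R z.2) (A z.2), z.2⟩)
  · rintro ⟨K, t⟩ h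
    simp only [Finset.coe_sigma, Set.mem_sigma_iff, Finset.mem_coe, mem_exts, Finset.mem_filter,
      Finset.mem_univ, true_and] at h ⊢
    obtain ⟨⟨hreg, hF⟩, hP, hR, hd⟩ := h
    have hRK : R t ⊆ edges K := hR.trans Finset.sdiff_subset
    have hFR : ∀ e ∈ R t, e ∉ edges F := fun e he => (Finset.mem_sdiff.1 (hR he)).2
    have hFK := edges_subset_edges.2 hF
    rw [← edges_subset_edges, edges_swap _ _ (hA t hP)]
    refine ⟨⟨fun v => ?_, ?_⟩, hP, ?_, ?_⟩
    · have h1 := deg_swap (hA t hP) hRK hd v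
      rw [hbal t hP v, hreg v] at h1
      omega
    · intro e he
      have := hFR e
      have := hFK he
      simp only [Finset.mem_union, Finset.mem_sdiff]
      tauto
    · intro e he
      have h1 : e ∉ edges F := fun h => Finset.disjoint_left.1 hd he (hFK h)
      simp only [Finset.mem_union, Finset.mem_sdiff]
      tauto
    · rw [Finset.disjoint_left]
      intro e he h
      have h1 : e ∈ A t → e ∉ edges K := fun h => Finset.disjoint_left.1 hd h
      have h2 := hRK he
      simp only [Finset.mem_union, Finset.mem_sdiff] at h
      tauto
  · rintro ⟨K, t⟩ h ⟨K', t'⟩ h' heq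
    simp only [Finset.coe_sigma, Set.mem_sigma_iff, Finset.mem_coe, mem_exts, Finset.mem_filter,
      Finset.mem_univ, true_and] at h h'
    simp only [Sigma.mk.injEq, heq_eq_eq] at heq
    obtain ⟨h1, rfl⟩ := heq
    have e1 := swap_swap (hA t h.2.1) (h.2.2.1.trans Finset.sdiff_subset) h.2.2.2
    have e2 := swap_swap (hA t h'.2.1) (h'.2.2.1.trans Finset.sdiff_subset) h'.2.2.2
    rw [← e1, h1, e2]

/-- Switchings are reversible, so they can be counted from both sides. -/
theorem sum_switchings_eq {τ : Type*} [Fintype τ] (F : SimpleGraph (Fin n)) (d : ℕ)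
    (R A : τ → Finset (Sym2 (Fin n))) (P : τ → Prop)
    (hR : ∀ t, P t → ∀ e ∈ R t, ¬ e.IsDiag)
    (hA : ∀ t, P t → ∀ e ∈ A t, ¬ e.IsDiag)
    (hbal : ∀ t, P t → ∀ v, ((R t).filter (fun e => v ∈ e)).card =
      ((A t).filter (fun e => v ∈ e)).card) :
    ∑ K ∈ exts F d, cnt (fun t => P t ∧ R t ⊆ edges K \ edges F ∧
        Disjoint (A t) (edges K)) =
      ∑ K ∈ exts F d, cnt (fun t => P t ∧ A t ⊆ edges K \ edges F ∧
        Disjoint (R t) (edges K)) :=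
  le_antisymm (sum_switchings_le F d R A P hA hbal)
    (sum_switchings_le F d A R P hR fun t ht v => (hbal t ht v).symm)

/-- The total excess of the degrees of `K` over `d`. -/
def excess (K : SimpleGraph (Fin n)) (d : ℕ) : ℕ := ∑ v, (deg K v - d)

theorem regular_of_deg_le {K : SimpleGraph (Fin n)} {d N : ℕ} (hN : 2 * N = d * n)
    (hK : (edges K).card = N) (h : ∀ v, deg K v ≤ d) : IsRegularGraph K d := by
  have h1 : ∑ v, deg K v = ∑ _v : Fin n, d := by
    rw [sum_deg, hK, hN]; simp [mul_comm]
  have := (Finset.sum_eq_sum_iff_of_le (fun v _ => h v)).1 h1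
  exact fun v => this v (Finset.mem_univ v)

theorem exists_deg_lt {K : SimpleGraph (Fin n)} {d N : ℕ} (hN : 2 * N = d * n)
    (hK : (edges K).card = N) {u : Fin n} (hu : d < deg K u) : ∃ v, deg K v < d := by
  by_contra! h
  have h1 : ∑ v, deg K v = ∑ _v : Fin n, d := by
    rw [sum_deg, hK, hN]; simp [mul_comm]
  have := (Finset.sum_eq_sum_iff_of_le (fun v _ => h v)).1 h1.symm u (Finset.mem_univ u)
  omega

theorem exists_adj_not_adj {K : SimpleGraph (Fin n)} {u v : Fin n} (h : deg K v < deg K u) :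
    ∃ w, w ≠ v ∧ K.Adj u w ∧ ¬ K.Adj v w := by
  by_contra! hcon
  have hne : u ≠ v := by rintro rfl; omega
  rw [deg_eq_card, deg_eq_card] at h
  apply absurd h
  rw [not_lt]
  by_cases huv : K.Adj u v
  · apply Finset.card_le_card_of_injOn (fun w => if w = v then u else w)
    · intro w hw
      simp only [Finset.coe_filter, Finset.mem_univ, true_and, Set.mem_ofPred_eq] at hw ⊢
      split_ifs with hwv
      · exact huv.symm
      · exact hcon w hwv hw
    · intro w hw w' hw' heq
      simp only [Finset.coe_filter, Finset.mem_univ, true_and, Set.mem_ofPred_eq] at hw hw' heq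
      split_ifs at heq with h1 h2 h2
      · rw [h1, h2]
      · exact absurd heq hw'.ne
      · exact absurd heq.symm hw.ne
      · exact heq
  · apply Finset.card_le_card
    intro w hw
    simp only [Finset.mem_filter, Finset.mem_univ, true_and] at hw ⊢
    exact hcon w (by rintro rfl; exact huv hw) hw

/-- The graphs with `N` edges whose total degree excess over `d` is at most `t`. -/
def nearReg (n d N t : ℕ) : Finset (SimpleGraph (Fin n)) :=
  Finset.univ.filter (fun K => (edges K).card = N ∧ excess K d ≤ t)

theorem exists_swap_excess {K : SimpleGraph (Fin n)} {d N t : ℕ} (hN : 2 * N = d * n)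
    (hK : (edges K).card = N) (ht : excess K d ≤ t + 1) (hnr : ¬ IsRegularGraph K d) :
    ∃ u v w : Fin n, u ≠ v ∧ swap K {s(u, w)} {s(v, w)} ∈ nearReg n d N t ∧
      swap (swap K {s(u, w)} {s(v, w)}) {s(v, w)} {s(u, w)} = K := by
  obtain ⟨u, hu⟩ : ∃ u, d < deg K u := by
    by_contra! h
    exact hnr (regular_of_deg_le hN hK h)
  obtain ⟨v, hv⟩ := exists_deg_lt hN hK hu
  obtain ⟨w, hwv, huw, hvw⟩ := exists_adj_not_adj (hv.trans hu)
  have hne : u ≠ v := by rintro rfl; omega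
  have hA : ∀ e ∈ ({s(v, w)} : Finset (Sym2 (Fin n))), ¬ e.IsDiag := by
    intro e he
    rw [Finset.mem_singleton.1 he, Sym2.mk_isDiag_iff]
    exact hwv.symm
  have hR : ({s(u, w)} : Finset (Sym2 (Fin n))) ⊆ edges K := by simpa using huw
  have hD : Disjoint ({s(v, w)} : Finset (Sym2 (Fin n))) (edges K) := by simpa using hvw
  refine ⟨u, v, w, hne, ?_, swap_swap hA hR hD⟩
  have hdeg := deg_swap hA hR hD
  have hcard := card_edges_swap hA hR hD
  simp only [Finset.card_singleton] at hcard
  simp only [nearReg, Finset.mem_filter, Finset.mem_univ, true_and]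
  refine ⟨by omega, ?_⟩
  suffices h : excess (swap K {s(u, w)} {s(v, w)}) d + 1 ≤ excess K d by omega
  unfold excess
  apply Nat.succ_le_of_lt
  apply Finset.sum_lt_sum
  · intro z _
    have hz := hdeg z
    simp only [Finset.filter_singleton, Sym2.mem_iff] at hz
    by_cases hzw : z = w
    · subst hzw
      simp only [or_true, if_true, Finset.card_singleton] at hz
      omega
    · simp only [hzw, or_false] at hz
      by_cases hzv : z = v
      · subst hzv
        rw [if_neg hne.symm, if_pos rfl] at hz
        simp only [Finset.card_empty, Finset.card_singleton] at hz
        omega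
      · rw [if_neg hzv] at hz
        simp only [Finset.card_empty] at hz
        omega
  · refine ⟨u, Finset.mem_univ u, ?_⟩
    have hz := hdeg u
    simp only [Finset.filter_singleton, Sym2.mem_iff, true_or, if_true,
      Finset.card_singleton] at hz
    rw [if_neg (by rintro (h | h); exacts [hne h, huw.ne h])] at hz
    simp only [Finset.card_empty] at hz
    omega

theorem card_nearReg_succ_le {n d N : ℕ} (hN : 2 * N = d * n) (t : ℕ) (hn : 0 < n) :
    (nearReg n d N (t + 1)).card ≤ (nearReg n d N t).card * n ^ 3 := by
  have hsub : nearReg n d N (t + 1) ⊆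
      ((nearReg n d N t) ×ˢ (Finset.univ : Finset (Fin n × Fin n × Fin n))).image
        (fun z => if z.2.1 = z.2.2.1 then z.1
          else swap z.1 {s(z.2.2.1, z.2.2.2)} {s(z.2.1, z.2.2.2)}) := by
    intro K hK
    simp only [nearReg, Finset.mem_filter, Finset.mem_univ, true_and] at hK
    rw [Finset.mem_image]
    by_cases hreg : IsRegularGraph K d
    · refine ⟨(K, ⟨0, hn⟩, ⟨0, hn⟩, ⟨0, hn⟩), ?_, by simp⟩
      have : excess K d = 0 := by
        unfold excess
        apply Finset.sum_eq_zero
        intro v _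
        rw [hreg v, Nat.sub_self]
      simp [nearReg, hK.1, this]
    · obtain ⟨u, v, w, huv, h1, h2⟩ := exists_swap_excess hN hK.1 hK.2 hreg
      refine ⟨(swap K {s(u, w)} {s(v, w)}, u, v, w), by simpa using h1, ?_⟩
      simp only [huv, if_false]
      exact h2
  refine (Finset.card_le_card hsub).trans (Finset.card_image_le.trans ?_)
  rw [Finset.card_product]
  simp
  apply le_of_eq
  ring

theorem card_nearReg_le {n d N : ℕ} (hN : 2 * N = d * n) (t : ℕ) (hn : 0 < n) :
    (nearReg n d N t).card ≤ (nearReg n d N 0).card * n ^ (3 * t) := by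
  induction t with
  | zero => simp
  | succ t ih =>
    refine (card_nearReg_succ_le hN t hn).trans ((Nat.mul_le_mul_right _ ih).trans ?_)
    rw [mul_assoc, ← pow_add, Nat.mul_succ]

theorem card_edges_of_regular {K : SimpleGraph (Fin n)} {d : ℕ} (h : IsRegularGraph K d) :
    2 * (edges K).card = d * n := by
  rw [← sum_deg, Finset.sum_congr rfl fun v _ => h v]
  simp [mul_comm]

theorem nearReg_zero {n d N : ℕ} (hN : 2 * N = d * n) :
    nearReg n d N 0 = exts (⊥ : SimpleGraph (Fin n)) d := by
  ext K
  simp only [nearReg, mem_exts, Finset.mem_filter, Finset.mem_univ, true_and, bot_le, and_true,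
    Nat.le_zero]
  constructor
  · rintro ⟨h1, h2⟩
    refine regular_of_deg_le hN h1 fun v => ?_
    have := Finset.sum_eq_zero_iff.1 h2 v (Finset.mem_univ v)
    omega
  · intro h
    refine ⟨by have := card_edges_of_regular h; omega, Finset.sum_eq_zero fun v _ => ?_⟩
    rw [h v, Nat.sub_self]

theorem mem_edges_pair {K : SimpleGraph (Fin n)} {x y : Fin n} :
    s(x, y) ∈ edges K ↔ K.Adj x y := by simp

theorem card_filter_mem_pair {x y a b v : Fin n} (hxy : x ≠ y) (hab : a ≠ b)
    (h : s(x, y) ≠ s(a, b)) :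
    (({s(x, y), s(a, b)} : Finset (Sym2 (Fin n))).filter (fun e => v ∈ e)).card =
      (if v = x then 1 else 0) + (if v = y then 1 else 0) + (if v = a then 1 else 0) +
        (if v = b then 1 else 0) := by
  rw [Finset.card_filter, Finset.sum_pair h]
  simp only [Sym2.mem_iff]
  split_ifs <;> simp_all

/-- The `d`-regular extensions of `F` containing the edge `xy`. -/
def extsWith (F : SimpleGraph (Fin n)) (d : ℕ) (x y : Fin n) : Finset (SimpleGraph (Fin n)) :=
  (exts F d).filter (fun K => K.Adj x y)

/-- The `d`-regular extensions of `F` not containing the edge `xy`. -/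
def extsWithout (F : SimpleGraph (Fin n)) (d : ℕ) (x y : Fin n) : Finset (SimpleGraph (Fin n)) :=
  (exts F d).filter (fun K => ¬ K.Adj x y)

theorem card_extsWith_add (F : SimpleGraph (Fin n)) (d : ℕ) (x y : Fin n) :
    (extsWith F d x y).card + (extsWithout F d x y).card = (exts F d).card :=
  Finset.card_filter_add_card_filter_not _

/-- The ways to switch `xy, ab` to `xa, yb`. -/
def fwd (F K : SimpleGraph (Fin n)) (x y : Fin n) : ℕ :=
  cnt (fun t : Fin n × Fin n => (K \ F).Adj t.1 t.2 ∧ t.1 ≠ x ∧ t.2 ≠ y ∧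
    ¬ K.Adj x t.1 ∧ ¬ K.Adj y t.2)

/-- The ways to switch `xa, yb` to `xy, ab`. -/
def rev (F K : SimpleGraph (Fin n)) (x y : Fin n) : ℕ :=
  cnt (fun t : Fin n × Fin n => (K \ F).Adj x t.1 ∧ (K \ F).Adj y t.2 ∧
    t.1 ≠ t.2 ∧ ¬ K.Adj t.1 t.2)

/-- Double counting of the switchings `xy, ab ↔ xa, yb`. -/
theorem sum_fwd_eq_sum_rev (F : SimpleGraph (Fin n)) (d : ℕ) {x y : Fin n} (hxy : x ≠ y)
    (hF : ¬ F.Adj x y) :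
    ∑ K ∈ extsWith F d x y, fwd F K x y = ∑ K ∈ extsWithout F d x y, rev F K x y := by
  have key := sum_switchings_eq (τ := Fin n × Fin n) F d
    (fun t => {s(x, y), s(t.1, t.2)}) (fun t => {s(x, t.1), s(y, t.2)})
    (fun t => t.1 ≠ x ∧ t.2 ≠ y ∧ t.1 ≠ t.2 ∧ ¬ (t.1 = y ∧ t.2 = x))
    (by
      rintro ⟨a, b⟩ h e he
      simp only [Finset.mem_insert, Finset.mem_singleton] at he
      rcases he with rfl | rfl
      · simpa using hxy
      · simpa using h.2.2.1)
    (by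
      rintro ⟨a, b⟩ h e he
      simp only [Finset.mem_insert, Finset.mem_singleton] at he
      rcases he with rfl | rfl
      · simpa using h.1.symm
      · simpa using h.2.1.symm)
    (by
      rintro ⟨a, b⟩ ⟨h1, h2, h3, h4⟩ v
      simp only at h1 h2 h3 h4
      rw [card_filter_mem_pair hxy h3, card_filter_mem_pair h1.symm h2.symm]
      · ring
      · simp only [ne_eq, Sym2.eq_iff]; tauto
      · simp only [ne_eq, Sym2.eq_iff]
        rintro (⟨h, h'⟩ | ⟨h, h'⟩)
        · exact h1 h.symm
        · exact h4 ⟨h'.symm, h.symm⟩)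
  rw [extsWith, extsWithout, Finset.sum_filter, Finset.sum_filter]
  refine (Finset.sum_congr rfl fun K _ => ?_).trans (key.trans (Finset.sum_congr rfl fun K _ => ?_))
  · split_ifs with h
    · refine cnt_congr ?_
      rintro ⟨a, b⟩
      simp only [Finset.insert_subset_iff,
        Finset.singleton_subset_iff, Finset.mem_sdiff, mem_edges_pair,
        Finset.disjoint_insert_left, Finset.disjoint_singleton_left, SimpleGraph.sdiff_adj]
      constructor
      · rintro ⟨h1, h2, h3, h4, h5⟩
        refine ⟨⟨h2, h3, h1.1.ne, ?_⟩, ⟨⟨h, hF⟩, h1⟩, h4, h5⟩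
        rintro ⟨rfl, rfl⟩
        exact h4 h
      · tauto
    · symm
      refine cnt_eq_zero ?_
      rintro ⟨a, b⟩
      simp only [Finset.insert_subset_iff, Finset.mem_sdiff, mem_edges_pair]
      tauto
  · symm
    split_ifs with h
    · symm
      refine cnt_eq_zero ?_
      rintro ⟨a, b⟩
      simp only [Finset.disjoint_insert_left, mem_edges_pair]
      tauto
    · refine cnt_congr ?_
      rintro ⟨a, b⟩
      simp only [Finset.insert_subset_iff,
        Finset.singleton_subset_iff, Finset.mem_sdiff, mem_edges_pair,
        Finset.disjoint_insert_left, Finset.disjoint_singleton_left, SimpleGraph.sdiff_adj]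
      constructor
      · rintro ⟨h1, h2, h3, h4⟩
        refine ⟨⟨h1.1.ne.symm, h2.1.ne.symm, h3, ?_⟩, ⟨h1, h2⟩, h, h4⟩
        rintro ⟨rfl, rfl⟩
        exact h h1.1
      · tauto

theorem deg_sdiff {F K : SimpleGraph (Fin n)} (h : F ≤ K) (v : Fin n) :
    deg (K \ F) v + deg F v = deg K v := by
  rw [deg_eq_card, deg_eq_card, deg_eq_card, ← Finset.card_union_of_disjoint]
  · congr 1
    ext u
    simp only [Finset.mem_union, Finset.mem_filter, Finset.mem_univ, true_and,
      SimpleGraph.sdiff_adj]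
    have := @h v u
    tauto
  · rw [Finset.disjoint_left]
    intro u
    simp only [Finset.mem_filter, Finset.mem_univ, true_and, SimpleGraph.sdiff_adj]
    tauto

theorem deg_sdiff_of_mem_exts {F K : SimpleGraph (Fin n)} {d : ℕ} (h : K ∈ exts F d) (v : Fin n) :
    (deg (K \ F) v : ℝ) = d - deg F v := by
  have h' := mem_exts.1 h
  have := deg_sdiff h'.2 v
  rw [h'.1 v] at this
  rw [← this]
  push_cast
  ring

/-- Counting pairs by their first coordinate. -/
theorem cnt_prod {α β : Type*} [Fintype α] [Fintype β] (P : α × β → Prop) :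
    cnt P = ∑ a, cnt (fun b => P (a, b)) := by
  simp only [cnt, Finset.card_filter]
  rw [← Finset.univ_product_univ, Finset.sum_product]

/-- Counting pairs by their second coordinate. -/
theorem cnt_prod_right {α β : Type*} [Fintype α] [Fintype β] (P : α × β → Prop) :
    cnt P = ∑ b, cnt (fun a => P (a, b)) := by
  simp only [cnt, Finset.card_filter]
  rw [← Finset.univ_product_univ, Finset.sum_product_right]

theorem cnt_and_prod {α β : Type*} [Fintype α] [Fintype β] (P : α → Prop) (Q : β → Prop) :
    cnt (fun t : α × β => P t.1 ∧ Q t.2) = cnt P * cnt Q := by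
  simp only [cnt]
  rw [← Finset.card_product, ← Finset.univ_product_univ, ← Finset.filter_product]
  congr

theorem cnt_adj (G : SimpleGraph (Fin n)) (v : Fin n) : cnt (G.Adj v) = deg G v := by
  rw [deg_eq_card]
  rfl

theorem cnt_adj_prod (G : SimpleGraph (Fin n)) :
    cnt (fun t : Fin n × Fin n => G.Adj t.1 t.2) = ∑ v, deg G v := by
  rw [cnt_prod]
  exact Finset.sum_congr rfl fun v _ => cnt_adj G v

theorem cnt_swap {α β : Type*} [Fintype α] [Fintype β] (P : α × β → Prop) :
    cnt P = cnt (fun t : β × α => P (t.2, t.1)) := by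
  rw [cnt_prod, cnt_prod_right]

/-- A sum bound for the number of pairs with constrained first coordinate. -/
theorem cnt_prod_le {α β : Type*} [Fintype α] [Fintype β] (P : α → Prop) (Q : α → β → Prop)
    (d : ℕ) (hd : ∀ a, P a → cnt (Q a) ≤ d) :
    cnt (fun t : α × β => P t.1 ∧ Q t.1 t.2) ≤ cnt P * d := by
  rw [cnt_prod, cnt, Finset.card_filter, Finset.sum_mul]
  apply Finset.sum_le_sum
  intro a _
  by_cases h : P a
  · simpa [h] using hd a h
  · simp [h, cnt]

theorem sum_deg_sdiff_of_mem_exts {F K : SimpleGraph (Fin n)} {d : ℕ} (h : K ∈ exts F d) :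
    ((∑ v, deg (K \ F) v : ℕ) : ℝ) = d * n - 2 * (edges F).card := by
  push_cast
  rw [Finset.sum_congr rfl fun v _ => deg_sdiff_of_mem_exts h v, Finset.sum_sub_distrib]
  have := sum_deg F
  have h2 : (∑ v, (deg F v : ℝ)) = 2 * (edges F).card := by exact_mod_cast this
  rw [h2]
  simp [mul_comm]

theorem cnt_adj_sdiff {F K : SimpleGraph (Fin n)} {d : ℕ} (h : K ∈ exts F d) :
    (cnt (fun t : Fin n × Fin n => (K \ F).Adj t.1 t.2) : ℝ) = d * n - 2 * (edges F).card := by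
  rw [cnt_adj_prod, sum_deg_sdiff_of_mem_exts h]

theorem deg_sdiff_le {F K : SimpleGraph (Fin n)} {d : ℕ} (h : K ∈ exts F d) (v : Fin n) :
    deg (K \ F) v ≤ d := by
  have h' := mem_exts.1 h
  have := deg_sdiff h'.2 v
  rw [h'.1 v] at this
  omega

theorem cnt_eq_one {α : Type*} [Fintype α] (x : α) : cnt (fun a => a = x) = 1 := by
  rw [cnt_eq, Finset.filter_eq' Finset.univ x]
  simp

theorem cnt_eq_or_adj_le {K : SimpleGraph (Fin n)} {d : ℕ} {x : Fin n} (h : deg K x = d) :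
    cnt (fun a => a = x ∨ K.Adj x a) ≤ d + 1 := by
  refine (cnt_or_le _ _).trans ?_
  have := cnt_adj K x
  rw [cnt_eq_one, this, h, add_comm]

theorem fwd_ge {F K : SimpleGraph (Fin n)} {d : ℕ} (h : K ∈ exts F d) (x y : Fin n) :
    ((d : ℝ) * n - 2 * (edges F).card) - 2 * d * (d + 1) ≤ fwd F K x y := by
  have hreg := (mem_exts.1 h).1
  rw [← cnt_adj_sdiff h]
  have hd : ∀ v, cnt ((K \ F).Adj v) ≤ d := fun v => by
    rw [cnt_adj]; exact deg_sdiff_le h v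
  have h1 := cnt_prod_le (fun a => a = x ∨ K.Adj x a) (fun a b => (K \ F).Adj a b) d
    fun v _ => hd v
  have h2 := cnt_prod_le (fun a => a = y ∨ K.Adj y a) (fun a b => (K \ F).Adj a b) d
    fun v _ => hd v
  rw [cnt_swap] at h2
  simp only at h2
  have h4 := Nat.mul_le_mul_right d (cnt_eq_or_adj_le (hreg x))
  have h5 := Nat.mul_le_mul_right d (cnt_eq_or_adj_le (hreg y))
  have h6 : cnt (fun t : Fin n × Fin n => (K \ F).Adj t.1 t.2) ≤ fwd F K x y +
      (cnt (fun t : Fin n × Fin n => (t.1 = x ∨ K.Adj x t.1) ∧ (K \ F).Adj t.1 t.2) +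
      cnt (fun t : Fin n × Fin n => (t.2 = y ∨ K.Adj y t.2) ∧ (K \ F).Adj t.2 t.1)) := by
    refine (cnt_le_add (R := fun t => _ ∨ _) ?_).trans (Nat.add_le_add_left (cnt_or_le _ _) _)
    rintro ⟨a, b⟩
    have := (K \ F).adj_comm a b
    simp only
    tauto
  have h7 : cnt (fun t : Fin n × Fin n => (K \ F).Adj t.1 t.2) ≤
      fwd F K x y + ((d + 1) * d + (d + 1) * d) := by
    omega
  have h8 : (cnt (fun t : Fin n × Fin n => (K \ F).Adj t.1 t.2) : ℝ) ≤
      fwd F K x y + ((d + 1) * d + (d + 1) * d) := by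
    exact_mod_cast h7
  linarith

theorem fwd_le {F K : SimpleGraph (Fin n)} {d : ℕ} (h : K ∈ exts F d) (x y : Fin n) :
    (fwd F K x y : ℝ) ≤ (d : ℝ) * n - 2 * (edges F).card := by
  rw [← cnt_adj_sdiff h]
  norm_cast
  exact cnt_mono fun t ht => ht.1

theorem rev_le {F K : SimpleGraph (Fin n)} {d : ℕ} (h : K ∈ exts F d) (x y : Fin n) :
    (rev F K x y : ℝ) ≤ (d - deg F x) * (d - deg F y) := by
  rw [← deg_sdiff_of_mem_exts h, ← deg_sdiff_of_mem_exts h, ← cnt_adj, ← cnt_adj]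
  norm_cast
  rw [← cnt_and_prod]
  exact cnt_mono fun t ht => ⟨ht.1, ht.2.1⟩

theorem rev_ge {F K : SimpleGraph (Fin n)} {d : ℕ} (h : K ∈ exts F d) (x y : Fin n) :
    ((d : ℝ) - deg F x) * (d - deg F y) ≤ rev F K x y + d +
      cnt (fun t : Fin n × Fin n => K.Adj x t.1 ∧ K.Adj t.1 t.2 ∧ (K \ F).Adj y t.2) := by
  rw [← deg_sdiff_of_mem_exts h, ← deg_sdiff_of_mem_exts h, ← cnt_adj, ← cnt_adj]
  norm_cast
  rw [← cnt_and_prod]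
  have h1 := cnt_prod_le (fun a => (K \ F).Adj x a) (fun a b => b = a) 1
    fun a _ => (cnt_eq_one a).le
  have h2 : cnt (fun a => (K \ F).Adj x a) ≤ d := by
    have := cnt_adj (K \ F) x
    rw [this]
    exact deg_sdiff_le h x
  have h3 : cnt (fun t : Fin n × Fin n => (K \ F).Adj x t.1 ∧ (K \ F).Adj y t.2) ≤
      rev F K x y + (cnt (fun t : Fin n × Fin n => (K \ F).Adj x t.1 ∧ t.2 = t.1) +
      cnt (fun t : Fin n × Fin n => K.Adj x t.1 ∧ K.Adj t.1 t.2 ∧ (K \ F).Adj y t.2)) := by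
    refine (cnt_le_add (R := fun t => _ ∨ _) ?_).trans (Nat.add_le_add_left (cnt_or_le _ _) _)
    rintro ⟨a, b⟩
    simp only [SimpleGraph.sdiff_adj, ne_eq]
    have : a = b ↔ b = a := eq_comm
    tauto
  omega

/-- An upper bound for the proportion of `d`-regular extensions of `F` containing `xy`. -/
theorem card_extsWith_le (F : SimpleGraph (Fin n)) (d : ℕ) {x y : Fin n} (hxy : x ≠ y)
    (hF : ¬ F.Adj x y) :
    ((extsWith F d x y).card : ℝ) *
        (((d : ℝ) * n - 2 * (edges F).card) - 2 * d * (d + 1)) ≤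
      (exts F d).card * ((d - deg F x) * (d - deg F y)) := by
  have h1 : ((extsWith F d x y).card : ℝ) *
        (((d : ℝ) * n - 2 * (edges F).card) - 2 * d * (d + 1)) ≤
      ((∑ K ∈ extsWith F d x y, fwd F K x y : ℕ) : ℝ) := by
    rw [← nsmul_eq_mul, ← Finset.sum_const]
    push_cast
    apply Finset.sum_le_sum
    intro K hK
    exact fwd_ge (Finset.mem_filter.1 hK).1 x y
  refine h1.trans ?_
  rw [sum_fwd_eq_sum_rev F d hxy hF]
  push_cast
  have h2 : ∀ K ∈ exts F d, (0 : ℝ) ≤ (d - deg F x) * (d - deg F y) := by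
    intro K hK
    rw [← deg_sdiff_of_mem_exts hK, ← deg_sdiff_of_mem_exts hK]
    positivity
  calc _ ≤ ∑ K ∈ extsWithout F d x y, (((d : ℝ) - deg F x) * (d - deg F y)) :=
        Finset.sum_le_sum fun K hK => rev_le (Finset.mem_filter.1 hK).1 x y
    _ ≤ ∑ K ∈ exts F d, (((d : ℝ) - deg F x) * (d - deg F y)) :=
        Finset.sum_le_sum_of_subset_of_nonneg (Finset.filter_subset _ _) fun K hK _ => h2 K hK
    _ = _ := by rw [Finset.sum_const, nsmul_eq_mul]

theorem sum_cnt_comm {α β : Type*} [Fintype β] (S : Finset α) (P : α → β → Prop) :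
    ∑ a ∈ S, cnt (P a) = ∑ b, (S.filter (fun a => P a b)).card := by
  simp only [cnt, Finset.card_filter]
  exact Finset.sum_comm

theorem deg_le_of_mem_exts {F K : SimpleGraph (Fin n)} {d : ℕ} (h : K ∈ exts F d) (v : Fin n) :
    deg F v ≤ d := by
  have h' := mem_exts.1 h
  rw [← h'.1 v]
  exact deg_mono h'.2 v

theorem card_extsWith_mul_le (F : SimpleGraph (Fin n)) (d : ℕ) {x y : Fin n} (hxy : x ≠ y)
    (hF : ¬ F.Adj x y) {G : ℝ} (hG : ∀ v, (d : ℝ) - deg F v ≤ G) {T : ℝ}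
    (hT : T ≤ ((d : ℝ) * n - 2 * (edges F).card) - 2 * d * (d + 1)) :
    ((extsWith F d x y).card : ℝ) * T ≤ (exts F d).card * G ^ 2 := by
  by_cases hV : exts F d = ∅
  · simp [extsWith, hV]
  obtain ⟨K, hK⟩ := Finset.nonempty_iff_ne_empty.2 hV
  have h1 := card_extsWith_le F d hxy hF
  have hx : (0 : ℝ) ≤ d - deg F x := sub_nonneg.2 (by exact_mod_cast deg_le_of_mem_exts hK x)
  have hy : (0 : ℝ) ≤ d - deg F y := sub_nonneg.2 (by exact_mod_cast deg_le_of_mem_exts hK y)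
  calc _ ≤ _ := mul_le_mul_of_nonneg_left hT (Nat.cast_nonneg _)
    _ ≤ _ := h1
    _ ≤ _ := by
      rw [sq]
      gcongr
      · exact hx.trans (hG x)
      · exact hG x
      · exact hG y

/-- The graph obtained from `F` by adding the edges `xa` and `ab`. -/
def addPath (F : SimpleGraph (Fin n)) (x a b : Fin n) : SimpleGraph (Fin n) :=
  ofEdges (edges F ∪ {s(x, a), s(a, b)})

theorem edges_addPath (F : SimpleGraph (Fin n)) {x a b : Fin n} (hxa : x ≠ a) (hab : a ≠ b) :
    edges (addPath F x a b) = edges F ∪ {s(x, a), s(a, b)} := by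
  apply edges_ofEdges
  intro e he
  simp only [Finset.mem_union, Finset.mem_insert, Finset.mem_singleton] at he
  rcases he with h | rfl | rfl
  · exact not_isDiag_of_mem_edges h
  · simpa using hxa
  · simpa using hab

theorem exts_addPath (F : SimpleGraph (Fin n)) (d : ℕ) {x a b : Fin n} (hxa : x ≠ a)
    (hab : a ≠ b) :
    exts (addPath F x a b) d = (exts F d).filter (fun K => K.Adj x a ∧ K.Adj a b) := by
  ext K
  rw [Finset.mem_filter, mem_exts, mem_exts, ← edges_subset_edges, ← edges_subset_edges,
    edges_addPath F hxa hab, Finset.union_subset_iff, Finset.insert_subset_iff,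
    Finset.singleton_subset_iff, mem_edges_pair, mem_edges_pair, and_assoc]

theorem card_filter_path_mul_le (F : SimpleGraph (Fin n)) (d : ℕ) {x y a b : Fin n}
    (hxy : x ≠ y) {G : ℝ} (hG : ∀ v, (d : ℝ) - deg F v ≤ G) {T : ℝ}
    (hT : T + 4 ≤ ((d : ℝ) * n - 2 * (edges F).card) - 2 * d * (d + 1)) :
    (((extsWithout F d x y).filter
        (fun K => K.Adj x a ∧ K.Adj a b ∧ (K \ F).Adj y b)).card : ℝ) * T ≤
      ((exts F d).filter (fun K => K.Adj x a ∧ K.Adj a b)).card * G ^ 2 := by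
  by_cases h : (((extsWithout F d x y).filter
        (fun K => K.Adj x a ∧ K.Adj a b ∧ (K \ F).Adj y b))) = ∅
  · rw [h]
    simp only [Finset.card_empty, Nat.cast_zero, zero_mul]
    positivity
  obtain ⟨K, hK⟩ := Finset.nonempty_iff_ne_empty.2 h
  simp only [extsWithout, Finset.mem_filter, SimpleGraph.sdiff_adj] at hK
  obtain ⟨⟨hK, hKxy⟩, hxa, hab, hyb, hF⟩ := hK
  have hay : a ≠ y := by rintro rfl; exact hKxy hxa
  have hbx : b ≠ x := by rintro rfl; exact hKxy hyb.symm
  have he := edges_addPath F hxa.ne hab.ne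
  have hle : F ≤ addPath F x a b := by
    rw [← edges_subset_edges, he]
    exact Finset.subset_union_left
  have hF' : ¬ (addPath F x a b).Adj y b := by
    rw [← mem_edges_pair, he]
    simp only [Finset.mem_union, mem_edges_pair, Finset.mem_insert, Finset.mem_singleton,
      Sym2.eq_iff]
    have := hyb.ne
    tauto
  have hcard : ((edges (addPath F x a b)).card : ℝ) ≤ (edges F).card + 2 := by
    rw [he]
    exact_mod_cast (Finset.card_union_le _ _).trans (Nat.add_le_add_left Finset.card_le_two _)
  have hG' : ∀ v, (d : ℝ) - deg (addPath F x a b) v ≤ G := fun v => by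
    have h1 : (deg F v : ℝ) ≤ deg (addPath F x a b) v := by exact_mod_cast deg_mono hle v
    linarith [hG v]
  have key := card_extsWith_mul_le (addPath F x a b) d hyb.ne hF' hG' (T := max T 0)
  by_cases hT0 : T ≤ 0
  · exact (mul_nonpos_of_nonneg_of_nonpos (Nat.cast_nonneg _) hT0).trans (by positivity)
  rw [max_eq_left (not_le.1 hT0).le] at key
  have key := key (by linarith)
  rw [exts_addPath F d hxa.ne hab.ne] at key
  refine le_trans ?_ key
  rw [extsWith, exts_addPath F d hxa.ne hab.ne]
  refine mul_le_mul_of_nonneg_right ?_ (not_le.1 hT0).le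
  norm_cast
  apply Finset.card_le_card
  intro L
  simp only [extsWithout, Finset.mem_filter, SimpleGraph.sdiff_adj]
  tauto

/-- The number of paths `x, a, b, y` in `K` whose last edge is not in `F`. -/
def pathCount (F K : SimpleGraph (Fin n)) (x y : Fin n) : ℕ :=
  cnt (fun t : Fin n × Fin n => K.Adj x t.1 ∧ K.Adj t.1 t.2 ∧ (K \ F).Adj y t.2)

theorem sum_path_mul_le (F : SimpleGraph (Fin n)) (d : ℕ) {x y : Fin n}
    (hxy : x ≠ y) {G : ℝ} (hG : ∀ v, (d : ℝ) - deg F v ≤ G) {T : ℝ}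
    (hT : T + 4 ≤ ((d : ℝ) * n - 2 * (edges F).card) - 2 * d * (d + 1)) :
    ((∑ K ∈ extsWithout F d x y, pathCount F K x y : ℕ) : ℝ) * T ≤
      (exts F d).card * d ^ 2 * G ^ 2 := by
  have h1 : ∑ K ∈ exts F d, cnt (fun t : Fin n × Fin n => K.Adj x t.1 ∧ K.Adj t.1 t.2) ≤
      (exts F d).card * d ^ 2 := by
    rw [← smul_eq_mul]
    apply Finset.sum_le_card_nsmul
    intro K hK
    have hr := (mem_exts.1 hK).1
    have h2 := cnt_prod_le (K.Adj x) (fun a b => K.Adj a b) d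
      fun a _ => by have := cnt_adj K a; rw [this, hr a]
    have h3 := cnt_adj K x
    rw [h3, hr x] at h2
    rw [sq]
    exact h2
  have h2 : ∀ t : Fin n × Fin n, (((extsWithout F d x y).filter
        (fun K => K.Adj x t.1 ∧ K.Adj t.1 t.2 ∧ (K \ F).Adj y t.2)).card : ℝ) * T ≤
      ((exts F d).filter (fun K => K.Adj x t.1 ∧ K.Adj t.1 t.2)).card * G ^ 2 :=
    fun t => card_filter_path_mul_le F d hxy hG hT
  have h3 : ∑ t : Fin n × Fin n,
      ((exts F d).filter (fun K => K.Adj x t.1 ∧ K.Adj t.1 t.2)).card ≤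
      (exts F d).card * d ^ 2 := by
    refine le_trans (le_of_eq ?_) h1
    rw [sum_cnt_comm]
    exact Finset.sum_congr rfl fun t _ => by congr
  have h4 : ∑ K ∈ extsWithout F d x y, pathCount F K x y = ∑ t : Fin n × Fin n,
      ((extsWithout F d x y).filter
        (fun K => K.Adj x t.1 ∧ K.Adj t.1 t.2 ∧ (K \ F).Adj y t.2)).card := by
    unfold pathCount
    rw [sum_cnt_comm]
    exact Finset.sum_congr rfl fun t _ => by congr
  rw [h4]
  push_cast
  rw [Finset.sum_mul]
  refine (Finset.sum_le_sum fun t _ => h2 t).trans ?_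
  rw [← Finset.sum_mul]
  gcongr
  exact_mod_cast h3

theorem card_extsWith_lower (F : SimpleGraph (Fin n)) (d : ℕ) {x y : Fin n} (hxy : x ≠ y)
    (hF : ¬ F.Adj x y) :
    ((extsWithout F d x y).card : ℝ) * (((d : ℝ) - deg F x) * (d - deg F y) - d) ≤
      (extsWith F d x y).card * ((d : ℝ) * n - 2 * (edges F).card) +
      ((∑ K ∈ extsWithout F d x y, pathCount F K x y : ℕ) : ℝ) := by
  have h1 : ((∑ K ∈ extsWith F d x y, fwd F K x y : ℕ) : ℝ) ≤
      (extsWith F d x y).card * ((d : ℝ) * n - 2 * (edges F).card) := by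
    rw [← nsmul_eq_mul, ← Finset.sum_const]
    push_cast
    exact Finset.sum_le_sum fun K hK => fwd_le (Finset.mem_filter.1 hK).1 x y
  rw [sum_fwd_eq_sum_rev F d hxy hF] at h1
  have h2 : ((extsWithout F d x y).card : ℝ) * (((d : ℝ) - deg F x) * (d - deg F y) - d) ≤
      ∑ K ∈ extsWithout F d x y, ((rev F K x y : ℝ) + pathCount F K x y) := by
    rw [← nsmul_eq_mul, ← Finset.sum_const]
    apply Finset.sum_le_sum
    intro K hK
    have := rev_ge (Finset.mem_filter.1 hK).1 x y
    unfold pathCount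
    linarith
  rw [Finset.sum_add_distrib] at h2
  push_cast at h1 ⊢
  linarith

/-- The degrees of `F` are within `γD` of `d - D`. -/
def Balanced (F : SimpleGraph (Fin n)) (d : ℕ) (D γ : ℝ) : Prop :=
  ∀ v, |(d : ℝ) - deg F v - D| ≤ γ * D

theorem sparse_lower_arith {n d D γ V N N₀ W : ℝ} (hn : 0 < n) (hD : 0 < D) (hDd : D ≤ d)
    (hγ : 0 < γ) (hγ' : γ ≤ 1 / 40) (hV0 : 0 ≤ V) (hN0 : 0 ≤ N)
    (hd2 : 2 * d * (d + 1) + 4 ≤ γ * (n * D)) (hadd : N + N₀ = V)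
    (hW : W * ((1 - γ) * (n * D)) ≤ V * d ^ 2 * ((1 + γ) * D) ^ 2)
    (hlow : N₀ * ((1 - 3 * γ) * D ^ 2) ≤ N * (n * D) + W) :
    (1 - 8 * γ) * (D * V) ≤ n * N := by
  have hd0 : 0 < d := hD.trans_le hDd
  have hdn : d ≤ γ / 2 * n := by
    have h0 : γ * (n * D) ≤ γ * (n * d) := by gcongr
    have h1 : (2 * (d + 1)) * d ≤ (γ * n) * d := by linarith
    have h2 := le_of_mul_le_mul_right h1 hd0
    linarith
  have hW' : W ≤ γ * D ^ 2 * V := by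
    have h1 : d ^ 2 ≤ γ / 2 * (n * D) := by nlinarith
    have h2 : V * d ^ 2 * ((1 + γ) * D) ^ 2 ≤ V * (γ / 2 * (n * D)) * ((1 + γ) * D) ^ 2 := by
      gcongr
    have h3 : W * (1 - γ) * (n * D) ≤ (V * (γ / 2) * ((1 + γ) * D) ^ 2) * (n * D) := by
      linarith
    have h4 := le_of_mul_le_mul_right h3 (by positivity)
    have h5 : (1 + γ) ^ 2 / 2 ≤ 1 - γ := by nlinarith
    have h6 : V * (γ / 2) * ((1 + γ) * D) ^ 2 ≤ (γ * D ^ 2 * V) * (1 - γ) := by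
      have : V * (γ / 2) * ((1 + γ) * D) ^ 2 = (γ * D ^ 2 * V) * ((1 + γ) ^ 2 / 2) := by ring
      rw [this]
      gcongr
    exact le_of_mul_le_mul_right (h4.trans h6) (by linarith)
  have h9 : V * ((1 - 3 * γ) * D ^ 2) ≤ N * ((1 - 3 * γ) * D ^ 2) + N * (n * D) +
      γ * D ^ 2 * V := by
    rw [← hadd] at hW' ⊢
    linarith
  have h10 : N * ((1 - 3 * γ) * D ^ 2) ≤ N * (γ / 2 * (n * D)) := by
    apply mul_le_mul_of_nonneg_left _ hN0
    have h0 : D * D ≤ γ / 2 * n * D := mul_le_mul_of_nonneg_right (hDd.trans hdn) hD.le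
    have h1 : 0 ≤ γ * (D * D) := by positivity
    linarith
  have h11 : ((1 - 4 * γ) * (D * V)) * D ≤ (n * N * (1 + γ / 2)) * D := by linarith
  have h12 := le_of_mul_le_mul_right h11 hD
  have h13 : (1 - 8 * γ) * (1 + γ / 2) ≤ 1 - 4 * γ := by nlinarith
  have h14 : ((1 - 8 * γ) * (D * V)) * (1 + γ / 2) ≤ (n * N) * (1 + γ / 2) := by
    refine le_trans ?_ h12
    have := mul_le_mul_of_nonneg_right h13 (mul_nonneg hD.le hV0)
    linarith
  exact le_of_mul_le_mul_right h14 (by linarith)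

theorem card_extsWith_sparse (F : SimpleGraph (Fin n)) (d : ℕ) {x y : Fin n} (hxy : x ≠ y)
    (hF : ¬ F.Adj x y) {D γ : ℝ} (hn : (0 : ℝ) < n) (hD : 0 < D) (hDd : D ≤ d) (hγ : 0 < γ)
    (hγ' : γ ≤ 1 / 40) (htot : (d : ℝ) * n - 2 * (edges F).card = n * D)
    (hbal : Balanced F d D γ) (hd1 : (d : ℝ) ≤ γ * D ^ 2)
    (hd2 : 2 * (d : ℝ) * (d + 1) + 4 ≤ γ * (n * D)) :
    (1 - 8 * γ) * (D * (exts F d).card) ≤ n * (extsWith F d x y).card ∧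
      n * (extsWith F d x y).card * (1 - γ) ≤ (1 + γ) ^ 2 * (D * (exts F d).card) := by
  have hlo : ∀ v, (1 - γ) * D ≤ (d : ℝ) - deg F v := fun v => by
    have := (abs_le.1 (hbal v)).1
    linarith
  have hhi : ∀ v, (d : ℝ) - deg F v ≤ (1 + γ) * D := fun v => by
    have := (abs_le.1 (hbal v)).2
    linarith
  have hup := card_extsWith_mul_le F d hxy hF hhi (T := (1 - γ) * (n * D)) (by
    rw [htot]; linarith)
  have hW := sum_path_mul_le F d hxy hhi (T := (1 - γ) * (n * D)) (by
    rw [htot]; linarith)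
  have hlow := card_extsWith_lower F d hxy hF
  rw [htot] at hlow
  have hadd : ((extsWith F d x y).card : ℝ) + (extsWithout F d x y).card = (exts F d).card := by
    exact_mod_cast card_extsWith_add F d x y
  set V : ℝ := ((exts F d).card : ℝ)
  set N : ℝ := ((extsWith F d x y).card : ℝ)
  set N₀ : ℝ := ((extsWithout F d x y).card : ℝ)
  set W : ℝ := ((∑ K ∈ extsWithout F d x y, pathCount F K x y : ℕ) : ℝ)
  have hV0 : 0 ≤ V := Nat.cast_nonneg _
  have hN0 : 0 ≤ N := Nat.cast_nonneg _
  have hN₀0 : 0 ≤ N₀ := Nat.cast_nonneg _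
  have hup' : n * N * (1 - γ) ≤ (1 + γ) ^ 2 * (D * V) := by
    have : (n * N * (1 - γ)) * D ≤ ((1 + γ) ^ 2 * (D * V)) * D := by linarith
    exact le_of_mul_le_mul_right this hD
  refine ⟨?_, hup'⟩
  refine sparse_lower_arith hn hD hDd hγ hγ' hV0 hN0 hd2 hadd hW (le_trans ?_ hlow)
  apply mul_le_mul_of_nonneg_left _ hN₀0
  have h8 : ((1 - γ) * D) * ((1 - γ) * D) ≤ ((d : ℝ) - deg F x) * (d - deg F y) :=
    mul_le_mul (hlo x) (hlo y) (by apply mul_nonneg <;> linarith)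
      (le_trans (by apply mul_nonneg <;> linarith) (hlo x))
  have h9 : 0 ≤ γ ^ 2 * D ^ 2 := by positivity
  linarith

theorem card_extsWith_compare_sparse (F : SimpleGraph (Fin n)) (d : ℕ) {x y x' y' : Fin n}
    (hxy : x ≠ y) (hF : ¬ F.Adj x y) (hxy' : x' ≠ y') (hF' : ¬ F.Adj x' y') {D γ η : ℝ}
    (hn : (0 : ℝ) < n) (hD : 0 < D) (hDd : D ≤ d) (hγ : 0 < γ) (hη : η ≤ 1) (hγη : γ ≤ η / 40)
    (htot : (d : ℝ) * n - 2 * (edges F).card = n * D)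
    (hbal : Balanced F d D γ) (hd1 : (d : ℝ) ≤ γ * D ^ 2)
    (hd2 : 2 * (d : ℝ) * (d + 1) + 4 ≤ γ * (n * D)) :
    ((extsWith F d x y).card : ℝ) ≤ (1 + η) * (extsWith F d x' y').card := by
  have h1 := (card_extsWith_sparse F d hxy hF hn hD hDd hγ (by linarith) htot hbal hd1 hd2).2
  have h2 := (card_extsWith_sparse F d hxy' hF' hn hD hDd hγ (by linarith) htot hbal hd1 hd2).1
  set V : ℝ := D * ((exts F d).card : ℝ)
  set N : ℝ := ((extsWith F d x y).card : ℝ)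
  set N' : ℝ := ((extsWith F d x' y').card : ℝ)
  have hN0 : 0 ≤ N := Nat.cast_nonneg _
  have hN0' : 0 ≤ N' := Nat.cast_nonneg _
  have hV0 : 0 ≤ V := mul_nonneg hD.le (Nat.cast_nonneg _)
  have hγ1 : γ ≤ 1 / 40 := by linarith
  have h3 : n * N * (1 - γ) * (1 - 8 * γ) ≤ (1 + γ) ^ 2 * (n * N') := by
    have := mul_le_mul_of_nonneg_right h1 (show 0 ≤ 1 - 8 * γ by linarith)
    have := mul_le_mul_of_nonneg_left h2 (show 0 ≤ (1 + γ) ^ 2 by positivity)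
    linarith
  have h4 : (1 + γ) ^ 2 ≤ (1 + η) * ((1 - γ) * (1 - 8 * γ)) := by
    have h5 : (1 + γ) ^ 2 ≤ (1 + 40 * γ) * ((1 - γ) * (1 - 8 * γ)) := by
      nlinarith [mul_pos hγ hγ, mul_pos hγ (mul_pos hγ hγ)]
    refine h5.trans (mul_le_mul_of_nonneg_right (by linarith) ?_)
    apply mul_nonneg <;> linarith
  have h6 : N * (n * ((1 - γ) * (1 - 8 * γ))) ≤ ((1 + η) * N') * (n * ((1 - γ) * (1 - 8 * γ))) := by
    have := mul_le_mul_of_nonneg_right h4 (show 0 ≤ n * N' by positivity)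
    linarith
  refine le_of_mul_le_mul_right h6 ?_
  apply mul_pos hn (mul_pos _ _) <;> linarith

theorem card_filter_mem_triple {x y a b c z v : Fin n}
    (h : [x, y, a, b, c, z].Nodup) :
    (({s(y, a), s(b, c), s(z, x)} : Finset (Sym2 (Fin n))).filter (fun e => v ∈ e)).card =
      (({s(x, y), s(a, b), s(c, z)} : Finset (Sym2 (Fin n))).filter (fun e => v ∈ e)).card := by
  simp only [List.nodup_cons, List.mem_cons, List.not_mem_nil, or_false, not_or] at h
  obtain ⟨⟨h1, h2, h3, h4, h5⟩, ⟨h6, h7, h8, h9⟩, ⟨h10, h11, h12⟩, ⟨h13, h14⟩, h15, -⟩ := h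
  rw [Finset.card_filter, Finset.card_filter, Finset.sum_insert, Finset.sum_insert,
    Finset.sum_singleton, Finset.sum_insert, Finset.sum_insert, Finset.sum_singleton]
  · simp only [Sym2.mem_iff]
    by_cases e1 : v = x
    · subst e1; simp [*]
    by_cases e2 : v = y
    · subst e2; simp [*]
    by_cases e3 : v = a
    · subst e3; simp [*]
    by_cases e4 : v = b
    · subst e4; simp [*]
    by_cases e5 : v = c
    · subst e5; simp [*]
    by_cases e6 : v = z
    · subst e6; simp [*]
    simp [*]
  all_goals
    simp only [Finset.mem_insert, Finset.mem_singleton, Sym2.eq_iff]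
    tauto

/-- The ways to switch `ya, bc, zx` to `xy, ab, cz`. -/
def fwd₆ (F K : SimpleGraph (Fin n)) (x y : Fin n) : ℕ :=
  cnt (fun t : (Fin n × Fin n) × (Fin n × Fin n) =>
    ((K \ F).Adj t.1.1 t.1.2 ∧ ((K \ F).Adj y t.2.1 ∧ Kᶜ.Adj t.1.1 t.2.1) ∧
      ((K \ F).Adj x t.2.2 ∧ Kᶜ.Adj t.1.2 t.2.2)) ∧
      t.2.1 ≠ t.2.2 ∧ t.1.1 ≠ x ∧ t.1.2 ≠ y)

/-- An upper bound for the number of ways to switch `xy, ab, cz` to `ya, bc, zx`. -/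
def rev₆ (K : SimpleGraph (Fin n)) (x y : Fin n) : ℕ :=
  cnt (fun t : (Fin n × Fin n) × (Fin n × Fin n) =>
    Kᶜ.Adj t.1.1 t.1.2 ∧ Kᶜ.Adj y t.2.1 ∧ Kᶜ.Adj x t.2.2)

theorem sum_fwd₆_le_sum_rev₆ (F : SimpleGraph (Fin n)) (d : ℕ) {x y : Fin n} (hxy : x ≠ y) :
    ∑ K ∈ extsWithout F d x y, fwd₆ F K x y ≤ ∑ K ∈ exts F d, rev₆ K x y := by
  have key := sum_switchings_le (τ := (Fin n × Fin n) × (Fin n × Fin n)) F d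
    (fun t => {s(y, t.2.1), s(t.1.1, t.1.2), s(t.2.2, x)})
    (fun t => {s(x, y), s(t.2.1, t.1.1), s(t.1.2, t.2.2)})
    (fun t => [x, y, t.2.1, t.1.1, t.1.2, t.2.2].Nodup)
    (by
      rintro ⟨⟨b, c⟩, ⟨a, z⟩⟩ h e he
      simp only [List.nodup_cons, List.mem_cons, List.not_mem_nil, or_false, not_or] at h
      simp only [Finset.mem_insert, Finset.mem_singleton] at he
      rcases he with rfl | rfl | rfl <;> rw [Sym2.mk_isDiag_iff] <;> tauto)
    (by
      rintro ⟨⟨b, c⟩, ⟨a, z⟩⟩ h v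
      exact card_filter_mem_triple h)
  refine le_trans ?_ (key.trans ?_)
  · rw [extsWithout, Finset.sum_filter]
    refine Finset.sum_le_sum fun K _ => ?_
    by_cases hK : K.Adj x y
    · rw [if_neg (not_not.2 hK)]
      exact Nat.zero_le _
    · rw [if_pos hK]
      refine cnt_mono ?_
      rintro ⟨⟨b, c⟩, ⟨a, z⟩⟩
      simp only [Finset.insert_subset_iff, SimpleGraph.compl_adj,
        Finset.singleton_subset_iff, Finset.mem_sdiff, mem_edges_pair,
        Finset.disjoint_insert_left, Finset.disjoint_singleton_left, SimpleGraph.sdiff_adj,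
        List.nodup_cons, List.mem_cons, List.not_mem_nil, or_false, not_or]
      rintro ⟨⟨hbc, ⟨hya, hba, hab⟩, hxz, hcz, hnz⟩, haz, hbx, hcy⟩
      rw [K.adj_comm z x, F.adj_comm z x, K.adj_comm a b]
      refine ⟨⟨⟨hxy, ?_, hbx.symm, ?_, hxz.1.ne⟩, ⟨hya.1.ne, ?_, hcy.symm, ?_⟩,
        ⟨hba.symm, ?_, haz⟩, ⟨hbc.1.ne, ?_⟩, hcz, not_false, List.nodup_nil⟩,
        ⟨hya, hbc, hxz⟩, hK, hab, hnz⟩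
      · rintro rfl; exact hK hya.1.symm
      · rintro rfl; exact hnz hxz.1
      · rintro rfl; exact hab hya.1
      · rintro rfl; exact hK hxz.1
      · rintro rfl; exact hab hbc.1
      · rintro rfl; exact hnz hbc.1.symm
  · refine Finset.sum_le_sum fun K _ => cnt_mono ?_
    rintro ⟨⟨b, c⟩, ⟨a, z⟩⟩
    simp only [Finset.insert_subset_iff, SimpleGraph.compl_adj,
      Finset.singleton_subset_iff, Finset.mem_sdiff, mem_edges_pair,
      Finset.disjoint_insert_left, Finset.disjoint_singleton_left,
      List.nodup_cons, List.mem_cons, List.not_mem_nil, or_false, not_or]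
    rw [K.adj_comm z x]
    tauto

theorem deg_compl {K : SimpleGraph (Fin n)} (v : Fin n) : deg Kᶜ v + deg K v + 1 = n := by
  have h1 : (Finset.univ.filter fun u => ¬ K.Adj v u) =
      insert v (Finset.univ.filter fun u => Kᶜ.Adj v u) := by
    ext u
    simp only [Finset.mem_filter, Finset.mem_univ, true_and, Finset.mem_insert,
      SimpleGraph.compl_adj]
    constructor
    · intro h
      by_cases huv : u = v
      · exact Or.inl huv
      · exact Or.inr ⟨fun h => huv h.symm, h⟩
    · rintro (rfl | h)
      · exact K.irrefl
      · exact h.2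
  have h2 := Finset.card_filter_add_card_filter_not (s := (Finset.univ : Finset (Fin n)))
    (fun u => K.Adj v u)
  have h3 : (Finset.univ.filter fun u => Kᶜ.Adj v u).card = deg Kᶜ v := by
    rw [deg_eq_card]
    congr
  rw [h1, Finset.card_insert_of_notMem (by simp), ← deg_eq_card, h3] at h2
  simp only [Finset.card_univ, Fintype.card_fin] at h2
  omega

theorem rev₆_le {K : SimpleGraph (Fin n)} {d' : ℕ} (h : ∀ v, deg Kᶜ v = d') (x y : Fin n) :
    rev₆ K x y ≤ n * d' ^ 3 := by
  have h2 := cnt_and_prod (fun t : Fin n × Fin n => Kᶜ.Adj t.1 t.2)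
    (fun t : Fin n × Fin n => Kᶜ.Adj y t.1 ∧ Kᶜ.Adj x t.2)
  have h3 := cnt_and_prod (Kᶜ.Adj y) (Kᶜ.Adj x)
  have h4 := cnt_adj_prod Kᶜ
  have h5 := cnt_adj Kᶜ x
  have h6 := cnt_adj Kᶜ y
  rw [rev₆, h2, h3, h4, h5, h6]
  simp only [h, Finset.sum_const, Finset.card_univ, Fintype.card_fin, smul_eq_mul]
  apply le_of_eq
  ring

/-- The number of `a` such that `va` is an edge of `K \ F` and `ba` is not an edge of `K`. -/
def altCount (F K : SimpleGraph (Fin n)) (v b : Fin n) : ℕ :=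
  cnt (fun a => (K \ F).Adj v a ∧ Kᶜ.Adj b a)

theorem altCount_le (F K : SimpleGraph (Fin n)) (v b : Fin n) : altCount F K v b ≤ deg Kᶜ b := by
  have := cnt_adj Kᶜ b
  rw [← this]
  exact cnt_mono fun a h => h.2

theorem sum_altCount (F K : SimpleGraph (Fin n)) {d' : ℕ} (h : ∀ v, deg Kᶜ v = d') (v : Fin n) :
    ∑ b, altCount F K v b = deg (K \ F) v * d' := by
  have h1 := cnt_prod (fun t : Fin n × Fin n => (K \ F).Adj v t.2 ∧ Kᶜ.Adj t.1 t.2)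
  have h2 := cnt_prod_right (fun t : Fin n × Fin n => (K \ F).Adj v t.2 ∧ Kᶜ.Adj t.1 t.2)
  unfold altCount
  rw [← cnt_adj, cnt, Finset.card_filter, Finset.sum_mul]
  refine (h1.symm.trans h2).trans (Finset.sum_congr rfl fun a _ => ?_)
  by_cases ha : (K \ F).Adj v a
  · have h3 := cnt_adj Kᶜ a
    rw [if_pos ha, one_mul, ← h a, ← h3]
    refine cnt_congr fun b => ?_
    simp only [Kᶜ.adj_comm b a]
    tauto
  · rw [if_neg ha, zero_mul]
    exact cnt_eq_zero fun b hb => ha hb.1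

theorem card_altCount_large (F K : SimpleGraph (Fin n)) {d' : ℕ} (h : ∀ v, deg Kᶜ v = d')
    (hd' : 0 < d') (v : Fin n) {β : ℝ} (hβ : 0 ≤ β) (hv : β * n ≤ deg (K \ F) v) :
    β / 2 * n ≤ (Finset.univ.filter fun b => β / 2 * d' ≤ altCount F K v b).card := by
  have hd0 : (0 : ℝ) < d' := by exact_mod_cast hd'
  have h1 : (∑ b, (altCount F K v b : ℝ)) = deg (K \ F) v * d' := by
    exact_mod_cast sum_altCount F K h v
  have h2 : ∀ b, (altCount F K v b : ℝ) ≤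
      (if β / 2 * d' ≤ altCount F K v b then (d' : ℝ) else 0) + β / 2 * d' := by
    intro b
    split_ifs with hb
    · have : (altCount F K v b : ℝ) ≤ d' := by
        rw [← h b]
        exact_mod_cast altCount_le F K v b
      have : 0 ≤ β / 2 * d' := by positivity
      linarith
    · linarith
  have h3 := Finset.sum_le_sum fun b (_ : b ∈ Finset.univ) => h2 b
  rw [h1, Finset.sum_add_distrib, ← Finset.sum_filter, Finset.sum_const, Finset.sum_const,
    nsmul_eq_mul, nsmul_eq_mul, Finset.card_univ, Fintype.card_fin] at h3
  have h4 := mul_le_mul_of_nonneg_right hv hd0.le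
  have h5 : (β / 2 * n) * d' ≤
      ((Finset.univ.filter fun b => β / 2 * d' ≤ altCount F K v b).card : ℝ) * d' := by
    linarith
  exact le_of_mul_le_mul_right h5 hd0

theorem fwd₆_ge_sum (F K : SimpleGraph (Fin n)) {d' : ℕ} (h : ∀ v, deg Kᶜ v = d') (x y : Fin n) :
    ∑ t : Fin n × Fin n, (if (K \ F).Adj t.1 t.2 then altCount F K y t.1 * altCount F K x t.2
      else 0) ≤ fwd₆ F K x y + 3 * (n * d' ^ 2) := by
  have hL : ∀ b, cnt (Kᶜ.Adj b) = d' := fun b => by rw [cnt_adj, h]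
  have hfst : ∀ u : Fin n, cnt (fun t : Fin n × Fin n => t.1 = u) = n := fun u => by
    have := cnt_and_prod (fun a : Fin n => a = u) (fun _ : Fin n => True)
    simp only [and_true] at this
    rw [this, cnt_eq_one, one_mul]
    simp [cnt]
  have hsnd : ∀ u : Fin n, cnt (fun t : Fin n × Fin n => t.2 = u) = n := fun u => by
    have := cnt_and_prod (fun _ : Fin n => True) (fun a : Fin n => a = u)
    simp only [true_and] at this
    rw [this, cnt_eq_one, mul_one]
    simp [cnt]
  have hdiag : cnt (fun t : Fin n × Fin n => t.1 = t.2) = n := by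
    rw [cnt_prod]
    have : ∀ a : Fin n, cnt (fun b => a = b) = 1 := fun a => by
      simp_rw [eq_comm (a := a)]; exact cnt_eq_one a
    simp [this]
  have hQ : ∀ t : Fin n × Fin n,
      cnt (fun s : Fin n × Fin n => Kᶜ.Adj t.1 s.1 ∧ Kᶜ.Adj t.2 s.2) ≤ d' ^ 2 := fun t => by
    rw [cnt_and_prod, hL, hL, sq]
  have e1 := cnt_prod_le (fun t : Fin n × Fin n => t.1 = x)
    (fun t s : Fin n × Fin n => Kᶜ.Adj t.1 s.1 ∧ Kᶜ.Adj t.2 s.2) _ fun t _ => hQ t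
  have e2 := cnt_prod_le (fun t : Fin n × Fin n => t.2 = y)
    (fun t s : Fin n × Fin n => Kᶜ.Adj t.1 s.1 ∧ Kᶜ.Adj t.2 s.2) _ fun t _ => hQ t
  have e3 := cnt_prod_le (fun t : Fin n × Fin n => t.1 = t.2)
    (fun t s : Fin n × Fin n => Kᶜ.Adj t.1 s.1 ∧ Kᶜ.Adj t.2 s.2) _ fun t _ => hQ t
  rw [cnt_swap] at e3
  simp only [hfst, hsnd, hdiag] at e1 e2 e3
  have e4 : ∑ t : Fin n × Fin n, (if (K \ F).Adj t.1 t.2 then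
      altCount F K y t.1 * altCount F K x t.2 else 0) =
      cnt (fun t : (Fin n × Fin n) × (Fin n × Fin n) =>
    ((K \ F).Adj t.1.1 t.1.2 ∧ ((K \ F).Adj y t.2.1 ∧ Kᶜ.Adj t.1.1 t.2.1) ∧
      ((K \ F).Adj x t.2.2 ∧ Kᶜ.Adj t.1.2 t.2.2))) := by
    rw [cnt_prod]
    refine Finset.sum_congr rfl fun t _ => ?_
    split_ifs with ht
    · unfold altCount
      rw [← cnt_and_prod]
      exact cnt_congr fun s => by simp only [ht, true_and]
    · exact (cnt_eq_zero fun s hs => ht hs.1).symm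
  rw [e4]
  have e5 : cnt (fun t : (Fin n × Fin n) × (Fin n × Fin n) =>
    ((K \ F).Adj t.1.1 t.1.2 ∧ ((K \ F).Adj y t.2.1 ∧ Kᶜ.Adj t.1.1 t.2.1) ∧
      ((K \ F).Adj x t.2.2 ∧ Kᶜ.Adj t.1.2 t.2.2))) ≤ fwd₆ F K x y +
      (cnt (fun t : (Fin n × Fin n) × (Fin n × Fin n) =>
        t.1.1 = x ∧ Kᶜ.Adj t.1.1 t.2.1 ∧ Kᶜ.Adj t.1.2 t.2.2) +
      (cnt (fun t : (Fin n × Fin n) × (Fin n × Fin n) =>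
        t.1.2 = y ∧ Kᶜ.Adj t.1.1 t.2.1 ∧ Kᶜ.Adj t.1.2 t.2.2) +
      cnt (fun t : (Fin n × Fin n) × (Fin n × Fin n) =>
        t.2.1 = t.2.2 ∧ Kᶜ.Adj t.2.1 t.1.1 ∧ Kᶜ.Adj t.2.2 t.1.2))) := by
    refine (cnt_le_add (R := fun t => _ ∨ (_ ∨ _)) ?_).trans
      (Nat.add_le_add_left ((cnt_or_le _ _).trans (Nat.add_le_add_left (cnt_or_le _ _) _)) _)
    rintro ⟨⟨b, c⟩, ⟨a, z⟩⟩
    simp only [ne_eq, Kᶜ.adj_comm a b, Kᶜ.adj_comm z c]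
    tauto
  omega

theorem eb_mul_le_sum (M : SimpleGraph (Fin n)) [DecidableRel M.Adj] (f g : Fin n → ℕ)
    (B C : Finset (Fin n)) {T : ℝ} (hT : 0 ≤ T) (hB : ∀ b ∈ B, T ≤ f b) (hC : ∀ c ∈ C, T ≤ g c) :
    (eb M B C : ℝ) * T ^ 2 ≤
      ((∑ t : Fin n × Fin n, (if M.Adj t.1 t.2 then f t.1 * g t.2 else 0) : ℕ) : ℝ) := by
  have h0 : eb M B C = ∑ t ∈ B ×ˢ C, if M.Adj t.1 t.2 then 1 else 0 := by
    rw [eb, Finset.card_filter]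
    refine Finset.sum_congr rfl fun t _ => ?_
    congr
  rw [h0]
  push_cast
  rw [Finset.sum_mul]
  refine (Finset.sum_le_sum fun t ht => ?_).trans
    (Finset.sum_le_sum_of_subset_of_nonneg (Finset.subset_univ _) fun t _ _ => ?_)
  · rw [Finset.mem_product] at ht
    split_ifs
    · rw [one_mul, sq]
      exact mul_le_mul (hB _ ht.1) (hC _ ht.2) hT (Nat.cast_nonneg _)
    · simp
  · split_ifs
    · positivity
    · exact le_rfl

/-- A lower bound for `fwd₆` when `K \ F` has many edges between any two large sets. -/
theorem fwd₆_ge (F K : SimpleGraph (Fin n)) {d' : ℕ} (h : ∀ v, deg Kᶜ v = d')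
    (hd' : 0 < d') (x y : Fin n) {β κ : ℝ} (hβ : 0 ≤ β) (hv : ∀ v, β * n ≤ deg (K \ F) v)
    (hM : ∀ B C : Finset (Fin n), β / 2 * n ≤ B.card → β / 2 * n ≤ C.card →
      κ * n ^ 2 ≤ eb (K \ F) B C) :
    κ * n ^ 2 * (β / 2 * d') ^ 2 ≤ fwd₆ F K x y + 3 * (n * d' ^ 2) := by
  have h1 := fwd₆_ge_sum F K h x y
  obtain ⟨B, hB, hB'⟩ : ∃ B : Finset (Fin n), β / 2 * n ≤ B.card ∧
      ∀ b ∈ B, β / 2 * d' ≤ altCount F K y b :=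
    ⟨_, card_altCount_large F K h hd' y hβ (hv y), fun b hb => (Finset.mem_filter.1 hb).2⟩
  obtain ⟨C, hC, hC'⟩ : ∃ C : Finset (Fin n), β / 2 * n ≤ C.card ∧
      ∀ c ∈ C, β / 2 * d' ≤ altCount F K x c :=
    ⟨_, card_altCount_large F K h hd' x hβ (hv x), fun b hb => (Finset.mem_filter.1 hb).2⟩
  have h2 := hM B C hB hC
  have h3 := eb_mul_le_sum (K \ F) (altCount F K y) (altCount F K x) B C
    (T := β / 2 * d') (by positivity) hB' hC'
  have h4 := mul_le_mul_of_nonneg_right h2 (sq_nonneg (β / 2 * (d' : ℝ)))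
  refine (h4.trans h3).trans ?_
  exact_mod_cast h1

theorem eb_sdiff {F K : SimpleGraph (Fin n)} (h : F ≤ K) (A B : Finset (Fin n)) :
    eb (K \ F) A B + eb F A B = eb K A B := by
  have h1 : edges (K \ F) = edges K \ edges F := by
    ext e
    induction e with
    | _ a b => simp only [Finset.mem_sdiff, mem_edges_pair, SimpleGraph.sdiff_adj]
  rw [eb_eq_sum_mult, eb_eq_sum_mult, eb_eq_sum_mult, h1]
  exact Finset.sum_sdiff (edges_subset_edges.2 h)

theorem eb_compl (K : SimpleGraph (Fin n)) (A B : Finset (Fin n)) :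
    eb Kᶜ A B + eb K A B = eb ⊤ A B := by
  rw [← top_sdiff]
  exact eb_sdiff le_top A B

theorem eb_le_sum_deg (G : SimpleGraph (Fin n)) (A B : Finset (Fin n)) :
    eb G A B ≤ ∑ v, deg G v := by
  rw [← cnt_adj_prod, cnt, eb]
  refine Finset.card_le_card fun t => ?_
  simp only [Finset.mem_filter, Finset.mem_univ, true_and]
  tauto

theorem eb_sdiff_ge {F K : SimpleGraph (Fin n)} {d' : ℕ} (hFK : F ≤ K) (h : ∀ v, deg Kᶜ v = d')
    {p γ β : ℝ} (hβ : 0 ≤ β) (hp : β ≤ p)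
    (hcut : ∀ A B, (eb F A B : ℝ) ≤ (1 - p) * (A.card * B.card) + γ * n ^ 2)
    (hγ : γ ≤ β ^ 3 / 16) (hd : (d' : ℝ) ≤ β ^ 3 / 16 * n) (hn : 1 ≤ β ^ 3 / 16 * n)
    {B C : Finset (Fin n)} (hB : β / 2 * n ≤ B.card) (hC : β / 2 * n ≤ C.card) :
    β ^ 3 / 16 * n ^ 2 ≤ eb (K \ F) B C := by
  have h1 := eb_sdiff hFK B C
  have h2 := eb_compl K B C
  have h3 := eb_top B C
  have h4 := eb_le_sum_deg Kᶜ B C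
  simp only [h, Finset.sum_const, Finset.card_univ, Fintype.card_fin, smul_eq_mul] at h4
  have h5 := card_le_n (B ∩ C)
  have h6 := hcut B C
  have e1 : (eb (K \ F) B C : ℝ) + eb F B C = eb K B C := by exact_mod_cast h1
  have e2 : (eb Kᶜ B C : ℝ) + eb K B C + (B ∩ C).card = B.card * C.card := by
    rw [← h2] at h3; exact_mod_cast h3
  have e4 : (eb Kᶜ B C : ℝ) ≤ n * d' := by exact_mod_cast h4
  have e5 : ((B ∩ C).card : ℝ) ≤ n := by exact_mod_cast h5
  have hn0 : (0 : ℝ) ≤ n := Nat.cast_nonneg n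
  have e7 : β * (β / 2 * n * (β / 2 * n)) ≤ p * (B.card * C.card) :=
    mul_le_mul hp (mul_le_mul hB hC (by positivity) (by positivity)) (by positivity)
      (hβ.trans hp)
  have e8 := mul_le_mul_of_nonneg_right hγ (sq_nonneg (n : ℝ))
  have e9 := mul_le_mul_of_nonneg_left hd hn0
  have e10 := mul_le_mul_of_nonneg_left hn hn0
  nlinarith

theorem card_extsWithout_dense (F : SimpleGraph (Fin n)) {d d' : ℕ} (hdn : d + d' + 1 = n)
    {x y : Fin n} (hxy : x ≠ y) {p γ β : ℝ} (hβ : 0 < β) (hp : β ≤ p)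
    (hcut : ∀ A B, (eb F A B : ℝ) ≤ (1 - p) * (A.card * B.card) + γ * n ^ 2)
    (hdeg : ∀ v, β * n ≤ d - deg F v)
    (hγ : γ ≤ β ^ 3 / 16) (hd : (d' : ℝ) ≤ β ^ 3 / 16 * n) (hn : 1 ≤ β ^ 3 / 16 * n)
    (hn' : 24 ≤ β ^ 5 / 16 * n) :
    ((extsWithout F d x y).card : ℝ) * (β ^ 5 / 128 * n) ≤ d' * (exts F d).card := by
  have hcompl : ∀ K ∈ exts F d, ∀ v, deg Kᶜ v = d' := fun K hK v => by
    have h1 := deg_compl (K := K) v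
    have h2 := (mem_exts.1 hK).1 v
    omega
  rcases Nat.eq_zero_or_pos d' with h0 | hpos
  · have : extsWithout F d x y = ∅ := by
      rw [Finset.eq_empty_iff_forall_notMem]
      intro K hK
      obtain ⟨hK1, hK2⟩ := Finset.mem_filter.1 hK
      have h1 := hcompl K hK1 x
      rw [h0, deg_eq_degree, SimpleGraph.degree_eq_zero_iff_notMem_support] at h1
      exact h1 ⟨y, (SimpleGraph.compl_adj _ _ _).2 ⟨hxy, hK2⟩⟩
    rw [this, h0]
    simp
  have h1 : ∀ K ∈ extsWithout F d x y, β ^ 5 / 128 * n ^ 2 * d' ^ 2 ≤ (fwd₆ F K x y : ℝ) := by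
    intro K hK
    have hK1 := (Finset.mem_filter.1 hK).1
    have h2 := fwd₆_ge F K (hcompl K hK1) hpos x y hβ.le
      (fun v => by rw [deg_sdiff_of_mem_exts hK1]; exact hdeg v)
      (fun B C hB hC => eb_sdiff_ge (mem_exts.1 hK1).2 (hcompl K hK1) hβ.le hp hcut hγ hd hn hB hC)
    have h3 : (24 : ℝ) * (n * d' ^ 2) ≤ β ^ 5 / 16 * n * (n * d' ^ 2) :=
      mul_le_mul_of_nonneg_right hn' (by positivity)
    have h4 : β ^ 3 / 16 * (n : ℝ) ^ 2 * (β / 2 * d') ^ 2 =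
      β ^ 5 / 64 * n ^ 2 * d' ^ 2 := by ring
    rw [h4] at h2
    nlinarith
  have h2 : ((∑ K ∈ extsWithout F d x y, fwd₆ F K x y : ℕ) : ℝ) ≤
      ((∑ K ∈ exts F d, rev₆ K x y : ℕ) : ℝ) := by exact_mod_cast sum_fwd₆_le_sum_rev₆ F d hxy
  have h3 : ∑ K ∈ exts F d, rev₆ K x y ≤ (exts F d).card * (n * d' ^ 3) := by
    rw [← smul_eq_mul]
    exact Finset.sum_le_card_nsmul _ _ _ fun K hK => rev₆_le (hcompl K hK) x y
  have h3' : ((∑ K ∈ exts F d, rev₆ K x y : ℕ) : ℝ) ≤ (exts F d).card * (n * d' ^ 3) := by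
    exact_mod_cast h3
  have h4 : ((extsWithout F d x y).card : ℝ) * (β ^ 5 / 128 * n ^ 2 * d' ^ 2) ≤
      ((∑ K ∈ extsWithout F d x y, fwd₆ F K x y : ℕ) : ℝ) := by
    rw [← nsmul_eq_mul]
    push_cast
    exact Finset.card_nsmul_le_sum _ _ _ h1
  have h5 := h4.trans (h2.trans h3')
  have hnpos : (0 : ℝ) < n * d' ^ 2 := by
    have : 0 < n := by omega
    positivity
  refine le_of_mul_le_mul_right ?_ hnpos
  calc _ = ((extsWithout F d x y).card : ℝ) * (β ^ 5 / 128 * n ^ 2 * d' ^ 2) := by ring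
    _ ≤ _ := h5
    _ = _ := by ring

theorem card_extsWith_compare_dense (F : SimpleGraph (Fin n)) {d d' : ℕ} (hdn : d + d' + 1 = n)
    {x y x' y' : Fin n} (hxy' : x' ≠ y') {p γ β η : ℝ} (hη : 0 < η) (hη1 : η ≤ 1)
    (hβ : 0 < β) (hβ1 : β ≤ 1) (hp : β ≤ p)
    (hcut : ∀ A B, (eb F A B : ℝ) ≤ (1 - p) * (A.card * B.card) + γ * n ^ 2)
    (hdeg : ∀ v, β * n ≤ d - deg F v)
    (hγ : γ ≤ β ^ 3 / 16) (hd : (d' : ℝ) ≤ η * β ^ 5 / 512 * n) (hn : 24 ≤ β ^ 5 / 16 * n) :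
    ((extsWith F d x y).card : ℝ) ≤ (1 + η) * (extsWith F d x' y').card := by
  have hn0 : (0 : ℝ) < n := by
    have : 0 < n := by omega
    exact_mod_cast this
  have hβ5 : β ^ 5 ≤ β ^ 3 := pow_le_pow_of_le_one hβ.le hβ1 (by norm_num)
  have h5 : 0 < β ^ 5 := by positivity
  have hd1 : (d' : ℝ) ≤ β ^ 3 / 16 * n := by
    refine hd.trans (mul_le_mul_of_nonneg_right ?_ hn0.le)
    have : η * β ^ 5 ≤ 1 * β ^ 5 := mul_le_mul_of_nonneg_right hη1 h5.le
    linarith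
  have hn1 : 1 ≤ β ^ 3 / 16 * n := by
    have : β ^ 5 / 16 * n ≤ β ^ 3 / 16 * n := mul_le_mul_of_nonneg_right (by linarith) hn0.le
    linarith
  have h1 := card_extsWithout_dense F hdn hxy' hβ hp hcut hdeg hγ hd1 hn1 hn
  have h2 : ((extsWith F d x' y').card : ℝ) + (extsWithout F d x' y').card = (exts F d).card := by
    exact_mod_cast card_extsWith_add F d x' y'
  have h3 : ((extsWith F d x y).card : ℝ) ≤ (exts F d).card := by
    have := card_extsWith_add F d x y
    exact_mod_cast (by omega : (extsWith F d x y).card ≤ (exts F d).card)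
  have h4 : ((extsWithout F d x' y').card : ℝ) * (β ^ 5 / 128 * n) ≤
      (η / 4 * (exts F d).card) * (β ^ 5 / 128 * n) := by
    refine h1.trans ((mul_le_mul_of_nonneg_right hd (Nat.cast_nonneg _)).trans (le_of_eq ?_))
    ring
  have h6 := le_of_mul_le_mul_right h4 (by positivity)
  have h7 : (0 : ℝ) ≤ (exts F d).card := Nat.cast_nonneg _
  nlinarith

theorem abs_sum_sub_le {α : Type*} (S : Finset α) (f : α → ℕ) (Q : α → Prop) {X κ M : ℝ}
    (hX0 : 0 ≤ X) (hX : X ≤ M) (hκ : 0 ≤ κ) (hf : ∀ a ∈ S, (f a : ℝ) ≤ M)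
    (hQ : ∀ a ∈ S, Q a → |(f a : ℝ) - X| ≤ κ) :
    |((∑ a ∈ S, f a : ℕ) : ℝ) - X * S.card| ≤ κ * S.card + M * (S.filter fun a => ¬ Q a).card := by
  have h1 : ((∑ a ∈ S, f a : ℕ) : ℝ) - X * S.card = ∑ a ∈ S, ((f a : ℝ) - X) := by
    rw [Finset.sum_sub_distrib, Finset.sum_const, nsmul_eq_mul]
    push_cast
    ring
  have h2 : κ * S.card + M * (S.filter fun a => ¬ Q a).card =
      ∑ a ∈ S, (κ + if ¬ Q a then M else 0) := by
    rw [Finset.sum_add_distrib, ← Finset.sum_filter, Finset.sum_const, Finset.sum_const,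
      nsmul_eq_mul, nsmul_eq_mul]
    ring
  rw [h1, h2]
  refine (Finset.abs_sum_le_sum_abs _ _).trans (Finset.sum_le_sum fun a ha => ?_)
  by_cases h : Q a
  · simpa [h] using hQ a ha h
  · have h3 := hf a ha
    have h4 : (0 : ℝ) ≤ f a := Nat.cast_nonneg _
    rw [if_pos h, abs_le]
    constructor <;> linarith

theorem fwd_le_sq (F K : SimpleGraph (Fin n)) (x y : Fin n) : fwd F K x y ≤ n ^ 2 := by
  refine (Finset.card_le_univ _).trans (le_of_eq ?_)
  rw [Fintype.card_prod, Fintype.card_fin, sq]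

theorem rev_le_sq (F K : SimpleGraph (Fin n)) (x y : Fin n) : rev F K x y ≤ n ^ 2 := by
  refine (Finset.card_le_univ _).trans (le_of_eq ?_)
  rw [Fintype.card_prod, Fintype.card_fin, sq]

theorem card_extsWith_approx (F : SimpleGraph (Fin n)) (d : ℕ) {x y : Fin n} (hxy : x ≠ y)
    (hF : ¬ F.Adj x y) (Q : SimpleGraph (Fin n) → Prop) {X Y κ σ : ℝ} (hκ : 0 ≤ κ)
    (hX0 : 0 ≤ X) (hX : X ≤ n ^ 2) (hY0 : 0 ≤ Y) (hY : Y ≤ n ^ 2)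
    (hbad : (((exts F d).filter fun K => ¬ Q K).card : ℝ) ≤ σ * (exts F d).card)
    (hfwd : ∀ K ∈ exts F d, Q K → |(fwd F K x y : ℝ) - X| ≤ κ * n ^ 2)
    (hrev : ∀ K ∈ exts F d, Q K → |(rev F K x y : ℝ) - Y| ≤ κ * n ^ 2) :
    |(X + Y) * (extsWith F d x y).card - Y * (exts F d).card| ≤
      (κ + σ) * n ^ 2 * (exts F d).card := by
  have hsub1 : extsWith F d x y ⊆ exts F d := Finset.filter_subset _ _
  have hsub2 : extsWithout F d x y ⊆ exts F d := Finset.filter_subset _ _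
  have h1 := abs_sum_sub_le (extsWith F d x y) (fun K => fwd F K x y) Q hX0 hX
    (by positivity : 0 ≤ κ * (n : ℝ) ^ 2) (fun K _ => by exact_mod_cast fwd_le_sq F K x y)
    (fun K hK => hfwd K (hsub1 hK))
  have h2 := abs_sum_sub_le (extsWithout F d x y) (fun K => rev F K x y) Q hY0 hY
    (by positivity : 0 ≤ κ * (n : ℝ) ^ 2) (fun K _ => by exact_mod_cast rev_le_sq F K x y)
    (fun K hK => hrev K (hsub2 hK))
  rw [sum_fwd_eq_sum_rev F d hxy hF] at h1
  have h3 : ((extsWith F d x y).card : ℝ) + (extsWithout F d x y).card = (exts F d).card := by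
    exact_mod_cast card_extsWith_add F d x y
  have h4 : (((extsWith F d x y).filter fun K => ¬ Q K).card : ℝ) +
      ((extsWithout F d x y).filter fun K => ¬ Q K).card ≤
      ((exts F d).filter fun K => ¬ Q K).card := by
    rw [← Nat.cast_add, Nat.cast_le, ← Finset.card_union_of_disjoint]
    · exact Finset.card_le_card (Finset.union_subset (Finset.filter_subset_filter _ hsub1)
        (Finset.filter_subset_filter _ hsub2))
    · refine Finset.disjoint_left.2 fun K hK hK' => ?_
      exact (Finset.mem_filter.1 (Finset.mem_filter.1 hK').1).2
        (Finset.mem_filter.1 (Finset.mem_filter.1 hK).1).2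
  have h5 : (n : ℝ) ^ 2 * ((((extsWith F d x y).filter fun K => ¬ Q K).card : ℝ) +
      ((extsWithout F d x y).filter fun K => ¬ Q K).card) ≤
      (n : ℝ) ^ 2 * (σ * (exts F d).card) :=
    mul_le_mul_of_nonneg_left (h4.trans hbad) (by positivity)
  have e : (X + Y) * (extsWith F d x y).card - Y * (exts F d).card =
      X * (extsWith F d x y).card - Y * (extsWithout F d x y).card := by
    rw [← h3]; ring
  have e2 : (κ + σ) * n ^ 2 * (exts F d).card = κ * n ^ 2 * (extsWith F d x y).card +
    κ * n ^ 2 * (extsWithout F d x y).card + (n : ℝ) ^ 2 * (σ * (exts F d).card) := by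
    rw [← h3]; ring
  rw [e, e2, abs_le]
  rw [abs_le] at h1 h2
  rw [mul_add] at h5
  constructor <;> linarith [h1.1, h1.2, h2.1, h2.2]

theorem abs_eb_sub_le {K : SimpleGraph (Fin n)} {α γ : ℝ} (hα0 : 0 ≤ α) (hα : α ≤ 1)
    (h : CutClose K ⊤ α γ) (hn : 1 ≤ γ * n) (A B : Finset (Fin n)) :
    |(eb K A B : ℝ) - α * (A.card * B.card)| ≤ 2 * γ * n ^ 2 := by
  have h1 := h A B
  have h2 : (eb (⊤ : SimpleGraph (Fin n)) A B : ℝ) + (A ∩ B).card = A.card * B.card := by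
    exact_mod_cast eb_top A B
  have h3 : ((A ∩ B).card : ℝ) ≤ n := by exact_mod_cast card_le_n (A ∩ B)
  have h4 := mul_le_mul_of_nonneg_right hn (Nat.cast_nonneg (α := ℝ) n)
  have h5 : (0 : ℝ) ≤ (A ∩ B).card := Nat.cast_nonneg _
  have h6 := mul_le_mul_of_nonneg_right hα h5
  have h7 := mul_nonneg hα0 h5
  rw [← h2, abs_le] at *
  constructor <;> nlinarith [h1.1, h1.2]

theorem abs_eb_sdiff_sub_le {F K : SimpleGraph (Fin n)} {α p γ : ℝ} (hFK : F ≤ K) (hα0 : 0 ≤ α)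
    (hα : α ≤ 1) (hp0 : 0 ≤ p) (hp : p ≤ 1) (hF : CutClose F K (1 - p) γ) (h : CutClose K ⊤ α γ)
    (hn : 1 ≤ γ * n) (A B : Finset (Fin n)) :
    |(eb (K \ F) A B : ℝ) - p * α * (A.card * B.card)| ≤ 3 * γ * n ^ 2 := by
  have h1 := abs_eb_sub_le hα0 hα h hn A B
  have h2 : (eb (K \ F) A B : ℝ) + eb F A B = eb K A B := by exact_mod_cast eb_sdiff hFK A B
  have h3 := hF A B
  have h4 := abs_le.1 ((abs_mul p _).le.trans (mul_le_mul (abs_of_nonneg hp0).le h1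
    (abs_nonneg _) hp0))
  have h5 := mul_le_mul_of_nonneg_right hp ((abs_nonneg _).trans h1)
  rw [abs_le] at h3 ⊢
  constructor <;> nlinarith [h3.1, h3.2, h4.1, h4.2]

theorem fwd_eq_eb (F K : SimpleGraph (Fin n)) (x y : Fin n) :
    fwd F K x y = eb (K \ F) (Finset.univ.filter fun a => Kᶜ.Adj x a)
      (Finset.univ.filter fun a => Kᶜ.Adj y a) := by
  rw [fwd, cnt, eb]
  congr 1
  ext t
  simp only [Finset.mem_filter, Finset.mem_univ, true_and, Finset.mem_product,
    SimpleGraph.compl_adj]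
  rw [ne_comm (a := x), ne_comm (a := y)]
  tauto

theorem rev_eq_eb (F K : SimpleGraph (Fin n)) (x y : Fin n) :
    rev F K x y = eb Kᶜ (Finset.univ.filter fun a => (K \ F).Adj x a)
      (Finset.univ.filter fun a => (K \ F).Adj y a) := by
  rw [rev, cnt, eb]
  congr 1
  ext t
  simp only [Finset.mem_filter, Finset.mem_univ, true_and, Finset.mem_product,
    SimpleGraph.compl_adj]
  tauto

theorem card_filter_adj (G : SimpleGraph (Fin n)) [DecidableRel G.Adj] (v : Fin n) :
    (Finset.univ.filter fun a => G.Adj v a).card = deg G v := by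
  rw [deg_eq_card]
  congr

theorem abs_fwd_sub_le {F K : SimpleGraph (Fin n)} {d' : ℕ} {α p γ : ℝ} (hFK : F ≤ K)
    (hd' : ∀ v, deg Kᶜ v = d') (hα0 : 0 ≤ α)
    (hα : α ≤ 1) (hp0 : 0 ≤ p) (hp : p ≤ 1) (hF : CutClose F K (1 - p) γ) (h : CutClose K ⊤ α γ)
    (hn : 1 ≤ γ * n) (x y : Fin n) :
    |(fwd F K x y : ℝ) - p * α * d' ^ 2| ≤ 3 * γ * n ^ 2 := by
  have h1 := abs_eb_sdiff_sub_le hFK hα0 hα hp0 hp hF h hn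
    (Finset.univ.filter fun a => Kᶜ.Adj x a) (Finset.univ.filter fun a => Kᶜ.Adj y a)
  have h2 := fwd_eq_eb F K x y
  have h3 := card_filter_adj Kᶜ x
  have h4 := card_filter_adj Kᶜ y
  rw [h3, h4, hd', hd', ← h2, ← sq] at h1
  exact h1

theorem mul_approx {a b D M γ : ℝ} (hD : 0 ≤ D) (hDM : D ≤ M) (hγ0 : 0 ≤ γ) (hγ : γ ≤ 1)
    (ha : |a - D| ≤ γ * D) (hb : |b - D| ≤ γ * D) : |a * b - D ^ 2| ≤ 3 * γ * M ^ 2 := by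
  have h1 : a * b - D ^ 2 = (a - D) * (b - D) + D * (a - D) + D * (b - D) := by ring
  have h2 : |(a - D) * (b - D)| ≤ (γ * D) * (γ * D) := by
    rw [abs_mul]
    exact mul_le_mul ha hb (abs_nonneg _) (by positivity)
  have h3 : |D * (a - D)| ≤ D * (γ * D) := by
    rw [abs_mul, abs_of_nonneg hD]
    exact mul_le_mul_of_nonneg_left ha hD
  have h4 : |D * (b - D)| ≤ D * (γ * D) := by
    rw [abs_mul, abs_of_nonneg hD]
    exact mul_le_mul_of_nonneg_left hb hD
  have h5 := abs_add_le ((a - D) * (b - D) + D * (a - D)) (D * (b - D))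
  have h6 := abs_add_le ((a - D) * (b - D)) (D * (a - D))
  have h7 : D ^ 2 ≤ M ^ 2 := pow_le_pow_left₀ hD hDM 2
  have h8 : γ * γ * D ^ 2 ≤ 1 * γ * D ^ 2 := by gcongr
  have h9 : γ * D ^ 2 ≤ γ * M ^ 2 := by gcongr
  rw [h1]
  nlinarith

theorem abs_rev_sub_le {F K : SimpleGraph (Fin n)} {d : ℕ} {α γ D : ℝ} (hK : K ∈ exts F d)
    (hα0 : 0 ≤ α) (hα : α ≤ 1) (hD : 0 ≤ D) (hDn : D ≤ n) (hγ : γ ≤ 1)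
    (hbal : Balanced F d D γ) (h : CutClose K ⊤ α γ) (hn : 1 ≤ γ * n) (x y : Fin n) :
    |(rev F K x y : ℝ) - (1 - α) * D ^ 2| ≤ 6 * γ * n ^ 2 := by
  have hγ0 : 0 ≤ γ := by
    by_contra hlt
    push Not at hlt
    have := mul_nonpos_of_nonpos_of_nonneg hlt.le (Nat.cast_nonneg (α := ℝ) n)
    linarith
  obtain ⟨A, hA⟩ : ∃ A : Finset (Fin n), A = Finset.univ.filter fun a => (K \ F).Adj x a :=
    ⟨_, rfl⟩
  obtain ⟨B, hB⟩ : ∃ B : Finset (Fin n), B = Finset.univ.filter fun a => (K \ F).Adj y a :=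
    ⟨_, rfl⟩
  have h0 : rev F K x y = eb Kᶜ A B := by rw [hA, hB]; exact rev_eq_eb F K x y
  have h1 := abs_eb_sub_le hα0 hα h hn A B
  have h2 : (eb Kᶜ A B : ℝ) + eb K A B + (A ∩ B).card = A.card * B.card := by
    have := eb_top A B
    rw [← eb_compl K] at this
    exact_mod_cast this
  have h3 : ((A ∩ B).card : ℝ) ≤ n := by exact_mod_cast card_le_n (A ∩ B)
  have h4 := mul_le_mul_of_nonneg_right hn (Nat.cast_nonneg (α := ℝ) n)
  have h5 : (A.card : ℝ) = d - deg F x := by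
    rw [← deg_sdiff_of_mem_exts hK, ← card_filter_adj (K \ F) x, hA]
  have h6 : (B.card : ℝ) = d - deg F y := by
    rw [← deg_sdiff_of_mem_exts hK, ← card_filter_adj (K \ F) y, hB]
  have h7 := mul_approx hD hDn hγ0 hγ (hbal x) (hbal y)
  rw [← h5, ← h6] at h7
  have h8 : |(1 - α) * ((A.card : ℝ) * B.card - D ^ 2)| ≤ 1 * (3 * γ * n ^ 2) := by
    rw [abs_mul, abs_of_nonneg (by linarith)]
    exact mul_le_mul (by linarith) h7 (abs_nonneg _) (by norm_num)
  have h9 : (0 : ℝ) ≤ (A ∩ B).card := Nat.cast_nonneg _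
  rw [h0]
  rw [abs_le] at *
  constructor <;> nlinarith [h1.1, h1.2, h8.1, h8.2]

/-- The edges of `F` and of `K` are distributed as expected over all pairs of sets. -/
def Typical (F K : SimpleGraph (Fin n)) (d : ℕ) (p γ : ℝ) : Prop :=
  CutClose F K (1 - p) γ ∧ CutClose K ⊤ ((d : ℝ) / (n - 1 : ℕ)) γ

theorem card_extsWith_compare_mid (F : SimpleGraph (Fin n)) {d d' : ℕ} (hdn : d + d' + 1 = n)
    {x y x' y' : Fin n} (hxy : x ≠ y) (hF : ¬ F.Adj x y) (hxy' : x' ≠ y') (hF' : ¬ F.Adj x' y')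
    {p γ β δ σ η : ℝ} (hη : 0 < η) (hη1 : η ≤ 1) (hβ : 0 < β) (hδ : 0 < δ) (hp0 : 0 ≤ p)
    (hp : p ≤ 1) (hγ : γ ≤ 1) (hn : 1 ≤ γ * n)
    (hbad : (((exts F d).filter fun K => ¬ Typical F K d p γ).card : ℝ) ≤ σ * (exts F d).card)
    (hbal : Balanced F d (p * d) γ) (hβd : β * n ≤ p * d) (hδd : δ * n ≤ d')
    (hsmall : 3 * (6 * γ + σ) ≤ η * (δ * β ^ 2)) :
    ((extsWith F d x y).card : ℝ) ≤ (1 + η) * (extsWith F d x' y').card := by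
  have hn2 : 2 ≤ n := by
    have h1 := x.isLt
    have h2 := y.isLt
    have h3 := Fin.val_ne_of_ne hxy
    omega
  have hnR : (2 : ℝ) ≤ n := by exact_mod_cast hn2
  have hn1 : ((n - 1 : ℕ) : ℝ) = n - 1 := by
    rw [Nat.cast_sub (by omega), Nat.cast_one]
  have hdR : (d : ℝ) + d' + 1 = n := by exact_mod_cast hdn
  obtain ⟨α, hαd⟩ : ∃ α : ℝ, α = (d : ℝ) / (n - 1 : ℕ) := ⟨_, rfl⟩
  have hd0 : (0 : ℝ) ≤ d := Nat.cast_nonneg _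
  have hd0' : (0 : ℝ) ≤ d' := Nat.cast_nonneg _
  have hαn : α * (n - 1) = d := by
    rw [hαd, hn1]
    exact div_mul_cancel₀ _ (by linarith)
  have hα0 : 0 ≤ α := by rw [hαd]; positivity
  have hα1 : (1 - α) * (n - 1) = d' := by linarith
  have hα : α ≤ 1 := by
    by_contra hlt
    push Not at hlt
    have : (1 - α) * (n - 1) < 0 := mul_neg_of_neg_of_pos (by linarith) (by linarith)
    linarith
  have hδα : δ ≤ 1 - α := by
    have h1 : δ * (n - 1) ≤ (1 - α) * (n - 1) := by linarith
    exact le_of_mul_le_mul_right h1 (by linarith)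
  have hDn : p * d ≤ n := by
    have := mul_le_mul_of_nonneg_right hp hd0
    linarith
  have hD0 : 0 ≤ p * d := mul_nonneg hp0 hd0
  have hγ0 : 0 ≤ γ := by
    by_contra hlt
    push Not at hlt
    have := mul_nonpos_of_nonpos_of_nonneg hlt.le (Nat.cast_nonneg (α := ℝ) n)
    linarith
  have hcompl : ∀ K ∈ exts F d, ∀ v, deg Kᶜ v = d' := fun K hK v => by
    have h1 := deg_compl (K := K) v
    have h2 := (mem_exts.1 hK).1 v
    omega
  have hpα : p * α ≤ 1 := mul_le_one₀ hp hα0 hα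
  have hX0 : 0 ≤ p * α * (d' : ℝ) ^ 2 := by positivity
  have hX : p * α * (d' : ℝ) ^ 2 ≤ n ^ 2 := by
    have h1 : (d' : ℝ) ^ 2 ≤ n ^ 2 := pow_le_pow_left₀ hd0' (by linarith) 2
    have h2 := mul_le_mul hpα h1 (sq_nonneg _) (by norm_num)
    linarith
  have hD2 : (p * d) ^ 2 ≤ (n : ℝ) ^ 2 := pow_le_pow_left₀ hD0 hDn 2
  have hY0 : 0 ≤ (1 - α) * (p * d) ^ 2 := mul_nonneg (by linarith) (sq_nonneg _)
  have hY : (1 - α) * (p * d) ^ 2 ≤ n ^ 2 := by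
    have h2 := mul_le_mul (by linarith : 1 - α ≤ 1) hD2 (sq_nonneg _) (by norm_num)
    linarith
  have hYge : δ * β ^ 2 * n ^ 2 ≤ (1 - α) * (p * d) ^ 2 := by
    have h1 : (β * n) ^ 2 ≤ (p * d) ^ 2 := pow_le_pow_left₀ (by positivity) hβd 2
    have h2 := mul_le_mul hδα h1 (by positivity) (by linarith)
    linarith
  have key : ∀ {a b : Fin n}, a ≠ b → ¬ F.Adj a b →
      |(p * α * (d' : ℝ) ^ 2 + (1 - α) * (p * d) ^ 2) * (extsWith F d a b).card -
        (1 - α) * (p * d) ^ 2 * (exts F d).card| ≤ (6 * γ + σ) * n ^ 2 * (exts F d).card := by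
    intro a b hab hFab
    refine card_extsWith_approx F d hab hFab (fun K => Typical F K d p γ) (by positivity) hX0 hX
      hY0 hY hbad ?_ ?_
    · rintro K hK ⟨hQ1, hQ2⟩
      rw [← hαd] at hQ2
      refine (abs_fwd_sub_le (mem_exts.1 hK).2 (hcompl K hK) hα0 hα hp0 hp hQ1 hQ2 hn
        a b).trans ?_
      have : 0 ≤ γ * (n : ℝ) ^ 2 := by positivity
      linarith
    · rintro K hK ⟨hQ1, hQ2⟩
      rw [← hαd] at hQ2
      exact abs_rev_sub_le hK hα0 hα hD0 hDn hγ hbal hQ2 hn a b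
  have k1 := (abs_le.1 (key hxy hF)).2
  have k2 := (abs_le.1 (key hxy' hF')).1
  generalize p * α * (d' : ℝ) ^ 2 = X at *
  generalize (1 - α) * (p * d) ^ 2 = Y at *
  have hV : (0 : ℝ) ≤ (exts F d).card := Nat.cast_nonneg _
  generalize ((exts F d).card : ℝ) = V at *
  have hnn : (0 : ℝ) < n ^ 2 := by positivity
  have hYpos : 0 < Y := lt_of_lt_of_le (by positivity) hYge
  have h1 : 3 * ((6 * γ + σ) * (n : ℝ) ^ 2) ≤ η * Y := by
    have a1 := mul_le_mul_of_nonneg_right hsmall hnn.le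
    have a2 := mul_le_mul_of_nonneg_left hYge hη.le
    linarith
  generalize (6 * γ + σ) * (n : ℝ) ^ 2 = κ at *
  have h2 : Y + κ ≤ (1 + η) * (Y - κ) := by
    rcases le_or_gt 0 κ with hκ | hκ
    · have := mul_le_mul_of_nonneg_right hη1 hκ
      linarith
    · have := mul_neg_of_pos_of_neg hη hκ
      have := mul_pos hη hYpos
      linarith
  have h3 := mul_le_mul_of_nonneg_right h2 hV
  have h4 : (X + Y) * ((extsWith F d x y).card : ℝ) ≤
      (X + Y) * ((1 + η) * (extsWith F d x' y').card) := by
    have a1 := mul_le_mul_of_nonneg_left k2 (by linarith : 0 ≤ 1 + η)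
    linarith
  exact le_of_mul_le_mul_left h4 (by linarith)

theorem Balanced.mono {F : SimpleGraph (Fin n)} {d : ℕ} {D γ γ' : ℝ} (h : Balanced F d D γ)
    (hγ : γ ≤ γ') (hD : 0 ≤ D) : Balanced F d D γ' :=
  fun v => (h v).trans (mul_le_mul_of_nonneg_right hγ hD)

theorem exists_typical {F : SimpleGraph (Fin n)} {d : ℕ} {p γ σ : ℝ} (hne : (exts F d).Nonempty)
    (hσ : σ < 1)
    (hbad : (((exts F d).filter fun K => ¬ Typical F K d p γ).card : ℝ) ≤ σ * (exts F d).card) :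
    ∃ K ∈ exts F d, Typical F K d p γ := by
  by_contra hcon
  push Not at hcon
  have h1 : (exts F d).filter (fun K => ¬ Typical F K d p γ) = exts F d :=
    Finset.filter_true_of_mem hcon
  rw [h1] at hbad
  have h2 : (0 : ℝ) < (exts F d).card := by exact_mod_cast hne.card_pos
  have := mul_lt_mul_of_pos_right hσ h2
  linarith

/-- Balancedness and typicality of `F` control all the extension counts. -/
theorem exists_card_extsWith_compare {η ε : ℝ} (hη : 0 < η) (hη1 : η ≤ 1) (hε : 0 < ε)
    (hε1 : ε ≤ 1) :
    ∃ γ σ D₀ n₀ : ℝ, 0 < γ ∧ γ ≤ 1 ∧ 0 < σ ∧ ∀ (n d : ℕ), n₀ ≤ n → D₀ ≤ d → d + 1 ≤ n →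
      ∀ p : ℝ, ε ≤ p → p ≤ 1 → ∀ F : SimpleGraph (Fin n),
        (d : ℝ) * n - 2 * (edges F).card = n * (p * d) → Balanced F d (p * d) γ →
        (((exts F d).filter fun K => ¬ Typical F K d p γ).card : ℝ) ≤ σ * (exts F d).card →
        (exts F d).Nonempty → ∀ x y x' y' : Fin n, x ≠ y → ¬ F.Adj x y → x' ≠ y' →
        ¬ F.Adj x' y' → ((extsWith F d x y).card : ℝ) ≤ (1 + η) * (extsWith F d x' y').card := by
  obtain ⟨δ₁, hδ₁⟩ : ∃ δ₁ : ℝ, δ₁ = η * ε / 320 := ⟨_, rfl⟩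
  obtain ⟨β, hβ⟩ : ∃ β : ℝ, β = ε * δ₁ / 2 := ⟨_, rfl⟩
  obtain ⟨δ₂, hδ₂⟩ : ∃ δ₂ : ℝ, δ₂ = η * β ^ 5 / 512 := ⟨_, rfl⟩
  have hηε : η * ε ≤ 1 := mul_le_one₀ hη1 hε.le hε1
  have hδ₁0 : 0 < δ₁ := by rw [hδ₁]; positivity
  have hδ₁1 : δ₁ ≤ 1 := by rw [hδ₁]; linarith
  have hβ0 : 0 < β := by rw [hβ]; positivity
  have hβε : β ≤ ε := by
    rw [hβ]
    have := mul_le_mul_of_nonneg_left hδ₁1 hε.le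
    linarith
  have hβ1 : β ≤ 1 := hβε.trans hε1
  have hδ₂0 : 0 < δ₂ := by rw [hδ₂]; positivity
  have hβ5 : β ^ 5 ≤ 1 := pow_le_one₀ hβ0.le hβ1
  have hβ2 : β ^ 2 ≤ 1 := pow_le_one₀ hβ0.le hβ1
  have hβ3 : β ^ 5 ≤ β ^ 3 := pow_le_pow_of_le_one hβ0.le hβ1 (by norm_num)
  have hδ₂β : δ₂ ≤ β ^ 3 / 512 := by
    rw [hδ₂]
    have : η * β ^ 5 ≤ 1 * β ^ 5 := mul_le_mul_of_nonneg_right hη1 (by positivity)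
    linarith
  have hδ₂η : η * (δ₂ * β ^ 2) ≤ η / 512 := by
    have h1 : δ₂ * β ^ 2 ≤ 1 / 512 * 1 :=
      mul_le_mul (by have := pow_le_one₀ (n := 3) hβ0.le hβ1; linarith) hβ2 (by positivity)
        (by norm_num)
    have := mul_le_mul_of_nonneg_left h1 hη.le
    linarith
  have hδ₂3 : η * (δ₂ * β ^ 2) ≤ β ^ 3 / 512 := by
    have h1 : δ₂ * β ^ 2 ≤ β ^ 3 / 512 * 1 := mul_le_mul hδ₂β hβ2 (by positivity) (by positivity)
    have := mul_le_mul hη1 h1 (by positivity) (by norm_num)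
    linarith
  obtain ⟨γ, hγ⟩ : ∃ γ : ℝ, γ = η * (δ₂ * β ^ 2) / 36 := ⟨_, rfl⟩
  obtain ⟨σ, hσ⟩ : ∃ σ : ℝ, σ = η * (δ₂ * β ^ 2) / 6 := ⟨_, rfl⟩
  have hγ0 : 0 < γ := by rw [hγ]; positivity
  have hσ0 : 0 < σ := by rw [hσ]; positivity
  have hγη : γ ≤ η / 40 := by linarith
  have hγ1 : γ ≤ 1 / 2 := by linarith
  refine ⟨γ, σ, max 1 (40 / (η * ε ^ 2)), max (1 / γ) (384 / β ^ 5), hγ0, by linarith, hσ0, ?_⟩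
  intro n d hn hd hdn p hpε hp1 F htot hbal hbad hne x y x' y' hxy hF hxy' hF'
  have hn1 : 1 ≤ γ * n := by
    have := (div_le_iff₀ hγ0).1 ((le_max_left _ _).trans hn)
    linarith
  have hn2 : 24 ≤ β ^ 5 / 16 * n := by
    have := (div_le_iff₀ (by positivity)).1 ((le_max_right _ _).trans hn)
    linarith
  have hd1 : (1 : ℝ) ≤ d := (le_max_left _ _).trans hd
  have hd2 : 40 ≤ d * (η * ε ^ 2) := (div_le_iff₀ (by positivity)).1 ((le_max_right _ _).trans hd)
  have hnpos : (0 : ℝ) < n := by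
    have : 0 < n := by omega
    exact_mod_cast this
  have hp0 : 0 < p := hε.trans_le hpε
  have hD0 : 0 < p * d := by positivity
  have hDd : p * d ≤ d := by
    have := mul_le_mul_of_nonneg_right hp1 (by linarith : (0 : ℝ) ≤ d)
    linarith
  have hDε : ε * d ≤ p * d := mul_le_mul_of_nonneg_right hpε (by linarith)
  rcases le_or_gt (d : ℝ) (δ₁ * n) with hsp | hsp
  · refine card_extsWith_compare_sparse F d hxy hF hxy' hF' hnpos hD0 hDd (γ := η / 40)
      (by positivity) hη1 le_rfl htot (hbal.mono hγη hD0.le) ?_ ?_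
    · have h1 : (ε * d) ^ 2 ≤ (p * d) ^ 2 := pow_le_pow_left₀ (by positivity) hDε 2
      have h2 := mul_le_mul_of_nonneg_left h1 hη.le
      have h3 := mul_le_mul_of_nonneg_left hd2 (by linarith : (0 : ℝ) ≤ d)
      linarith
    · have h1 : (1 : ℝ) * d ≤ d * d := mul_le_mul_of_nonneg_right hd1 (by linarith)
      have h2 : (d : ℝ) * d ≤ d * (δ₁ * n) := mul_le_mul_of_nonneg_left hsp (by linarith)
      have h3 : (n : ℝ) * (ε * d) ≤ n * (p * d) := mul_le_mul_of_nonneg_left hDε hnpos.le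
      have h4 := mul_le_mul_of_nonneg_left h3 hη.le
      rw [hδ₁] at h2
      linarith
  · have hDn : 2 * β * n ≤ p * d := by
      have := mul_le_mul_of_nonneg_left hsp.le hε.le
      rw [hβ]
      linarith
    obtain ⟨d', hd'⟩ : ∃ d', d + d' + 1 = n := ⟨n - 1 - d, by omega⟩
    rcases le_or_gt (d' : ℝ) (δ₂ * n) with hde | hde
    · obtain ⟨K, hK, hT⟩ := exists_typical hne (by linarith) hbad
      refine card_extsWith_compare_dense F hd' hxy' (p := p) (γ := γ) hη hη1 hβ0 hβ1
        (hβε.trans hpε) ?_ ?_ (by linarith) (by rw [← hδ₂]; exact hde) hn2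
      · intro A B
        have h1 := (abs_le.1 (hT.1 A B)).2
        have h2 : (eb K A B : ℝ) ≤ A.card * B.card := by exact_mod_cast eb_le K A B
        have h3 := mul_le_mul_of_nonneg_left h2 (by linarith : 0 ≤ 1 - p)
        linarith
      · intro v
        have h1 := (abs_le.1 (hbal v)).1
        have h2 := mul_le_mul_of_nonneg_right hγ1 hD0.le
        linarith
    · refine card_extsWith_compare_mid F hd' hxy hF hxy' hF' hη hη1 hβ0 hδ₂0 hp0.le hp1
        (by linarith) hn1 hbad hbal ?_ hde.le ?_
      · have : 0 ≤ β * n := by positivity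
        linarith
      · rw [hγ, hσ]
        linarith

/-- `(K, F)` consists of a `d`-regular graph `K` and a subgraph `F` of `K` with `k` edges. -/
def IsPair (d k : ℕ) (w : SimpleGraph (Fin n) × SimpleGraph (Fin n)) : Prop :=
  IsRegularGraph w.1 d ∧ w.2 ≤ w.1 ∧ (edges w.2).card = k

theorem cnt_isPair_fst {K : SimpleGraph (Fin n)} {d : ℕ} (hK : IsRegularGraph K d) (k : ℕ)
    (Q : SimpleGraph (Fin n) → Prop) :
    cnt (fun F => IsPair d k (K, F) ∧ Q F) = ((subs K k).filter Q).card := by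
  rw [cnt, subs, Finset.filter_filter]
  congr 1
  ext F
  simp only [Finset.mem_filter, Finset.mem_univ, true_and, IsPair, hK]

theorem cnt_isPair_snd {F : SimpleGraph (Fin n)} {k : ℕ} (hF : (edges F).card = k) (d : ℕ)
    (Q : SimpleGraph (Fin n) → Prop) :
    cnt (fun K => IsPair d k (K, F) ∧ Q K) = ((exts F d).filter Q).card := by
  rw [cnt, exts, Finset.filter_filter]
  congr 1
  ext K
  simp only [Finset.mem_filter, Finset.mem_univ, true_and, IsPair, hF, and_true]

theorem cnt_isPair_le (d k : ℕ) (Q : SimpleGraph (Fin n) → SimpleGraph (Fin n) → Prop) {b : ℝ}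
    (h : ∀ K, IsRegularGraph K d →
      (((subs K k).filter fun F => Q F K).card : ℝ) ≤ b * (subs K k).card) :
    (cnt (fun w : SimpleGraph (Fin n) × SimpleGraph (Fin n) => IsPair d k w ∧ Q w.2 w.1) : ℝ) ≤
      b * cnt (IsPair (n := n) d k) := by
  have h1 := cnt_prod fun w : SimpleGraph (Fin n) × SimpleGraph (Fin n) =>
    IsPair d k w ∧ Q w.2 w.1
  have h2 := cnt_prod fun w : SimpleGraph (Fin n) × SimpleGraph (Fin n) => IsPair d k w
  rw [h1, h2]
  push_cast
  rw [Finset.mul_sum]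
  refine Finset.sum_le_sum fun K _ => ?_
  by_cases hK : IsRegularGraph K d
  · have e1 := cnt_isPair_fst hK k fun F => Q F K
    have e2 := cnt_isPair_fst hK k fun _ => True
    simp only [and_true, Finset.filter_true] at e2
    rw [e1, e2]
    exact h K hK
  · rw [cnt_eq_zero fun F hF => hK hF.1.1, cnt_eq_zero fun F hF => hK hF.1]
    simp

theorem cnt_isPair_regular {d k N : ℕ} (hN : 2 * N = d * n) (Q : SimpleGraph (Fin n) → Prop) :
    cnt (fun w : SimpleGraph (Fin n) × SimpleGraph (Fin n) => IsPair d k w ∧ Q w.1) =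
      ((exts (⊥ : SimpleGraph (Fin n)) d).filter Q).card * N.choose k := by
  have h1 := cnt_prod fun w : SimpleGraph (Fin n) × SimpleGraph (Fin n) =>
    IsPair d k w ∧ Q w.1
  rw [h1, ← smul_eq_mul, ← Finset.sum_const, exts, Finset.filter_filter, Finset.sum_filter]
  refine Finset.sum_congr rfl fun K _ => ?_
  split_ifs with hK
  · have e1 := cnt_isPair_fst hK.1.1 k fun _ => Q K
    rw [Finset.filter_true_of_mem fun _ _ => hK.2, card_subs] at e1
    have e2 := card_edges_of_regular hK.1.1
    rw [(by omega : (edges K).card = N)] at e1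
    exact e1
  · exact cnt_eq_zero fun F hF => hK ⟨⟨hF.1.1, bot_le⟩, hF.2⟩

/-- Markov's inequality for the conditional probability of atypicality given `F`. -/
theorem cnt_isPair_exceptional_le (d k : ℕ)
    (Q : SimpleGraph (Fin n) → SimpleGraph (Fin n) → Prop) {σ : ℝ} :
    σ * cnt (fun w : SimpleGraph (Fin n) × SimpleGraph (Fin n) => IsPair d k w ∧
      ¬ (((exts w.2 d).filter fun K => Q w.2 K).card : ℝ) ≤ σ * (exts w.2 d).card) ≤
      cnt (fun w : SimpleGraph (Fin n) × SimpleGraph (Fin n) => IsPair d k w ∧ Q w.2 w.1) := by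
  have h1 := cnt_prod_right fun w : SimpleGraph (Fin n) × SimpleGraph (Fin n) => IsPair d k w ∧
      ¬ (((exts w.2 d).filter fun K => Q w.2 K).card : ℝ) ≤ σ * (exts w.2 d).card
  have h2 := cnt_prod_right fun w : SimpleGraph (Fin n) × SimpleGraph (Fin n) =>
    IsPair d k w ∧ Q w.2 w.1
  rw [h1, h2]
  push_cast
  rw [Finset.mul_sum]
  refine Finset.sum_le_sum fun F _ => ?_
  by_cases hF : (edges F).card = k
  · have e1 := cnt_isPair_snd hF d fun K => Q F K
    rw [e1]
    by_cases hex : (((exts F d).filter fun K => Q F K).card : ℝ) ≤ σ * (exts F d).card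
    · rw [cnt_eq_zero fun K hK => hK.2 hex]
      simp
    · have e2 := cnt_isPair_snd hF d fun _ => True
      rw [cnt_congr fun K => and_congr_right fun _ => iff_of_true hex trivial, e2]
      simp only [Finset.filter_true]
      exact (not_le.1 hex).le
  · rw [cnt_eq_zero fun K hK => hF hK.1.2.2]
    simp

theorem excess_le_floor {K : SimpleGraph (Fin n)} {d : ℕ} {s : ℝ}
    (h : ∀ v, |(deg K v : ℝ) - d| ≤ s) : excess K d ≤ ⌊n * s⌋₊ := by
  refine Nat.le_floor ?_
  rw [excess]
  push_cast
  have h1 : ∀ v ∈ (Finset.univ : Finset (Fin n)), ((deg K v - d : ℕ) : ℝ) ≤ s := fun v _ => by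
    have h2 := abs_le.1 (h v)
    rcases le_total d (deg K v) with h3 | h3
    · rw [Nat.cast_sub h3]
      exact h2.2
    · rw [Nat.sub_eq_zero_of_le h3, Nat.cast_zero]
      exact (abs_nonneg _).trans (h v)
  refine (Finset.sum_le_card_nsmul _ _ _ h1).trans (le_of_eq ?_)
  rw [nsmul_eq_mul, Finset.card_univ, Fintype.card_fin]

theorem two_mul_card_edges_top : 2 * (edges (⊤ : SimpleGraph (Fin n))).card = n * (n - 1) := by
  rw [← sum_deg]
  simp only [deg_top, Finset.sum_const, Finset.card_univ, Fintype.card_fin, smul_eq_mul]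

theorem card_subs_top_le {d N : ℕ} (hN : 2 * N = d * n) (hd : d ≤ n - 1) (hn : 2 ≤ n)
    {s : ℝ} (hs : 0 ≤ s) (hsn : s ≤ 2 * n) (hsexp : 2 * n * Real.exp (-(s ^ 2 / (4 * n))) ≤ 1 / 2) :
    ((subs (⊤ : SimpleGraph (Fin n)) N).card : ℝ) ≤
      2 * ((exts (⊥ : SimpleGraph (Fin n)) d).card * (n : ℝ) ^ (3 * ⌊n * s⌋₊)) := by
  have hT := two_mul_card_edges_top (n := n)
  have hn1 : 0 < n - 1 := by omega
  have hTpos : 0 < (edges (⊤ : SimpleGraph (Fin n))).card := by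
    have : 0 < n * (n - 1) := by positivity
    omega
  have hNT : N ≤ (edges (⊤ : SimpleGraph (Fin n))).card := by
    have : d * n ≤ n * (n - 1) := by rw [mul_comm]; exact Nat.mul_le_mul_left n hd
    omega
  have hratio : ∀ v, (N : ℝ) / (edges (⊤ : SimpleGraph (Fin n))).card *
      deg (⊤ : SimpleGraph (Fin n)) v = d := fun v => by
    rw [deg_top]
    have h1 : (2 : ℝ) * (edges (⊤ : SimpleGraph (Fin n))).card = n * (n - 1 : ℕ) := by
      exact_mod_cast hT
    have h2 : (2 : ℝ) * N = d * n := by exact_mod_cast hN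
    have h3 : (0 : ℝ) < (edges (⊤ : SimpleGraph (Fin n))).card := by exact_mod_cast hTpos
    have h4 : (0 : ℝ) < n := by exact_mod_cast (by omega : 0 < n)
    rw [div_mul_eq_mul_div, div_eq_iff h3.ne']
    refine mul_left_cancel₀ h4.ne' ?_
    linear_combination (N : ℝ) * (-h1) + (edges (⊤ : SimpleGraph (Fin n))).card * h2
  have h1 := card_not_deg_close_le (⊤ : SimpleGraph (Fin n)) N hTpos hNT n s
    (by exact_mod_cast (by omega : 0 < n))
    (fun v => by rw [deg_top]; exact_mod_cast Nat.sub_le n 1) hs hsn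
  have h2 := (h1.trans (mul_le_mul_of_nonneg_right hsexp (Nat.cast_nonneg _)))
  have h3 := Finset.card_filter_add_card_filter_not (s := subs (⊤ : SimpleGraph (Fin n)) N)
    (fun F => ∀ v, |(deg F v : ℝ) - (N : ℝ) / (edges (⊤ : SimpleGraph (Fin n))).card *
      deg (⊤ : SimpleGraph (Fin n)) v| ≤ s)
  have h4 : (subs (⊤ : SimpleGraph (Fin n)) N).filter
      (fun F => ∀ v, |(deg F v : ℝ) - (N : ℝ) / (edges (⊤ : SimpleGraph (Fin n))).card *
      deg (⊤ : SimpleGraph (Fin n)) v| ≤ s) ⊆ nearReg n d N ⌊n * s⌋₊ := by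
    intro F hF
    obtain ⟨hF1, hF2⟩ := Finset.mem_filter.1 hF
    refine Finset.mem_filter.2 ⟨Finset.mem_univ _, (Finset.mem_filter.1 hF1).2.2,
      excess_le_floor fun v => ?_⟩
    have := hF2 v
    rwa [hratio] at this
  have h5 := (Finset.card_le_card h4).trans (card_nearReg_le hN _ (by omega))
  rw [nearReg_zero hN] at h5
  have h6 := congrArg (Nat.cast (R := ℝ)) h3
  rw [Nat.cast_add] at h6
  have h7 : (_ : ℝ) ≤ _ := Nat.cast_le.2 h5
  push_cast at h7
  linarith

theorem card_regular_not_cutClose_le {d N : ℕ} (hN : 2 * N = d * n) (hd : d ≤ n - 1) (hn : 2 ≤ n)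
    {γ s : ℝ} (hγ0 : 0 ≤ γ) (hγ1 : γ ≤ 1) (hs : 0 ≤ s) (hsn : s ≤ 2 * n)
    (hsexp : 2 * n * Real.exp (-(s ^ 2 / (4 * n))) ≤ 1 / 2) :
    (((exts (⊥ : SimpleGraph (Fin n)) d).filter
      fun K => ¬ CutClose K ⊤ ((d : ℝ) / (n - 1 : ℕ)) γ).card : ℝ) ≤
      4 * 4 ^ n * Real.exp (-(γ ^ 2 * n ^ 2 / 16)) * (n : ℝ) ^ (3 * ⌊n * s⌋₊) *
        (exts (⊥ : SimpleGraph (Fin n)) d).card := by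
  have hT := two_mul_card_edges_top (n := n)
  have hn1 : 0 < n - 1 := by omega
  have hTpos : 0 < (edges (⊤ : SimpleGraph (Fin n))).card := by
    have : 0 < n * (n - 1) := by positivity
    omega
  have hNT : N ≤ (edges (⊤ : SimpleGraph (Fin n))).card := by
    have : d * n ≤ n * (n - 1) := by rw [mul_comm]; exact Nat.mul_le_mul_left n hd
    omega
  have hratio : (N : ℝ) / (edges (⊤ : SimpleGraph (Fin n))).card = (d : ℝ) / (n - 1 : ℕ) := by
    have h1 : (2 : ℝ) * (edges (⊤ : SimpleGraph (Fin n))).card = n * (n - 1 : ℕ) := by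
      exact_mod_cast hT
    have h2 : (2 : ℝ) * N = d * n := by exact_mod_cast hN
    have h3 : (0 : ℝ) < (edges (⊤ : SimpleGraph (Fin n))).card := by exact_mod_cast hTpos
    have h4 : (0 : ℝ) < (n - 1 : ℕ) := by exact_mod_cast hn1
    have h5 : (0 : ℝ) < n := by exact_mod_cast (by omega : 0 < n)
    rw [div_eq_div_iff h3.ne' h4.ne']
    refine mul_left_cancel₀ h5.ne' ?_
    linear_combination (N : ℝ) * (-h1) + (edges (⊤ : SimpleGraph (Fin n))).card * h2
  have h1 := card_not_cutClose_le (⊤ : SimpleGraph (Fin n)) N hTpos hNT (by omega) γ hγ0 hγ1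
  rw [hratio] at h1
  have h2 := card_subs_top_le hN hd hn hs hsn hsexp
  have h3 : (exts (⊥ : SimpleGraph (Fin n)) d).filter
      (fun K => ¬ CutClose K ⊤ ((d : ℝ) / (n - 1 : ℕ)) γ) ⊆
      (subs (⊤ : SimpleGraph (Fin n)) N).filter
        (fun K => ¬ CutClose K ⊤ ((d : ℝ) / (n - 1 : ℕ)) γ) := by
    intro K hK
    obtain ⟨hK1, hK2⟩ := Finset.mem_filter.1 hK
    have := card_edges_of_regular (mem_exts.1 hK1).1
    exact Finset.mem_filter.2 ⟨Finset.mem_filter.2 ⟨Finset.mem_univ _, le_top, by omega⟩, hK2⟩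
  have h4 : (_ : ℝ) ≤ _ := Nat.cast_le.2 (Finset.card_le_card h3)
  refine h4.trans (h1.trans ((mul_le_mul_of_nonneg_left h2 (by positivity)).trans (le_of_eq ?_)))
  ring

theorem cnt_isPair_not_balanced_le {d k N : ℕ} {p γ : ℝ} (hN : 2 * N = d * n) (hd : 0 < d)
    (hn : 0 < n) (hk : k ≤ N) (hp : (k : ℝ) = (1 - p) * N) (hp0 : 0 ≤ p) (hp1 : p ≤ 1)
    (hγ0 : 0 ≤ γ) (hγ1 : γ ≤ 1) :
    (cnt (fun w : SimpleGraph (Fin n) × SimpleGraph (Fin n) => IsPair d k w ∧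
      ¬ Balanced w.2 d (p * d) γ) : ℝ) ≤
      (2 * n * Real.exp (-((γ * p) ^ 2 * d / 4))) * cnt (IsPair (n := n) d k) := by
  have hNpos : 0 < N := by
    have := Nat.mul_pos hd hn
    omega
  have hd' : (0 : ℝ) < d := by exact_mod_cast hd
  refine cnt_isPair_le d k (fun F _ => ¬ Balanced F d (p * d) γ) fun K hK => ?_
  have hKN : (edges K).card = N := by
    have := card_edges_of_regular hK
    omega
  have hγp : γ * p ≤ 1 := mul_le_one₀ hγ1 hp0 hp1
  have h := card_not_deg_close_le K k (by omega) (by omega) d (γ * (p * d)) hd'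
    (fun v => by rw [hK v]) (by positivity) (by nlinarith)
  have he : (γ * (p * d)) ^ 2 / (4 * d) = (γ * p) ^ 2 * d / 4 := by
    field_simp
  rw [he] at h
  refine le_trans (le_of_eq ?_) h
  congr 2
  ext F
  simp only [Finset.mem_filter]
  refine and_congr_right fun _ => not_congr (forall_congr' fun v => ?_)
  rw [hK v, hKN, hp, mul_div_cancel_right₀ _ (by exact_mod_cast hNpos.ne'), ← abs_neg]
  ring_nf

theorem cnt_isPair_not_typical_le {d k N : ℕ} {p γ s : ℝ} (hN : 2 * N = d * n) (hd0 : 0 < d)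
    (hd : d ≤ n - 1) (hn : 2 ≤ n) (hk : k ≤ N) (hp : (k : ℝ) = (1 - p) * N)
    (hγ0 : 0 ≤ γ) (hγ1 : γ ≤ 1) (hs : 0 ≤ s) (hsn : s ≤ 2 * n)
    (hsexp : 2 * n * Real.exp (-(s ^ 2 / (4 * n))) ≤ 1 / 2) :
    (cnt (fun w : SimpleGraph (Fin n) × SimpleGraph (Fin n) => IsPair d k w ∧
      ¬ Typical w.2 w.1 d p γ) : ℝ) ≤
      6 * 4 ^ n * Real.exp (-(γ ^ 2 * n ^ 2 / 16)) * (n : ℝ) ^ (3 * ⌊n * s⌋₊) *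
        cnt (IsPair (n := n) d k) := by
  have hNpos : 0 < N := by
    have := Nat.mul_pos hd0 (by omega : 0 < n)
    omega
  have h1 := cnt_isPair_le d k (fun F K : SimpleGraph (Fin n) => ¬ CutClose F K (1 - p) γ)
    (b := 2 * 4 ^ n * Real.exp (-(γ ^ 2 * n ^ 2 / 16))) fun K hK => by
      have hKN : (edges K).card = N := by
        have := card_edges_of_regular hK
        omega
      have h := card_not_cutClose_le K k (by omega) (by omega) (by omega) γ hγ0 hγ1
      rw [hKN, hp, mul_div_cancel_right₀ _ (by exact_mod_cast hNpos.ne')] at h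
      convert h
  have h2 : (cnt (fun w : SimpleGraph (Fin n) × SimpleGraph (Fin n) => IsPair d k w ∧
      ¬ CutClose w.1 ⊤ ((d : ℝ) / (n - 1 : ℕ)) γ) : ℝ) ≤
      (4 * 4 ^ n * Real.exp (-(γ ^ 2 * n ^ 2 / 16)) * (n : ℝ) ^ (3 * ⌊n * s⌋₊)) *
        cnt (IsPair (n := n) d k) := by
    have e1 := cnt_isPair_regular (n := n) (k := k) hN
      fun K => ¬ CutClose K ⊤ ((d : ℝ) / (n - 1 : ℕ)) γ
    have e2 := cnt_isPair_regular (n := n) (k := k) hN fun _ => True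
    simp only [and_true, Finset.filter_true] at e2
    have e3 : cnt (IsPair (n := n) d k) = (exts (⊥ : SimpleGraph (Fin n)) d).card * N.choose k := e2
    rw [e1, e3]
    push_cast
    rw [← mul_assoc]
    refine mul_le_mul_of_nonneg_right ?_ (Nat.cast_nonneg _)
    convert card_regular_not_cutClose_le hN hd hn hγ0 hγ1 hs hsn hsexp <;> rfl
  have h3 := cnt_le_add (P := fun w : SimpleGraph (Fin n) × SimpleGraph (Fin n) =>
    IsPair d k w ∧ ¬ Typical w.2 w.1 d p γ)
    (Q := fun w => IsPair d k w ∧ ¬ CutClose w.2 w.1 (1 - p) γ)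
    (R := fun w => IsPair d k w ∧ ¬ CutClose w.1 ⊤ ((d : ℝ) / (n - 1 : ℕ)) γ) fun w hw => by
      by_cases hc : CutClose w.2 w.1 (1 - p) γ
      · exact Or.inr ⟨hw.1, fun h => hw.2 ⟨hc, h⟩⟩
      · exact Or.inl ⟨hw.1, hc⟩
  have h3' : (cnt (fun w : SimpleGraph (Fin n) × SimpleGraph (Fin n) =>
      IsPair d k w ∧ ¬ Typical w.2 w.1 d p γ) : ℝ) ≤ _ := (Nat.cast_le.2 h3)
  rw [Nat.cast_add] at h3'
  have h4 : (1 : ℝ) ≤ (n : ℝ) ^ (3 * ⌊n * s⌋₊) :=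
    one_le_pow₀ (by exact_mod_cast (by omega : 1 ≤ n))
  have h5 : 2 * 4 ^ n * Real.exp (-(γ ^ 2 * n ^ 2 / 16)) ≤
      2 * 4 ^ n * Real.exp (-(γ ^ 2 * n ^ 2 / 16)) * (n : ℝ) ^ (3 * ⌊n * s⌋₊) :=
    le_mul_of_one_le_right (by positivity) h4
  have h6 := mul_le_mul_of_nonneg_right h5 (Nat.cast_nonneg (α := ℝ) (cnt (IsPair (n := n) d k)))
  linarith

/-- `F` has balanced deficiencies, and almost all of its `d`-regular extensions are typical. -/
def Good (F : SimpleGraph (Fin n)) (d : ℕ) (p γ σ : ℝ) : Prop :=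
  Balanced F d (p * d) γ ∧
    (((exts F d).filter fun K => ¬ Typical F K d p γ).card : ℝ) ≤ σ * (exts F d).card

theorem cnt_isPair_not_good_le {d k N : ℕ} {p γ s σ : ℝ} (hN : 2 * N = d * n) (hd0 : 0 < d)
    (hd : d ≤ n - 1) (hn : 2 ≤ n) (hk : k ≤ N) (hp : (k : ℝ) = (1 - p) * N)
    (hp0 : 0 ≤ p) (hp1 : p ≤ 1) (hγ0 : 0 ≤ γ) (hγ1 : γ ≤ 1) (hσ : 0 < σ)
    (hs : 0 ≤ s) (hsn : s ≤ 2 * n)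
    (hsexp : 2 * n * Real.exp (-(s ^ 2 / (4 * n))) ≤ 1 / 2) :
    (cnt (fun w : SimpleGraph (Fin n) × SimpleGraph (Fin n) => IsPair d k w ∧
      ¬ Good w.2 d p γ σ) : ℝ) ≤
      (2 * n * Real.exp (-((γ * p) ^ 2 * d / 4)) +
        6 * 4 ^ n * Real.exp (-(γ ^ 2 * n ^ 2 / 16)) * (n : ℝ) ^ (3 * ⌊n * s⌋₊) / σ) *
        cnt (IsPair (n := n) d k) := by
  have h1 := cnt_isPair_not_balanced_le (n := n) hN hd0 (by omega) hk hp hp0 hp1 hγ0 hγ1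
  have h2 := (cnt_isPair_exceptional_le (n := n) d k
    (fun F K => ¬ Typical F K d p γ) (σ := σ)).trans
    (cnt_isPair_not_typical_le hN hd0 hd hn hk hp hγ0 hγ1 hs hsn hsexp)
  rw [mul_comm σ, ← le_div_iff₀ hσ, mul_div_right_comm] at h2
  have h3 := cnt_le_add (P := fun w : SimpleGraph (Fin n) × SimpleGraph (Fin n) =>
    IsPair d k w ∧ ¬ Good w.2 d p γ σ)
    (Q := fun w => IsPair d k w ∧ ¬ Balanced w.2 d (p * d) γ)
    (R := fun w => IsPair d k w ∧ ¬ (((exts w.2 d).filter fun K =>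
      ¬ Typical w.2 K d p γ).card : ℝ) ≤ σ * (exts w.2 d).card) fun w hw => by
      by_cases hc : Balanced w.2 d (p * d) γ
      · exact Or.inr ⟨hw.1, fun h => hw.2 ⟨hc, h⟩⟩
      · exact Or.inl ⟨hw.1, hc⟩
  have h3' : (cnt (fun w : SimpleGraph (Fin n) × SimpleGraph (Fin n) =>
      IsPair d k w ∧ ¬ Good w.2 d p γ σ) : ℝ) ≤ _ := (Nat.cast_le.2 h3)
  rw [Nat.cast_add] at h3'
  rw [add_mul]
  refine h3'.trans (add_le_add h1 ?_)
  convert h2; rfl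

open Filter Asymptotics in
theorem tendsto_sqrt_sub_log_atTop :
    Tendsto (fun x : ℝ => x ^ (1 / 2 : ℝ) / 4 - Real.log x) atTop atTop := by
  have h : (fun x : ℝ => Real.log x) =o[atTop] fun x : ℝ => x ^ (1 / 2 : ℝ) :=
    isLittleO_log_rpow_atTop (by norm_num)
  have h1 := h.bound (c := 1 / 8) (by norm_num)
  have h2 : Tendsto (fun x : ℝ => x ^ (1 / 2 : ℝ) / 8) atTop atTop :=
    (tendsto_rpow_atTop (by norm_num)).atTop_div_const (by norm_num)
  refine tendsto_atTop_mono' _ ?_ h2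
  filter_upwards [h1, eventually_ge_atTop 0] with x hx h0
  rw [Real.norm_eq_abs, Real.norm_eq_abs, abs_of_nonneg (Real.rpow_nonneg h0 _)] at hx
  have := le_abs_self (Real.log x)
  linarith

open Filter in
theorem eventually_mul_exp_le :
    ∀ᶠ x : ℝ in atTop, 2 * x * Real.exp (-((x ^ (3 / 4 : ℝ)) ^ 2 / (4 * x))) ≤ 1 / 2 := by
  filter_upwards [tendsto_sqrt_sub_log_atTop.eventually_ge_atTop (Real.log 4),
    eventually_gt_atTop 0] with x hx h0
  have e : (x ^ (3 / 4 : ℝ)) ^ 2 / (4 * x) = x ^ (1 / 2 : ℝ) / 4 := by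
    rw [← Real.rpow_natCast, ← Real.rpow_mul h0.le, mul_comm 4 x, ← div_div]
    congr 1
    rw [div_eq_iff h0.ne', ← Real.rpow_add_one h0.ne']
    norm_num
  rw [e]
  have h1 : Real.exp (-(x ^ (1 / 2 : ℝ) / 4)) ≤ Real.exp (-(Real.log 4 + Real.log x)) :=
    Real.exp_le_exp.2 (by linarith)
  rw [Real.exp_neg (Real.log 4 + _), Real.exp_add, Real.exp_log h0,
    Real.exp_log (by norm_num)] at h1
  calc _ ≤ 2 * x * (4 * x)⁻¹ := by gcongr
    _ = 1 / 2 := by field_simp; ring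

open Filter Asymptotics in
theorem eventually_entropy_le (a b : ℝ) (ha : 0 < a) :
    ∀ᶠ x : ℝ in atTop, b + x * Real.log 4 + 3 * (x * x ^ (3 / 4 : ℝ)) * Real.log x ≤
      a * x ^ 2 - 2 * Real.log x := by
  have h1 : (fun x : ℝ => Real.log x) =o[atTop] fun x : ℝ => x ^ (1 / 4 : ℝ) :=
    isLittleO_log_rpow_atTop (by norm_num)
  have h2 := h1.bound (c := a / 15) (by positivity)
  have h3 : Tendsto (fun x : ℝ => a / 3 * x) atTop atTop :=
    tendsto_id.const_mul_atTop (by positivity)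
  filter_upwards [h2, h3.eventually_ge_atTop (|b| + Real.log 4), eventually_ge_atTop 1]
    with x h2 h3 h1
  have h0 : 0 < x := by linarith
  rw [Real.norm_eq_abs, Real.norm_eq_abs, abs_of_nonneg (Real.rpow_nonneg h0.le _),
    abs_of_nonneg (Real.log_nonneg h1)] at h2
  have e1 : x ^ (3 / 4 : ℝ) * x ^ (1 / 4 : ℝ) = x := by
    rw [← Real.rpow_add h0]
    norm_num
  have hA : 0 < x ^ (3 / 4 : ℝ) := Real.rpow_pos_of_pos h0 _
  have hB : 1 ≤ x ^ (3 / 4 : ℝ) := Real.one_le_rpow h1 (by norm_num)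
  have hC : x ^ (3 / 4 : ℝ) * Real.log x ≤ a / 15 * x := by
    calc _ ≤ x ^ (3 / 4 : ℝ) * (a / 15 * x ^ (1 / 4 : ℝ)) := by gcongr
      _ = a / 15 * (x ^ (3 / 4 : ℝ) * x ^ (1 / 4 : ℝ)) := by ring
      _ = _ := by rw [e1]
  have hL : 0 ≤ Real.log x := Real.log_nonneg h1
  have hD : 3 * (x * x ^ (3 / 4 : ℝ)) * Real.log x ≤ a / 5 * x ^ 2 := by
    nlinarith
  have hE : Real.log x ≤ a / 15 * x ^ 2 := by
    nlinarith [mul_nonneg (sub_nonneg.2 hB) hL, mul_nonneg (sub_nonneg.2 h1) h0.le]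
  have hF : b + x * Real.log 4 ≤ a / 3 * x ^ 2 := by
    have := le_abs_self b
    have := abs_nonneg b
    nlinarith
  nlinarith

open Filter in
theorem eventually_atypical_le {γ σ c : ℝ} (hγ : 0 < γ) (hσ : 0 < σ) (hc : 0 < c) :
    ∀ᶠ n : ℕ in atTop, 6 * 4 ^ n * Real.exp (-(γ ^ 2 * n ^ 2 / 16)) *
      (n : ℝ) ^ (3 * ⌊(n : ℝ) * (n : ℝ) ^ (3 / 4 : ℝ)⌋₊) / σ ≤ c / (2 * n ^ 2) := by
  have h := eventually_entropy_le (γ ^ 2 / 16) (Real.log (12 / (σ * c))) (by positivity)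
  filter_upwards [tendsto_natCast_atTop_atTop.eventually h, eventually_ge_atTop 1] with n h hn
  have hn0 : (0 : ℝ) < n := by exact_mod_cast hn
  have hn1 : (1 : ℝ) ≤ n := by exact_mod_cast hn
  have h4 : (4 : ℝ) ^ n = Real.exp (n * Real.log 4) := by
    rw [Real.exp_nat_mul, Real.exp_log (by norm_num)]
  have h5 : (n : ℝ) ^ (3 * ⌊(n : ℝ) * (n : ℝ) ^ (3 / 4 : ℝ)⌋₊) ≤
      Real.exp (3 * ((n : ℝ) * (n : ℝ) ^ (3 / 4 : ℝ)) * Real.log n) := by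
    rw [← Real.exp_log (pow_pos hn0 _), Real.log_pow]
    refine Real.exp_le_exp.2 (mul_le_mul_of_nonneg_right ?_ (Real.log_nonneg hn1))
    push_cast
    exact mul_le_mul_of_nonneg_left (Nat.floor_le (by positivity)) (by norm_num)
  have h6 := Real.exp_le_exp.2 h
  rw [Real.exp_add, Real.exp_add, Real.exp_log (by positivity), Real.exp_sub,
    (by ring : 2 * Real.log (n : ℝ) = Real.log n + Real.log n), Real.exp_add,
    Real.exp_log hn0, ← h4] at h6
  have h7 : Real.exp (-(γ ^ 2 * n ^ 2 / 16)) = (Real.exp (γ ^ 2 / 16 * n ^ 2))⁻¹ := by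
    rw [← Real.exp_neg]
    ring_nf
  rw [h7]
  have hE := Real.exp_pos (γ ^ 2 / 16 * (n : ℝ) ^ 2)
  set E := Real.exp (γ ^ 2 / 16 * (n : ℝ) ^ 2)
  set A := (n : ℝ) ^ (3 * ⌊(n : ℝ) * (n : ℝ) ^ (3 / 4 : ℝ)⌋₊)
  set B := Real.exp (3 * ((n : ℝ) * (n : ℝ) ^ (3 / 4 : ℝ)) * Real.log n)
  have h8 : 12 / (σ * c) * 4 ^ n * A ≤ E / (n * n) :=
    (mul_le_mul_of_nonneg_left h5 (by positivity)).trans h6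
  calc 6 * 4 ^ n * E⁻¹ * A / σ = (12 / (σ * c) * 4 ^ n * A) * (c / (2 * E)) := by
        field_simp; ring
    _ ≤ E / (n * n) * (c / (2 * E)) := by gcongr
    _ = c / (2 * n ^ 2) := by field_simp

theorem unbalanced_prob_le {γ ε p c C : ℝ} {d : ℕ} (hε : 0 < ε) (hγ : 0 < γ) (hp : ε ≤ p)
    (hC : 16 / (γ * ε) ^ 2 ≤ C) (hc : 0 < c) (hn : 1 ≤ n) (hnc : 4 / c ≤ n)
    (hd : C * Real.log n ≤ d) :
    2 * n * Real.exp (-((γ * p) ^ 2 * d / 4)) ≤ c / (2 * n ^ 2) := by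
  have hn0 : (0 : ℝ) < n := by exact_mod_cast hn
  have hn1 : (1 : ℝ) ≤ n := by exact_mod_cast hn
  have hL : 0 ≤ Real.log n := Real.log_nonneg hn1
  have h0 : 0 < (γ * ε) ^ 2 := by positivity
  have h1 : 16 * Real.log n ≤ (γ * p) ^ 2 * d := by
    have : (γ * ε) ^ 2 ≤ (γ * p) ^ 2 := by gcongr
    rw [div_le_iff₀ h0] at hC
    calc 16 * Real.log n ≤ C * (γ * ε) ^ 2 * Real.log n := by gcongr
      _ = (γ * ε) ^ 2 * (C * Real.log n) := by ring
      _ ≤ (γ * ε) ^ 2 * d := by gcongr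
      _ ≤ _ := by gcongr
  have h2 : Real.exp (-((γ * p) ^ 2 * d / 4)) ≤ ((n : ℝ) ^ 4)⁻¹ := by
    rw [← Real.exp_log (pow_pos hn0 4), ← Real.exp_neg, Real.log_pow]
    refine Real.exp_le_exp.2 ?_
    push_cast
    linarith
  rw [div_le_iff₀ hc] at hnc
  calc _ ≤ 2 * n * ((n : ℝ) ^ 4)⁻¹ := by gcongr
    _ = 4 / (n * (2 * n ^ 2)) := by field_simp; ring
    _ ≤ n * c / (n * (2 * n ^ 2)) := by gcongr
    _ = _ := by field_simp

/-- Probabilities under a uniform distribution on a finite set. -/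
theorem le_prEvent_of_cnt {α : Type*} [Fintype α] {ν : PMF α} {S P : α → Prop} {δ : ℝ}
    (hν : IsUniformOn ν {a | S a}) (h : (cnt (fun a => S a ∧ ¬ P a) : ℝ) ≤ δ * cnt S) :
    ENNReal.ofReal (1 - δ) ≤ prEvent ν P := by
  have hcard : ({a | S a} : Set α).ncard = cnt S := by
    rw [cnt, Set.ncard_eq_toFinset_card']
    congr 1
    ext a
    simp
  have hS : cnt S ≠ 0 := by
    intro h0
    have h1 := ν.tsum_coe
    have h2 : ∀ a, ν a = 0 := fun a => by
      rw [hν a, if_neg]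
      intro ha
      have : a ∈ Finset.univ.filter S := by simpa using ha
      rw [cnt, Finset.card_eq_zero] at h0
      simp [h0] at this
    simp [h2] at h1
  have h1 : prEvent ν P = (cnt fun a => S a ∧ P a) * (cnt S : ℝ≥0∞)⁻¹ := by
    rw [prEvent, tsum_fintype, cnt, ← nsmul_eq_mul, ← Finset.sum_const, Finset.sum_filter]
    refine Finset.sum_congr rfl fun a _ => ?_
    rw [hν a, hcard]
    by_cases h1 : S a <;> by_cases h2 : P a <;> simp [h1, h2]
  have h2 : cnt S ≤ cnt (fun a => S a ∧ P a) + cnt fun a => S a ∧ ¬ P a :=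
    cnt_le_add fun a ha => by by_cases h : P a <;> simp [ha, h]
  have h3 : (cnt S : ℝ) ≤ cnt (fun a => S a ∧ P a) + cnt fun a => S a ∧ ¬ P a := by
    exact_mod_cast h2
  rw [h1, ← div_eq_mul_inv, ENNReal.le_div_iff_mul_le (Or.inl (by exact_mod_cast hS))
    (Or.inl (ENNReal.natCast_ne_top _)), ← ENNReal.ofReal_natCast, ← ENNReal.ofReal_natCast,
    ← ENNReal.ofReal_mul' (Nat.cast_nonneg _)]
  exact ENNReal.ofReal_le_ofReal (by linarith)

theorem ncard_regular_extensions (F : SimpleGraph (Fin n)) (d : ℕ) {x y : Fin n} (hxy : x ≠ y) :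
    {K : SimpleGraph (Fin n) | IsRegularGraph K d ∧
      F ⊔ SimpleGraph.fromEdgeSet {s(x, y)} ≤ K}.ncard = (extsWith F d x y).card := by
  rw [← Set.ncard_coe_finset]
  congr 1
  ext K
  rw [Set.mem_ofPred_eq, Finset.mem_coe, extsWith, Finset.mem_filter, mem_exts, sup_le_iff,
    and_assoc]
  refine and_congr_right fun _ => and_congr_right fun _ => ⟨fun h => h ?_, fun h a b hab => ?_⟩
  · simp [hxy]
  · rw [SimpleGraph.fromEdgeSet_adj, Set.mem_singleton_iff, Sym2.eq_iff] at hab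
    rcases hab.1 with ⟨rfl, rfl⟩ | ⟨rfl, rfl⟩
    · exact h
    · exact h.symm

/-- **Lemma 2.1.** For all `η, ε ∈ (0,1]` there is `C > 0` such that for every `c > 0` and
all sufficiently large `n`: for every `d` with `C·log n ≤ d ≤ n−1`, `dn` even, and every
integer `m` with `ε·d·n ≤ m ≤ dn/2`, if `F ~ F⁻(n,d,m)` (realised here as the second
coordinate of the uniform distribution `ν` on pairs `(K,F)` with `K` `d`-regular, `F ⊆ K`
and `e(K) = e(F) + m`), then with probability at least `1 − c·n⁻²`, for all non-edges
`e, f` of `F`: `|{K ∈ 𝒦_d(n) : F+e ⊆ K}| ≤ (1+η)·|{K ∈ 𝒦_d(n) : F+f ⊆ K}|`. -/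
theorem main_technical_lemma_lower :
    ∀ η ε : ℝ, 0 < η → η ≤ 1 → 0 < ε → ε ≤ 1 →
      ∃ C : ℝ, 0 < C ∧
        ∀ c : ℝ, 0 < c →
          ∃ n₀ : ℕ, ∀ n : ℕ, n₀ ≤ n →
            ∀ d : ℕ, C * Real.log n ≤ (d : ℝ) → d ≤ n - 1 → Even (d * n) →
              ∀ m : ℕ, ε * d * n ≤ (m : ℝ) → 2 * m ≤ d * n →
                ∀ ν : PMF (SimpleGraph (Fin n) × SimpleGraph (Fin n)),
                  IsUniformOn ν {w | IsRegularGraph w.1 d ∧ w.2 ≤ w.1 ∧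
                    edgeCount w.1 = edgeCount w.2 + m} →
                  ENNReal.ofReal (1 - c / (n : ℝ) ^ 2) ≤
                    prEvent ν (fun w =>
                      ∀ e f : Sym2 (Fin n), ¬ e.IsDiag → ¬ f.IsDiag →
                        e ∉ w.2.edgeSet → f ∉ w.2.edgeSet →
                        ({K : SimpleGraph (Fin n) | IsRegularGraph K d ∧
                            w.2 ⊔ SimpleGraph.fromEdgeSet {e} ≤ K}.ncard : ℝ) ≤
                          (1 + η) *
                            ({K : SimpleGraph (Fin n) | IsRegularGraph K d ∧
                              w.2 ⊔ SimpleGraph.fromEdgeSet {f} ≤ K}.ncard : ℝ)) := by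
  intro η ε hη hη1 hε hε1
  obtain ⟨γ, σ, D₀, n₁, hγ, hγ1, hσ, hcomp⟩ := exists_card_extsWith_compare hη hη1 hε hε1
  refine ⟨max (16 / (γ * ε) ^ 2) (max D₀ 1),
    lt_max_of_lt_right (lt_max_of_lt_right one_pos), fun c hc => ?_⟩
  have hev := ((tendsto_natCast_atTop_atTop (R := ℝ)).eventually eventually_mul_exp_le).and
    ((eventually_atypical_le hγ hσ hc).and
      (((tendsto_natCast_atTop_atTop (R := ℝ)).eventually_ge_atTop (max n₁ (4 / c))).and
        (Filter.eventually_ge_atTop 3)))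
  obtain ⟨n₀, hn₀⟩ := Filter.eventually_atTop.1 hev
  refine ⟨n₀, fun n hn d hCd hd heven m hm hmd ν hν => ?_⟩
  obtain ⟨hsexp, hatyp, hnlarge, hn3⟩ := hn₀ n hn
  have hn0 : (0 : ℝ) < n := by exact_mod_cast (by omega : 0 < n)
  have hlog : 1 ≤ Real.log n := by
    rw [Real.le_log_iff_exp_le hn0]
    have : (3 : ℝ) ≤ n := by exact_mod_cast hn3
    linarith [Real.exp_one_lt_d9]
  have hCd' : max (16 / (γ * ε) ^ 2) (max D₀ 1) ≤ (d : ℝ) :=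
    (le_mul_of_one_le_right (le_max_of_le_right (le_max_of_le_right zero_le_one)) hlog).trans hCd
  have hD : D₀ ≤ d := (le_max_left _ _).trans ((le_max_right _ _).trans hCd')
  have hd1 : (1 : ℝ) ≤ d := (le_max_right _ _).trans ((le_max_right _ _).trans hCd')
  have hd0 : 0 < d := by exact_mod_cast one_pos.trans_le hd1
  have hd0' : (0 : ℝ) < d := by linarith
  obtain ⟨N, hN'⟩ := heven
  have hN : 2 * N = d * n := by omega
  have hNR : 2 * (N : ℝ) = d * n := by exact_mod_cast hN
  have hNpos : (0 : ℝ) < N := by nlinarith [mul_pos hd0' hn0]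
  have hmN : m ≤ N := by omega
  have hmN' : (m : ℝ) ≤ N := by exact_mod_cast hmN
  obtain ⟨p, hp⟩ : ∃ p : ℝ, p * N = m := ⟨m / N, div_mul_cancel₀ _ hNpos.ne'⟩
  have hp1 : p ≤ 1 := le_of_mul_le_mul_right (by linarith) hNpos
  have hpε : ε ≤ p := by
    refine le_of_mul_le_mul_right (a := (N : ℝ)) ?_ hNpos
    rw [hp]
    have := mul_pos hε hNpos
    have : ε * (2 * N) ≤ m := by rw [hNR]; linarith
    linarith
  have hp0 : 0 ≤ p := hε.le.trans hpε
  have hk : ((N - m : ℕ) : ℝ) = (1 - p) * N := by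
    rw [Nat.cast_sub hmN, ← hp]
    ring
  have hbad := cnt_isPair_not_good_le (n := n) hN hd0 hd (by omega) (Nat.sub_le N m) hk hp0 hp1
    hγ.le hγ1 hσ (s := (n : ℝ) ^ (3 / 4 : ℝ)) (by positivity) (by
      have : (n : ℝ) ^ (3 / 4 : ℝ) ≤ (n : ℝ) ^ (1 : ℝ) :=
        Real.rpow_le_rpow_of_exponent_le (by exact_mod_cast (by omega : 1 ≤ n)) (by norm_num)
      rw [Real.rpow_one] at this
      linarith) hsexp
  have hunb := unbalanced_prob_le hε hγ hpε (le_max_left _ _) hc (by omega : 1 ≤ n)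
    ((le_max_right _ _).trans hnlarge) hCd
  have hsum : c / (2 * (n : ℝ) ^ 2) + c / (2 * (n : ℝ) ^ 2) = c / (n : ℝ) ^ 2 := by
    field_simp
    norm_num
  have hδ := hbad.trans (mul_le_mul_of_nonneg_right
    ((add_le_add hunb hatyp).trans_eq hsum) (Nat.cast_nonneg _))
  have hpair : ∀ w : SimpleGraph (Fin n) × SimpleGraph (Fin n),
      (IsRegularGraph w.1 d ∧ w.2 ≤ w.1 ∧ edgeCount w.1 = edgeCount w.2 + m) ↔
        IsPair d (N - m) w := fun w => by
    refine and_congr_right fun hK => and_congr_right fun _ => ?_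
    have := card_edges_of_regular hK
    rw [edgeCount_eq, edgeCount_eq]
    omega
  simp only [hpair] at hν
  refine le_prEvent_of_cnt hν (le_trans (Nat.cast_le.2 (cnt_mono fun w hw => ?_)) hδ)
  refine ⟨hw.1, fun hgood => hw.2 fun e f he hf heF hfF => ?_⟩
  induction e with | _ x y
  induction f with | _ x' y'
  rw [Sym2.mk_isDiag_iff] at he hf
  rw [SimpleGraph.mem_edgeSet] at heF hfF
  rw [ncard_regular_extensions _ _ he, ncard_regular_extensions _ _ hf]
  refine hcomp n d ((le_max_left _ _).trans hnlarge) hD (by omega) p hpε hp1 w.2 ?_ hgood.1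
    hgood.2 ⟨w.1, mem_exts.2 ⟨hw.1.1, hw.1.2.1⟩⟩ x y x' y' he heF hf hfF
  rw [hw.1.2.2, hk]
  linear_combination (p - 1) * hNR

end Sandwich
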